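/- Let q > 1, p ∈ ℝ, and let Ω_t, t ∈ [0,T), be a smooth solution of the normalized Gauss curvature flow ∂h/∂t = −θ(t) h^p 𝒦 f / Ṽ_{γ,q}(Ω_t, ∇h + hx) + h (with f a positive smooth even function on S^{n−1} and initial body a smooth, closed, origin-symmetric, strictly convex body). Then the Gaussian chord integral is preserved along the flow: d/dt I_{γ,q}(Ω_t) = 0 for all t, i.e. I_{γ,q}(Ω_t) = I_{γ,q}(Ω₀). -/

import Mathlib

open MeasureTheory Filter
open scoped RealInnerProductSpace Topology

noncomputable section

/-- `n`-dimensional Euclidean space. -/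
abbrev Eucl (n : ℕ) := EuclideanSpace ℝ (Fin n)

/-- The support function of `K`, as a `1`-homogeneous function on all of `ℝⁿ`;
its restriction to the unit sphere is the usual support function `h_K`. -/
def suppFun {n : ℕ} (K : Set (Eucl n)) (x : Eucl n) : ℝ :=
  sSup ((fun y => ⟪x, y⟫) '' K)

/-- The radial function `ρ_K(ξ) = max {c > 0 : c • ξ ∈ K}`. -/
def radFun {n : ℕ} (K : Set (Eucl n)) (ξ : Eucl n) : ℝ :=
  sSup {c : ℝ | 0 < c ∧ c • ξ ∈ K}

/-- `Ṽ_{γ,q}(K, y) = 2 e^{-|y|²/2} ∫_K e^{-|z|²/2} |z - y|^{-(n-q+1)} dz`. -/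
def Vtilde {n : ℕ} (q : ℝ) (K : Set (Eucl n)) (y : Eucl n) : ℝ :=
  2 * Real.exp (-‖y‖ ^ 2 / 2) *
    ∫ z in K, Real.exp (-‖z‖ ^ 2 / 2) / ‖z - y‖ ^ ((n : ℝ) - q + 1)

/-- The Gaussian chord integral
`I_{γ,q}(K) = ∫_K ∫_K e^{-(|z|²+|y|²)/2} |z - y|^{-(n-q+1)} dz dy`. -/
def gaussChord {n : ℕ} (q : ℝ) (K : Set (Eucl n)) : ℝ :=
  ∫ y in K, ∫ z in K,
    Real.exp (-(‖z‖ ^ 2 + ‖y‖ ^ 2) / 2) / ‖z - y‖ ^ ((n : ℝ) - q + 1)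

/-- The rank-one map `v ↦ ⟪x, v⟫ • x` (orthogonal projection onto `ℝ x` when `‖x‖ = 1`). -/
def rankOne {n : ℕ} (x : Eucl n) : Eucl n →ₗ[ℝ] Eucl n where
  toFun v := ⟪x, v⟫ • x
  map_add' v w := by simp [inner_add_right, add_smul]
  map_smul' c v := by simp [inner_smul_right, mul_smul]

/-- For the `1`-homogeneous extension `H` of the support function `h` of a smooth strictly
convex body, `fderiv ℝ (gradient H) x` vanishes on `ℝ x` and restricts on the tangent space
`x^⊥` to the matrix of principal radii of curvature `∇²h + h I`.  Adding the rank-one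
projection onto `ℝ x` therefore makes the determinant of the ambient map equal to
`det(∇²h + h I)`, the reciprocal Gauss curvature. -/
def curvDet {n : ℕ} (H : Eucl n → ℝ) (x : Eucl n) : ℝ :=
  LinearMap.det
    ((fderiv ℝ (fun y => gradient H y) x : Eucl n →ₗ[ℝ] Eucl n) + rankOne x)

/-- A convex body in `ℝⁿ` which is origin-symmetric and has smooth, strictly convex
boundary (encoded via smoothness of its support function away from the origin and
positivity of the curvature determinant on the sphere). -/
def IsSmoothBody {n : ℕ} (Ω : Set (Eucl n)) : Prop :=
  IsCompact Ω ∧ Convex ℝ Ω ∧ (0 : Eucl n) ∈ interior Ω ∧ (∀ x ∈ Ω, -x ∈ Ω) ∧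
    ContDiffOn ℝ (⊤ : ℕ∞) (suppFun Ω) {(0 : Eucl n)}ᶜ ∧
    ∀ x ∈ Metric.sphere (0 : Eucl n) 1, 0 < curvDet (suppFun Ω) x

/-- The normalizing factor
`θ(t) = (∫_{S^{n-1}} Ṽ_{γ,q}(Ω, ρ(ξ)ξ) ρ(ξ)ⁿ dξ) / (∫_{S^{n-1}} h(x)^p f(x) dx)`. -/
def theta {n : ℕ} (q p : ℝ) (f : Eucl n → ℝ) (K : Set (Eucl n)) : ℝ :=
  (∫ ξ in Metric.sphere (0 : Eucl n) 1,
      Vtilde q K (radFun K ξ • ξ) * radFun K ξ ^ n ∂μH[(n : ℝ) - 1]) /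
  ∫ x in Metric.sphere (0 : Eucl n) 1, suppFun K x ^ p * f x ∂μH[(n : ℝ) - 1]

/-- The right-hand side `-θ h^p 𝒦 f / Ṽ_{γ,q}(K, ∇h + h x) + h` of the normalized Gauss
curvature flow, expressed through the `1`-homogeneous extension of the support function
(`gradient (suppFun K) x = ∇h(x) + h(x) x` and `𝒦 = (curvDet (suppFun K) x)⁻¹`). -/
def flowRHS {n : ℕ} (q p : ℝ) (f : Eucl n → ℝ) (K : Set (Eucl n)) (x : Eucl n) : ℝ :=
  -(theta q p f K) * suppFun K x ^ p * (curvDet (suppFun K) x)⁻¹ * f x /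
      Vtilde q K (gradient (suppFun K) x) + suppFun K x

/-- `K : ℝ → Set (Eucl n)` solves the normalized Gauss curvature flow
`∂h/∂t = -θ(t) h^p 𝒦 f / Ṽ_{γ,q} + h` on the time set `S`. -/
def IsGaussChordFlow {n : ℕ} (q p : ℝ) (f : Eucl n → ℝ) (S : Set ℝ)
    (K : ℝ → Set (Eucl n)) : Prop :=
  ∀ t ∈ S, ∀ x ∈ Metric.sphere (0 : Eucl n) 1,
    HasDerivWithinAt (fun s => suppFun (K s) x) (flowRHS q p f (K t) x) S t

/-- The Wulff shape (Aleksandrov body) of a function `φ` on the unit sphere. -/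
def wulff {n : ℕ} (φ : Eucl n → ℝ) : Set (Eucl n) :=
  {x | ∀ u ∈ Metric.sphere (0 : Eucl n) 1, ⟪x, u⟫ ≤ φ u}

/-- `ν` is a Gauss map of `∂K`: at every boundary point `y` of `K`, `ν y` is an outer
unit normal, i.e. `y · ν y = h_K(ν y)`. -/
def IsGaussMap {n : ℕ} (K : Set (Eucl n)) (ν : Eucl n → Eucl n) : Prop :=
  ∀ y ∈ frontier K, ν y ∈ Metric.sphere (0 : Eucl n) 1 ∧ ⟪y, ν y⟫ = suppFun K (ν y)

section
/-- A compact convex set with the origin in its interior. -/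
structure IsBody {n : ℕ} (K : Set (Eucl n)) : Prop where
  isCompact : IsCompact K
  convex : Convex ℝ K
  zero_mem_interior : (0 : Eucl n) ∈ interior K

variable {n : ℕ} {K : Set (Eucl n)}

theorem IsSmoothBody.isBody (h : IsSmoothBody K) : IsBody K := ⟨h.1, h.2.1, h.2.2.1⟩

theorem IsBody.zero_mem (h : IsBody K) : (0 : Eucl n) ∈ K := interior_subset h.zero_mem_interior

theorem bddAbove_inner_image (hK : IsCompact K) (x : Eucl n) :
    BddAbove ((fun y => ⟪x, y⟫) '' K) :=
  (hK.image (by fun_prop)).bddAbove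

theorem inner_le_suppFun (hK : IsCompact K) (x : Eucl n) {y : Eucl n} (hy : y ∈ K) :
    ⟪x, y⟫ ≤ suppFun K x :=
  le_csSup (bddAbove_inner_image hK x) ⟨y, hy, rfl⟩

theorem IsBody.exists_inner_eq_suppFun (h : IsBody K) (x : Eucl n) :
    ∃ y ∈ K, ⟪x, y⟫ = suppFun K x := by
  obtain ⟨y, hy, hmax⟩ := h.isCompact.exists_isMaxOn ⟨0, h.zero_mem⟩
    (f := fun y => ⟪x, y⟫) (by fun_prop)
  refine ⟨y, hy, le_antisymm (inner_le_suppFun h.isCompact x hy) ?_⟩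
  refine csSup_le ⟨_, 0, h.zero_mem, rfl⟩ ?_
  rintro _ ⟨z, hz, rfl⟩
  exact hmax hz

theorem IsBody.suppFun_smul (h : IsBody K) {c : ℝ} (hc : 0 ≤ c) (x : Eucl n) :
    suppFun K (c • x) = c * suppFun K x := by
  apply le_antisymm
  · obtain ⟨y, hy, hyx⟩ := h.exists_inner_eq_suppFun (c • x)
    rw [← hyx, real_inner_smul_left]
    exact mul_le_mul_of_nonneg_left (inner_le_suppFun h.isCompact x hy) hc
  · obtain ⟨y, hy, hyx⟩ := h.exists_inner_eq_suppFun x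
    rw [← hyx, ← real_inner_smul_left]
    exact inner_le_suppFun h.isCompact _ hy

theorem IsBody.suppFun_eq_norm_mul (h : IsBody K) (x : Eucl n) :
    suppFun K x = ‖x‖ * suppFun K (‖x‖⁻¹ • x) := by
  rcases eq_or_ne x 0 with rfl | hx
  · simpa using h.suppFun_smul le_rfl (0 : Eucl n)
  · rw [← h.suppFun_smul (norm_nonneg x), smul_smul, mul_inv_cancel₀ (norm_ne_zero_iff.2 hx),
      one_smul]

theorem IsBody.inner_lt_suppFun (h : IsBody K) {x y : Eucl n} (hx : x ≠ 0)
    (hy : y ∈ interior K) : ⟪x, y⟫ < suppFun K x := by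
  have hc : Tendsto (fun ε : ℝ => y + ε • x) (𝓝[>] 0) (𝓝 y) := by
    have : Tendsto (fun ε : ℝ => y + ε • x) (𝓝 0) (𝓝 (y + (0 : ℝ) • x)) :=
      Continuous.tendsto (by fun_prop) 0
    simpa using this.mono_left nhdsWithin_le_nhds
  obtain ⟨ε, hε, hε0⟩ := ((hc.eventually (isOpen_interior.mem_nhds hy)).and
    self_mem_nhdsWithin).exists
  have := inner_le_suppFun h.isCompact x (interior_subset hε)
  rw [inner_add_right, real_inner_smul_right, real_inner_self_eq_norm_sq] at this
  have h2 : 0 < ε * ‖x‖ ^ 2 := mul_pos hε0 (pow_pos (norm_pos_iff.2 hx) 2)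
  linarith

theorem IsBody.suppFun_pos (h : IsBody K) {x : Eucl n} (hx : x ≠ 0) : 0 < suppFun K x := by
  simpa using h.inner_lt_suppFun hx h.zero_mem_interior

theorem IsBody.exists_suppFun_lt (h : IsBody K) {y : Eucl n} (hy : y ∉ K) :
    ∃ x ∈ Metric.sphere (0 : Eucl n) 1, suppFun K x < ⟪x, y⟫ := by
  obtain ⟨f, u, hf, hu⟩ := geometric_hahn_banach_closed_point h.convex h.isCompact.isClosed hy
  set x := (InnerProductSpace.toDual ℝ (Eucl n)).symm f with hx
  have hfx : ∀ z, f z = ⟪x, z⟫ := fun z => by simp [hx]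
  have hlt : suppFun K x < ⟪x, y⟫ := by
    obtain ⟨z, hz, hzx⟩ := h.exists_inner_eq_suppFun x
    rw [← hzx, ← hfx, ← hfx]
    exact (hf z hz).trans hu
  have hx0 : x ≠ 0 := by
    intro h0
    have := hf 0 h.zero_mem
    rw [hfx, h0] at this
    rw [hfx, h0] at hu
    simp at this hu
    linarith
  have hnx : 0 < ‖x‖⁻¹ := inv_pos.2 (norm_pos_iff.2 hx0)
  refine ⟨‖x‖⁻¹ • x, by simp [norm_smul, hx0], ?_⟩
  rw [h.suppFun_smul hnx.le, real_inner_smul_left]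
  exact mul_lt_mul_of_pos_left hlt hnx

theorem IsBody.mem_of_forall_inner_le (h : IsBody K) {y : Eucl n}
    (hy : ∀ x ∈ Metric.sphere (0 : Eucl n) 1, ⟪x, y⟫ ≤ suppFun K x) : y ∈ K := by
  by_contra hyK
  obtain ⟨x, hx, hlt⟩ := h.exists_suppFun_lt hyK
  exact absurd (hy x hx) (not_le.2 hlt)

theorem IsBody.suppFun_le_add (h : IsBody K) {R : ℝ} (hR : K ⊆ Metric.closedBall 0 R)
    (x x' : Eucl n) : suppFun K x ≤ suppFun K x' + R * ‖x - x'‖ := by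
  obtain ⟨y, hy, hyx⟩ := h.exists_inner_eq_suppFun x
  have h1 := inner_le_suppFun h.isCompact x' hy
  have h2 : ⟪x - x', y⟫ ≤ ‖x - x'‖ * ‖y‖ := real_inner_le_norm _ _
  have h3 : ‖y‖ ≤ R := by simpa using hR hy
  have h4 : ‖x - x'‖ * ‖y‖ ≤ ‖x - x'‖ * R := by gcongr
  rw [inner_sub_left] at h2
  linarith

theorem eq_gradient_suppFun (hK : IsCompact K) {x y : Eucl n}
    (hd : DifferentiableAt ℝ (suppFun K) x) (hy : y ∈ K) (hyx : ⟪x, y⟫ = suppFun K x) :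
    y = gradient (suppFun K) x := by
  have hmin : IsLocalMin (fun z => suppFun K z - ⟪z, y⟫) x := by
    refine Eventually.of_forall fun z => ?_
    have := inner_le_suppFun hK z hy
    simp only [hyx, sub_self]
    linarith
  have hg := hd.hasGradientAt.hasFDerivAt
  have h2 : HasFDerivAt (fun z : Eucl n => ⟪z, y⟫) (InnerProductSpace.toDual ℝ (Eucl n) y) x := by
    have := (InnerProductSpace.toDual ℝ (Eucl n) y).hasFDerivAt (x := x)
    refine this.congr_of_eventuallyEq (Eventually.of_forall fun z => ?_)
    simp [real_inner_comm]
  have := hmin.hasFDerivAt_eq_zero (hg.sub h2)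
  rw [sub_eq_zero] at this
  exact ((InnerProductSpace.toDual ℝ (Eucl n)).injective this).symm

theorem IsBody.gradient_spec (h : IsBody K) {x : Eucl n}
    (hd : DifferentiableAt ℝ (suppFun K) x) :
    gradient (suppFun K) x ∈ K ∧ ⟪x, gradient (suppFun K) x⟫ = suppFun K x := by
  obtain ⟨y, hy, hyx⟩ := h.exists_inner_eq_suppFun x
  rw [← eq_gradient_suppFun h.isCompact hd hy hyx]
  exact ⟨hy, hyx⟩

theorem IsBody.radFun_mem (h : IsBody K) {ξ : Eucl n} (hξ : ξ ≠ 0) :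
    0 < radFun K ξ ∧ radFun K ξ • ξ ∈ K := by
  have hne : {c : ℝ | 0 < c ∧ c • ξ ∈ K}.Nonempty := by
    have hc : Tendsto (fun ε : ℝ => ε • ξ) (𝓝[>] 0) (𝓝 0) := by
      have : Tendsto (fun ε : ℝ => ε • ξ) (𝓝 0) (𝓝 ((0 : ℝ) • ξ)) :=
        Continuous.tendsto (by fun_prop) 0
      simpa using this.mono_left nhdsWithin_le_nhds
    obtain ⟨ε, hε, hε0⟩ := ((hc.eventually (mem_interior_iff_mem_nhds.1 h.zero_mem_interior)).and
      self_mem_nhdsWithin).exists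
    exact ⟨ε, hε0, hε⟩
  have hbdd : BddAbove {c : ℝ | 0 < c ∧ c • ξ ∈ K} := by
    obtain ⟨R, hR⟩ := h.isCompact.isBounded.subset_closedBall 0
    refine ⟨R / ‖ξ‖, fun c hc => ?_⟩
    have := hR hc.2
    rw [mem_closedBall_zero_iff, norm_smul, Real.norm_of_nonneg hc.1.le] at this
    rwa [le_div_iff₀ (norm_pos_iff.2 hξ)]
  obtain ⟨c, hc⟩ := hne
  refine ⟨hc.1.trans_le (le_csSup hbdd hc), ?_⟩
  have hcl : IsClosed {c : ℝ | c • ξ ∈ K} := h.isCompact.isClosed.preimage (by fun_prop)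
  exact hcl.closure_subset_iff.2 (fun c hc => hc.2) (csSup_mem_closure ⟨c, hc⟩ hbdd)

theorem IsBody.le_radFun (h : IsBody K) {ξ : Eucl n} (hξ : ξ ≠ 0) {c : ℝ} (hc : c • ξ ∈ K) :
    c ≤ radFun K ξ := by
  rcases le_or_gt c 0 with h0 | h0
  · exact h0.trans (h.radFun_mem hξ).1.le
  · refine le_csSup ?_ ⟨h0, hc⟩
    obtain ⟨R, hR⟩ := h.isCompact.isBounded.subset_closedBall 0
    refine ⟨R / ‖ξ‖, fun c hc => ?_⟩
    have := hR hc.2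
    rw [mem_closedBall_zero_iff, norm_smul, Real.norm_of_nonneg hc.1.le] at this
    rwa [le_div_iff₀ (norm_pos_iff.2 hξ)]

theorem IsBody.smul_mem (h : IsBody K) {y : Eucl n} (hy : y ∈ K) {c : ℝ} (h0 : 0 ≤ c)
    (h1 : c ≤ 1) : c • y ∈ K := by
  have := h.convex hy h.zero_mem h0 (sub_nonneg.2 h1) (by ring)
  simpa using this

theorem IsBody.smul_mem_iff_le_radFun (h : IsBody K) {ξ : Eucl n} (hξ : ξ ≠ 0) {c : ℝ}
    (hc : 0 ≤ c) : c • ξ ∈ K ↔ c ≤ radFun K ξ := by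
  refine ⟨h.le_radFun hξ, fun hle => ?_⟩
  obtain ⟨hp, hm⟩ := h.radFun_mem hξ
  have := h.smul_mem hm (c := c / radFun K ξ) (by positivity) ((div_le_one hp).2 hle)
  rwa [smul_smul, div_mul_cancel₀ _ hp.ne'] at this

theorem IsBody.smul_mem_interior (h : IsBody K) {y : Eucl n} (hy : y ∈ K) {c : ℝ} (h0 : 0 ≤ c)
    (h1 : c < 1) : c • y ∈ interior K := by
  have := h.convex.combo_interior_self_mem_interior h.zero_mem_interior hy (sub_pos.2 h1) h0
    (by ring)
  simpa using this

theorem IsBody.radFun_smul (h : IsBody K) {ξ : Eucl n} (hξ : ξ ≠ 0) {c : ℝ} (hc : 0 < c) :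
    radFun K (c • ξ) = c⁻¹ * radFun K ξ := by
  have hcξ : c • ξ ≠ 0 := smul_ne_zero hc.ne' hξ
  apply le_antisymm
  · have := (h.radFun_mem hcξ).2
    rw [smul_smul] at this
    have := h.le_radFun hξ this
    rw [inv_mul_eq_div, le_div_iff₀ hc]
    exact this
  · apply h.le_radFun hcξ
    rw [smul_smul, mul_comm, ← mul_assoc, mul_inv_cancel₀ hc.ne', one_mul]
    exact (h.radFun_mem hξ).2

end

section

theorem eventually_forall_mem_of_isCompact {α β : Type*} [TopologicalSpace β] {l : Filter α}
    {C : Set β} (hC : IsCompact C) {P : α → β → Prop}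
    (h : ∀ x ∈ C, ∀ᶠ p in l ×ˢ 𝓝 x, P p.1 p.2) : ∀ᶠ a in l, ∀ x ∈ C, P a x := by
  have h1 : {p : α × β | P p.1 p.2} ∈ l ×ˢ 𝓝ˢ C := hC.mem_prod_nhdsSet_of_forall h
  obtain ⟨u, hu, v, hv, huv⟩ := mem_prod_iff.1 h1
  filter_upwards [hu] with a ha x hx
  exact huv (Set.mk_mem_prod ha (subset_of_mem_nhdsSet hv hx))

/-- A family of convex bodies whose support functions are pointwise continuous in time. -/
structure IsBodyFamily {n : ℕ} (S : Set ℝ) (K : ℝ → Set (Eucl n)) : Prop where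
  isBody : ∀ t ∈ S, IsBody (K t)
  continuousOn : ∀ x ∈ Metric.sphere (0 : Eucl n) 1, ContinuousOn (fun s => suppFun (K s) x) S

namespace IsBodyFamily

variable {n : ℕ} {S : Set ℝ} {K : ℝ → Set (Eucl n)} {t : ℝ}

theorem tendsto_suppFun_apply (h : IsBodyFamily S K) (ht : t ∈ S) (x : Eucl n) :
    Tendsto (fun s => suppFun (K s) x) (𝓝[S] t) (𝓝 (suppFun (K t) x)) := by
  have hev : (fun s => ‖x‖ * suppFun (K s) (‖x‖⁻¹ • x)) =ᶠ[𝓝[S] t]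
      fun s => suppFun (K s) x := by
    filter_upwards [self_mem_nhdsWithin] with s hs
    exact ((h.isBody s hs).suppFun_eq_norm_mul x).symm
  refine Tendsto.congr' hev ?_
  rw [(h.isBody t ht).suppFun_eq_norm_mul x]
  rcases eq_or_ne x 0 with rfl | hx
  · simp [tendsto_const_nhds]
  · exact (h.continuousOn _ (by simp [norm_smul, hx]) t ht).const_mul _

theorem eventually_subset_closedBall (h : IsBodyFamily S K) (ht : t ∈ S) :
    ∃ R > 0, ∀ᶠ s in 𝓝[S] t, K s ⊆ Metric.closedBall 0 R := by
  set b := EuclideanSpace.basisFun (Fin n) ℝ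
  set m : ℝ → ℝ := fun s => ∑ i, (suppFun (K s) (b i) + suppFun (K s) (-b i))
  have hm : Tendsto m (𝓝[S] t) (𝓝 (m t)) :=
    tendsto_finsetSum _ fun i _ =>
      (h.tendsto_suppFun_apply ht _).add (h.tendsto_suppFun_apply ht _)
  have hmt : 0 ≤ m t := Finset.sum_nonneg fun i _ => by
    have hb : b i ≠ 0 := b.toBasis.ne_zero i
    exact add_nonneg ((h.isBody t ht).suppFun_pos hb).le
      ((h.isBody t ht).suppFun_pos (neg_ne_zero.2 hb)).le
  refine ⟨m t + 1, by positivity, ?_⟩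
  filter_upwards [self_mem_nhdsWithin, hm.eventually (gt_mem_nhds (lt_add_one _))]
    with s hs hlt y hy
  rw [mem_closedBall_zero_iff]
  refine le_trans ?_ hlt.le
  conv_lhs => rw [← b.sum_repr' y]
  refine (norm_sum_le _ _).trans (Finset.sum_le_sum fun i _ => ?_)
  have hc := (h.isBody s hs).isCompact
  have hb : b i ≠ 0 := b.toBasis.ne_zero i
  have h1 := inner_le_suppFun hc (b i) hy
  have h2 := inner_le_suppFun hc (-b i) hy
  have h3 := ((h.isBody s hs).suppFun_pos hb).le
  have h4 := ((h.isBody s hs).suppFun_pos (neg_ne_zero.2 hb)).le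
  rw [inner_neg_left] at h2
  rw [norm_smul, b.norm_eq_one, mul_one, Real.norm_eq_abs, abs_le]
  constructor <;> linarith

theorem tendsto_suppFun (h : IsBodyFamily S K) (ht : t ∈ S) (x : Eucl n) :
    Tendsto (fun p : ℝ × Eucl n => suppFun (K p.1) p.2) (𝓝[S] t ×ˢ 𝓝 x)
      (𝓝 (suppFun (K t) x)) := by
  obtain ⟨R, hR0, hR⟩ := h.eventually_subset_closedBall ht
  have h1 : Tendsto (fun p : ℝ × Eucl n => suppFun (K p.1) x) (𝓝[S] t ×ˢ 𝓝 x)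
      (𝓝 (suppFun (K t) x)) := (h.tendsto_suppFun_apply ht x).comp tendsto_fst
  have h2 : Tendsto (fun p : ℝ × Eucl n => R * ‖p.2 - x‖) (𝓝[S] t ×ˢ 𝓝 x) (𝓝 0) := by
    have : Tendsto (fun y : Eucl n => R * ‖y - x‖) (𝓝 x) (𝓝 (R * ‖x - x‖)) :=
      Continuous.tendsto (by fun_prop) x
    simp only [sub_self, norm_zero, mul_zero] at this
    exact this.comp tendsto_snd
  have hev : ∀ᶠ p : ℝ × Eucl n in 𝓝[S] t ×ˢ 𝓝 x, p.1 ∈ S ∧ K p.1 ⊆ Metric.closedBall 0 R :=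
    tendsto_fst.eventually (Filter.Eventually.and self_mem_nhdsWithin hR)
  refine tendsto_of_tendsto_of_tendsto_of_le_of_le' (g := fun p : ℝ × Eucl n =>
    suppFun (K p.1) x - R * ‖p.2 - x‖) (h := fun p : ℝ × Eucl n =>
    suppFun (K p.1) x + R * ‖p.2 - x‖) ?_ ?_ ?_ ?_
  · simpa using h1.sub h2
  · simpa using h1.add h2
  · filter_upwards [hev] with p hp
    have := (h.isBody _ hp.1).suppFun_le_add hp.2 x p.2
    rw [norm_sub_rev] at this
    linarith
  · filter_upwards [hev] with p hp
    exact (h.isBody _ hp.1).suppFun_le_add hp.2 p.2 x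

theorem tendsto_prod_assoc_swap {y x : Eucl n} {F : ℝ × Eucl n → ℝ} {a : ℝ}
    (hF : Tendsto F (𝓝[S] t ×ˢ 𝓝 x) (𝓝 a)) :
    Tendsto (fun p : (ℝ × Eucl n) × Eucl n => F (p.1.1, p.2))
      ((𝓝[S] t ×ˢ 𝓝 y) ×ˢ 𝓝 x) (𝓝 a) :=
  hF.comp (Tendsto.prodMk (tendsto_fst.comp tendsto_fst) tendsto_snd)

theorem eventually_mem (h : IsBodyFamily S K) (ht : t ∈ S) {y : Eucl n}
    (hy : y ∈ interior (K t)) : ∀ᶠ p : ℝ × Eucl n in 𝓝[S] t ×ˢ 𝓝 y, p.2 ∈ K p.1 := by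
  have key : ∀ᶠ p : ℝ × Eucl n in 𝓝[S] t ×ˢ 𝓝 y, ∀ x ∈ Metric.sphere (0 : Eucl n) 1,
      ⟪x, p.2⟫ ≤ suppFun (K p.1) x := by
    refine eventually_forall_mem_of_isCompact
      (P := fun (p : ℝ × Eucl n) (x : Eucl n) => ⟪x, p.2⟫ ≤ suppFun (K p.1) x)
      (isCompact_sphere 0 1) fun x hx => ?_
    have hx0 : x ≠ 0 := Metric.ne_of_mem_sphere hx one_ne_zero
    have h1 := tendsto_prod_assoc_swap (y := y) (h.tendsto_suppFun ht x)
    have h2 : Tendsto (fun p : (ℝ × Eucl n) × Eucl n => ⟪p.2, p.1.2⟫)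
        ((𝓝[S] t ×ˢ 𝓝 y) ×ˢ 𝓝 x) (𝓝 ⟪x, y⟫) :=
      Tendsto.inner tendsto_snd (tendsto_snd.comp tendsto_fst)
    exact (h2.eventually_lt h1 ((h.isBody t ht).inner_lt_suppFun hx0 hy)).mono fun p hp => hp.le
  filter_upwards [key, tendsto_fst.eventually self_mem_nhdsWithin] with p hp hs
  exact (h.isBody _ hs).mem_of_forall_inner_le hp

theorem eventually_notMem (h : IsBodyFamily S K) (ht : t ∈ S) {y : Eucl n}
    (hy : y ∉ K t) : ∀ᶠ p : ℝ × Eucl n in 𝓝[S] t ×ˢ 𝓝 y, p.2 ∉ K p.1 := by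
  obtain ⟨x, hx, hlt⟩ := (h.isBody t ht).exists_suppFun_lt hy
  have h1 : Tendsto (fun p : ℝ × Eucl n => suppFun (K p.1) x) (𝓝[S] t ×ˢ 𝓝 y)
      (𝓝 (suppFun (K t) x)) := (h.tendsto_suppFun_apply ht x).comp tendsto_fst
  have h2 : Tendsto (fun p : ℝ × Eucl n => ⟪x, p.2⟫) (𝓝[S] t ×ˢ 𝓝 y) (𝓝 ⟪x, y⟫) :=
    Tendsto.inner tendsto_const_nhds tendsto_snd
  filter_upwards [h1.eventually_lt h2 hlt, tendsto_fst.eventually self_mem_nhdsWithin]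
    with p hp hs hmem
  exact absurd (inner_le_suppFun (h.isBody _ hs).isCompact x hmem) (not_le.2 hp)

theorem tendsto_radFun (h : IsBodyFamily S K) (ht : t ∈ S) {ξ : Eucl n} (hξ : ξ ≠ 0) :
    Tendsto (fun p : ℝ × Eucl n => radFun (K p.1) p.2) (𝓝[S] t ×ˢ 𝓝 ξ)
      (𝓝 (radFun (K t) ξ)) := by
  have hev : ∀ᶠ p : ℝ × Eucl n in 𝓝[S] t ×ˢ 𝓝 ξ, p.1 ∈ S ∧ p.2 ≠ 0 :=
    (tendsto_fst.eventually self_mem_nhdsWithin).and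
      (tendsto_snd.eventually (isOpen_ne.mem_nhds hξ))
  have hsc : ∀ c : ℝ, Tendsto (fun p : ℝ × Eucl n => (p.1, c • p.2)) (𝓝[S] t ×ˢ 𝓝 ξ)
      (𝓝[S] t ×ˢ 𝓝 (c • ξ)) := fun c =>
    tendsto_fst.prodMk (tendsto_snd.const_smul c)
  obtain ⟨hp, hm⟩ := (h.isBody t ht).radFun_mem hξ
  rw [tendsto_order]
  constructor
  · intro a ha
    obtain ⟨b, hb1, hb2⟩ := exists_between (max_lt ha hp)
    have hb0 : 0 < b := (le_max_right _ _).trans_lt hb1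
    have h_int : b • ξ ∈ interior (K t) := by
      have := (h.isBody t ht).smul_mem_interior hm (c := b / radFun (K t) ξ) (by positivity)
        ((div_lt_one hp).2 hb2)
      rwa [smul_smul, div_mul_cancel₀ _ hp.ne'] at this
    filter_upwards [hev, (hsc b).eventually (h.eventually_mem ht h_int)] with p hp1 hp2
    exact ((le_max_left _ _).trans_lt hb1).trans_le ((h.isBody _ hp1.1).le_radFun hp1.2 hp2)
  · intro a ha
    have hnot : a • ξ ∉ K t := fun hmem =>
      absurd ((h.isBody t ht).le_radFun hξ hmem) (not_le.2 ha)
    filter_upwards [hev, (hsc a).eventually (h.eventually_notMem ht hnot)] with p hp1 hp2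
    by_contra hle
    exact hp2 (((h.isBody _ hp1.1).smul_mem_iff_le_radFun hp1.2 (hp.trans ha).le).2 (not_lt.1 hle))

theorem tendsto_gradient (h : IsBodyFamily S K) (ht : t ∈ S)
    (hd : ∀ s ∈ S, ∀ x ≠ 0, DifferentiableAt ℝ (suppFun (K s)) x) {x : Eucl n} (hx : x ≠ 0) :
    Tendsto (fun p : ℝ × Eucl n => gradient (suppFun (K p.1)) p.2) (𝓝[S] t ×ˢ 𝓝 x)
      (𝓝 (gradient (suppFun (K t)) x)) := by
  obtain ⟨R, hR0, hR⟩ := h.eventually_subset_closedBall ht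
  have hev : ∀ᶠ p : ℝ × Eucl n in 𝓝[S] t ×ˢ 𝓝 x,
      (p.1 ∈ S ∧ K p.1 ⊆ Metric.closedBall 0 R) ∧ p.2 ≠ 0 :=
    (tendsto_fst.eventually (Filter.Eventually.and self_mem_nhdsWithin hR)).and
      (tendsto_snd.eventually (isOpen_ne.mem_nhds hx))
  refine IsCompact.tendsto_nhds_of_unique_mapClusterPt (isCompact_closedBall (0 : Eucl n) R) ?_ ?_
  · filter_upwards [hev] with p hp
    exact hp.1.2 ((h.isBody _ hp.1.1).gradient_spec (hd _ hp.1.1 _ hp.2)).1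
  · intro y _ hy
    obtain ⟨u, hu, huy⟩ := mapClusterPt_iff_ultrafilter.1 hy
    have hle : (u : Filter (ℝ × Eucl n)) ≤ 𝓝[S] t ×ˢ 𝓝 x := hu
    refine eq_gradient_suppFun (h.isBody t ht).isCompact (hd t ht x hx) ?_ ?_
    · refine (h.isBody t ht).mem_of_forall_inner_le fun z _ => ?_
      have h1 : Tendsto (fun p : ℝ × Eucl n => suppFun (K p.1) z) u (𝓝 (suppFun (K t) z)) :=
        ((h.tendsto_suppFun_apply ht z).comp tendsto_fst).mono_left hle
      have h2 : Tendsto (fun p : ℝ × Eucl n => ⟪z, gradient (suppFun (K p.1)) p.2⟫) u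
          (𝓝 ⟪z, y⟫) := Tendsto.inner tendsto_const_nhds huy
      refine le_of_tendsto_of_tendsto h2 h1 ?_
      filter_upwards [hle hev] with p hp
      exact inner_le_suppFun (h.isBody _ hp.1.1).isCompact z
        ((h.isBody _ hp.1.1).gradient_spec (hd _ hp.1.1 _ hp.2)).1
    · have h1 := (h.tendsto_suppFun ht x).mono_left hle
      have h2 : Tendsto (fun p : ℝ × Eucl n => ⟪p.2, gradient (suppFun (K p.1)) p.2⟫) u
          (𝓝 ⟪x, y⟫) := Tendsto.inner (tendsto_snd.mono_left hle) huy
      refine tendsto_nhds_unique h2 (h1.congr' ?_)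
      filter_upwards [hle hev] with p hp
      exact ((h.isBody _ hp.1.1).gradient_spec (hd _ hp.1.1 _ hp.2)).2.symm

end IsBodyFamily

end

section

open scoped ENNReal Pointwise

theorem measure_isOpen_le_of_uniform_ball {X : Type*} [MetricSpace X] [SecondCountableTopology X]
    [MeasurableSpace X] [BorelSpace X] (μ ν : Measure X) [IsFiniteMeasure μ] [IsFiniteMeasure ν]
    {r : ℕ → ℝ} (hr : Tendsto r atTop (𝓝 0)) {m v : ℕ → ℝ≥0∞}
    (hm : ∀ k x, μ (Metric.ball x (r k)) = m k) (hv : ∀ k x, ν (Metric.ball x (r k)) = v k)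
    (hv0 : ∀ k, v k ≠ 0) (hvt : ∀ k, v k ≠ ∞) {c : ℝ≥0∞}
    (hc : Tendsto (fun k => m k / v k) atTop (𝓝 c)) {U : Set X} (hU : IsOpen U) :
    μ U ≤ c * ν U := by
  set A : ℕ → Set (X × X) := fun k => {p | p.1 ∈ U ∧ p.2 ∈ U ∧ dist p.1 p.2 < r k}
  have hA : ∀ k, MeasurableSet (A k) := fun k =>
    (measurable_fst hU.measurableSet).inter
      ((measurable_snd hU.measurableSet).inter
        (measurableSet_lt (f := fun p : X × X => dist p.1 p.2) (g := fun _ => r k)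
          (measurable_fst.dist measurable_snd) measurable_const))
  set F : ℕ → X → ℝ≥0∞ := fun k x => ν (Prod.mk x ⁻¹' A k) / v k
  have hFm : ∀ k, Measurable (F k) := fun k =>
    (measurable_measure_prodMk_left (hA k)).div_const _
  have hlim : ∀ x ∈ U, 1 ≤ liminf (fun k => F k x) atTop := by
    intro x hx
    obtain ⟨ε, hε, hball⟩ := Metric.isOpen_iff.1 hU x hx
    refine le_liminf_of_le (by isBoundedDefault) ?_
    filter_upwards [hr.eventually (gt_mem_nhds hε)] with k hk
    have hset : Metric.ball x (r k) ⊆ Prod.mk x ⁻¹' A k := fun y hy =>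
      ⟨hx, hball (Metric.ball_subset_ball hk.le hy), by rwa [dist_comm]⟩
    calc (1 : ℝ≥0∞) = v k / v k := (ENNReal.div_self (hv0 k) (hvt k)).symm
      _ ≤ F k x := ENNReal.div_le_div_right (by rw [← hv k x]; exact measure_mono hset) _
  have h_int : ∀ k, ∫⁻ x, F k x ∂μ ≤ m k / v k * ν U := by
    intro k
    have h1 : ∫⁻ x, F k x ∂μ = (∫⁻ x, ν (Prod.mk x ⁻¹' A k) ∂μ) / v k := by
      simp only [F, div_eq_mul_inv]
      rw [lintegral_mul_const _ (measurable_measure_prodMk_left (hA k))]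
    rw [h1, ← Measure.prod_apply (hA k), Measure.prod_apply_symm (hA k)]
    have h2 : ∫⁻ y, μ ((fun x => (x, y)) ⁻¹' A k) ∂ν ≤ ∫⁻ y in U, m k ∂ν := by
      rw [← lintegral_indicator hU.measurableSet]
      refine lintegral_mono fun y => ?_
      by_cases hy : y ∈ U
      · simp only [Set.indicator_of_mem hy]
        rw [← hm k y]
        exact measure_mono fun x hx => hx.2.2
      · simp [A, hy]
    rw [lintegral_const, Measure.restrict_apply_univ] at h2
    rw [ENNReal.mul_div_right_comm.symm]
    exact ENNReal.div_le_div_right h2 _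
  calc μ U = ∫⁻ x in U, 1 ∂μ := by simp
    _ ≤ ∫⁻ x in U, liminf (fun k => F k x) atTop ∂μ := by
        refine lintegral_mono_ae ?_
        filter_upwards [ae_restrict_mem hU.measurableSet] with x hx using hlim x hx
    _ ≤ ∫⁻ x, liminf (fun k => F k x) atTop ∂μ := setLIntegral_le_lintegral _ _
    _ ≤ liminf (fun k => ∫⁻ x, F k x ∂μ) atTop := lintegral_liminf_le hFm
    _ ≤ liminf (fun k => m k / v k * ν U) atTop :=
        liminf_le_liminf (Eventually.of_forall h_int)
    _ = c * ν U := (ENNReal.Tendsto.mul_const hc (Or.inr (measure_ne_top _ _))).liminf_eq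

/-- Two finite measures for which the measure of a ball depends only on its radius are
proportional. -/
theorem exists_eq_smul_of_uniform_ball {X : Type*} [MetricSpace X] [SecondCountableTopology X]
    [MeasurableSpace X] [BorelSpace X] (μ ν : Measure X) [IsFiniteMeasure μ] [IsFiniteMeasure ν]
    (hμ0 : μ ≠ 0) (hν0 : ν ≠ 0) {m v : ℝ → ℝ≥0∞}
    (hm : ∀ r x, μ (Metric.ball x r) = m r) (hv : ∀ r x, ν (Metric.ball x r) = v r) :
    ∃ c : ℝ≥0∞, c ≠ 0 ∧ c ≠ ∞ ∧ μ = c • ν := by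
  have pos : ∀ (ρ : Measure X) (_ : ρ ≠ 0) (w : ℝ → ℝ≥0∞)
      (_ : ∀ r x, ρ (Metric.ball x r) = w r) (r : ℝ), 0 < r → w r ≠ 0 := by
    intro ρ hρ w hw r hr h0
    apply hρ
    rw [← Measure.measure_univ_eq_zero]
    refine measure_null_of_locally_null _ fun x _ => ⟨Metric.ball x r, ?_, by rw [hw, h0]⟩
    simpa using Metric.ball_mem_nhds x hr
  have ne : Nonempty X := by
    by_contra hne
    rw [not_nonempty_iff] at hne
    exact hμ0 (Measure.eq_zero_of_isEmpty μ)
  obtain ⟨x0⟩ := ne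
  obtain ⟨c, φ, hφ, hc⟩ := CompactSpace.tendsto_subseq
    (fun k : ℕ => m (1 / ((k : ℝ) + 1)) / v (1 / ((k : ℝ) + 1)))
  set r : ℕ → ℝ := fun k => 1 / ((φ k : ℝ) + 1)
  have hr0 : ∀ k, 0 < r k := fun k => by positivity
  have hr : Tendsto r atTop (𝓝 0) :=
    tendsto_one_div_add_atTop_nhds_zero_nat.comp hφ.tendsto_atTop
  have hmt : ∀ r, m r ≠ ∞ := fun r => by rw [← hm r x0]; exact measure_ne_top _ _
  have hvt : ∀ r, v r ≠ ∞ := fun r => by rw [← hv r x0]; exact measure_ne_top _ _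
  have hm0 : ∀ k, m (r k) ≠ 0 := fun k => pos μ hμ0 m hm _ (hr0 k)
  have hv0 : ∀ k, v (r k) ≠ 0 := fun k => pos ν hν0 v hv _ (hr0 k)
  have hc' : Tendsto (fun k => v (r k) / m (r k)) atTop (𝓝 c⁻¹) := by
    refine (tendsto_inv_iff.2 hc).congr fun k => ?_
    exact ENNReal.inv_div (Or.inl (hvt _)) (Or.inl (hv0 k))
  have h1 : ∀ U, IsOpen U → μ U ≤ c * ν U := fun U hU =>
    measure_isOpen_le_of_uniform_ball μ ν hr (fun k x => hm (r k) x) (fun k x => hv (r k) x)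
      hv0 (fun k => hvt _) hc hU
  have h2 : ∀ U, IsOpen U → ν U ≤ c⁻¹ * μ U := fun U hU =>
    measure_isOpen_le_of_uniform_ball ν μ hr (fun k x => hv (r k) x) (fun k x => hm (r k) x)
      hm0 (fun k => hmt _) hc' hU
  have hc0 : c ≠ 0 := by
    rintro rfl
    have := h1 Set.univ isOpen_univ
    rw [zero_mul, nonpos_iff_eq_zero, Measure.measure_univ_eq_zero] at this
    exact hμ0 this
  have hct : c ≠ ∞ := by
    rintro rfl
    have := h2 Set.univ isOpen_univ
    rw [ENNReal.inv_top, zero_mul, nonpos_iff_eq_zero, Measure.measure_univ_eq_zero] at this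
    exact hν0 this
  refine ⟨c, hc0, hct, ?_⟩
  have hU : ∀ U, IsOpen U → μ U = (c • ν) U := by
    intro U hU
    rw [Measure.smul_apply, smul_eq_mul]
    refine le_antisymm (h1 U hU) ?_
    calc c * ν U ≤ c * (c⁻¹ * μ U) := by gcongr; exact h2 U hU
      _ = μ U := by rw [← mul_assoc, ENNReal.mul_inv_cancel hc0 hct, one_mul]
  exact ext_of_generate_finite {s | IsOpen s} BorelSpace.measurable_eq isPiSystem_isOpen
    (fun s hs => hU s hs) (hU _ isOpen_univ)

variable {n : ℕ}

/-- The `(n - 1)`-dimensional Hausdorff measure on the unit sphere of `ℝⁿ`. -/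
def sphereHausdorff (n : ℕ) : Measure (Metric.sphere (0 : Eucl n) 1) :=
  (μH[(n : ℝ) - 1] : Measure (Eucl n)).comap Subtype.val

theorem sphereHausdorff_apply {s : Set (Metric.sphere (0 : Eucl n) 1)} :
    sphereHausdorff n s = μH[(n : ℝ) - 1] (Subtype.val '' s) :=
  (MeasurableEmbedding.subtype_coe Metric.isClosed_sphere.measurableSet).comap_apply _ _

theorem finrank_orthogonal_cast {x : Eucl n} (hx : x ≠ 0) :
    ((Module.finrank ℝ (ℝ ∙ x)ᗮ : ℕ) : ℝ) = (n : ℝ) - 1 := by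
  have h1 := Submodule.finrank_add_finrank_orthogonal (ℝ ∙ x)
  rw [finrank_span_singleton hx, finrank_euclideanSpace_fin] at h1
  have h2 : (n : ℝ) = 1 + (Module.finrank ℝ (ℝ ∙ x)ᗮ : ℕ) := by exact_mod_cast h1.symm
  linarith

theorem norm_sq_add_of_mem_orthogonal {x v : Eucl n} (hx : ‖x‖ = 1) (hv : v ∈ (ℝ ∙ x)ᗮ)
    (a : ℝ) : ‖a • x + v‖ ^ 2 = a ^ 2 + ‖v‖ ^ 2 := by
  rw [Submodule.mem_orthogonal_singleton_iff_inner_right] at hv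
  rw [norm_add_sq_real, real_inner_smul_left, hv, norm_smul, hx]
  simp

theorem lipschitz_normalize {E F : Type*} [SeminormedAddCommGroup E] [NormedAddCommGroup F]
    [NormedSpace ℝ F] {g : E → F} (hg : LipschitzWith 1 g) (h1 : ∀ v, 1 ≤ ‖g v‖) :
    LipschitzWith 2 (fun v => ‖g v‖⁻¹ • g v) := by
  refine LipschitzWith.of_dist_le_mul fun v w => ?_
  have hgd : ‖g v - g w‖ ≤ dist v w := by
    simpa [dist_eq_norm] using hg.dist_le_mul v w
  have hv := h1 v
  have hw := h1 w
  have hv0 : 0 < ‖g v‖ := by linarith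
  have hw0 : 0 < ‖g w‖ := by linarith
  have key : ‖g v‖⁻¹ • g v - ‖g w‖⁻¹ • g w
      = ‖g v‖⁻¹ • (g v - g w) + (‖g v‖⁻¹ - ‖g w‖⁻¹) • g w := by
    rw [smul_sub, sub_smul]; abel
  rw [dist_eq_norm, key]
  have e1 : ‖‖g v‖⁻¹ • (g v - g w)‖ ≤ ‖g v - g w‖ := by
    rw [norm_smul, norm_inv, norm_norm]
    exact mul_le_of_le_one_left (norm_nonneg _) (inv_le_one_of_one_le₀ hv)
  have e2 : ‖(‖g v‖⁻¹ - ‖g w‖⁻¹) • g w‖ ≤ ‖g v - g w‖ := by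
    have : (‖g v‖⁻¹ - ‖g w‖⁻¹) = ‖g v‖⁻¹ * (‖g w‖ - ‖g v‖) * ‖g w‖⁻¹ := by
      field_simp
    rw [this, norm_smul, norm_mul, norm_mul, norm_inv, norm_inv, norm_norm, norm_norm,
      mul_assoc, inv_mul_cancel₀ hw0.ne', mul_one, Real.norm_eq_abs]
    have h3 := abs_norm_sub_norm_le (g w) (g v)
    rw [norm_sub_rev] at h3
    calc ‖g v‖⁻¹ * |‖g w‖ - ‖g v‖| ≤ 1 * ‖g v - g w‖ := by
          gcongr
          exact inv_le_one_of_one_le₀ hv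
      _ = _ := one_mul _
  calc _ ≤ ‖g v - g w‖ + ‖g v - g w‖ := (norm_add_le _ _).trans (add_le_add e1 e2)
    _ ≤ _ := by push_cast; linarith

theorem hausdorffMeasure_sphere_lt_top (hn : n ≠ 0) :
    μH[(n : ℝ) - 1] (Metric.sphere (0 : Eucl n) 1) < ∞ := by
  have hd : (0 : ℝ) ≤ (n : ℝ) - 1 := by
    have : (1 : ℝ) ≤ n := by exact_mod_cast Nat.one_le_iff_ne_zero.2 hn
    linarith
  refine (isCompact_sphere (0 : Eucl n) 1).measure_lt_top_of_nhdsWithin fun x hx => ?_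
  have hx1 : ‖x‖ = 1 := by simpa using hx
  have hx0 : x ≠ 0 := fun h => by simp [h] at hx1
  set H := (ℝ ∙ x)ᗮ
  set g : H → Eucl n := fun v => x + v
  have hgn : ∀ v : H, ‖g v‖ ^ 2 = 1 + ‖v‖ ^ 2 := fun v => by
    have := norm_sq_add_of_mem_orthogonal hx1 v.2 1
    simpa [g] using this
  have hg : LipschitzWith 1 g := LipschitzWith.of_dist_le_mul fun v w => by
    simp [g, dist_add_left, Subtype.dist_eq]
  have hg1 : ∀ v, 1 ≤ ‖g v‖ := fun v => by
    have := hgn v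
    nlinarith [sq_nonneg ‖v‖, norm_nonneg (g v)]
  have hL := lipschitz_normalize hg hg1
  refine ⟨(fun v => ‖g v‖⁻¹ • g v) '' Metric.closedBall (0 : H) 2, ?_, ?_⟩
  · have hopen : {y : Eucl n | 1 / 2 < ⟪x, y⟫} ∈ 𝓝 x := by
      refine (isOpen_lt continuous_const (by fun_prop)).mem_nhds ?_
      simp only [Set.mem_ofPred_eq, real_inner_self_eq_norm_sq, hx1]
      norm_num
    filter_upwards [mem_nhdsWithin_of_mem_nhds hopen, self_mem_nhdsWithin] with y hy hys
    have hy1 : ‖y‖ = 1 := by simpa using hys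
    have hy2 : 1 / 2 < ⟪x, y⟫ := hy
    have hp : 0 < ⟪x, y⟫ := by linarith
    have hmem : ⟪x, y⟫⁻¹ • y - x ∈ H := by
      rw [Submodule.mem_orthogonal_singleton_iff_inner_right, inner_sub_right,
        real_inner_smul_right, real_inner_self_eq_norm_sq, hx1, inv_mul_cancel₀ hp.ne']
      norm_num
    have hgv : g ⟨_, hmem⟩ = ⟪x, y⟫⁻¹ • y := by simp [g]
    have hgnv : ‖g ⟨_, hmem⟩‖ = ⟪x, y⟫⁻¹ := by
      rw [hgv, norm_smul, hy1, mul_one, Real.norm_of_nonneg (inv_nonneg.2 hp.le)]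
    refine ⟨⟨_, hmem⟩, ?_, ?_⟩
    · rw [mem_closedBall_zero_iff]
      have h3 := hgn ⟨_, hmem⟩
      rw [hgnv] at h3
      have h4 : ⟪x, y⟫⁻¹ ≤ 2 := by
        rw [inv_le_comm₀ hp (by norm_num)]
        linarith
      have h5 : 0 < ⟪x, y⟫⁻¹ := inv_pos.2 hp
      nlinarith [norm_nonneg (⟨_, hmem⟩ : H)]
    · change ‖g _‖⁻¹ • g _ = y
      rw [hgnv, hgv, inv_inv, smul_smul, mul_inv_cancel₀ hp.ne', one_smul]
  · refine (hL.hausdorffMeasure_image_le hd _).trans_lt ?_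
    refine ENNReal.mul_lt_top (ENNReal.rpow_lt_top_of_nonneg hd (by simp)) ?_
    rw [← finrank_orthogonal_cast hx0]
    exact (isCompact_closedBall (0 : H) 2).measure_lt_top

theorem hausdorffMeasure_sphere_ne_zero (hn : n ≠ 0) :
    μH[(n : ℝ) - 1] (Metric.sphere (0 : Eucl n) 1) ≠ 0 := by
  have hd : (0 : ℝ) ≤ (n : ℝ) - 1 := by
    have : (1 : ℝ) ≤ n := by exact_mod_cast Nat.one_le_iff_ne_zero.2 hn
    linarith
  have : Nonempty (Fin n) := Fin.pos_iff_nonempty.1 (Nat.pos_of_ne_zero hn)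
  obtain ⟨x, hx1⟩ := exists_norm_eq (Eucl n) (zero_le_one' ℝ)
  have hx0 : x ≠ 0 := fun h => by simp [h] at hx1
  set H := (ℝ ∙ x)ᗮ
  refine ne_of_gt (lt_of_lt_of_le ?_
    (hausdorffMeasure_orthogonalProjectionOnto_le H ((n : ℝ) - 1) _ hd))
  have hsub : Metric.ball (0 : H) 1 ⊆
      H.orthogonalProjectionOnto '' Metric.sphere (0 : Eucl n) 1 := by
    intro v hv
    have hv1 : ‖v‖ < 1 := by simpa using hv
    have h1 : 0 ≤ 1 - ‖v‖ ^ 2 := by nlinarith [norm_nonneg v]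
    refine ⟨Real.sqrt (1 - ‖v‖ ^ 2) • x + v, ?_, ?_⟩
    · rw [mem_sphere_zero_iff_norm]
      have h2 := norm_sq_add_of_mem_orthogonal hx1 v.2 (Real.sqrt (1 - ‖v‖ ^ 2))
      rw [Real.sq_sqrt h1] at h2
      have h3 : ‖Real.sqrt (1 - ‖v‖ ^ 2) • x + (v : Eucl n)‖ ^ 2 = 1 := by
        rw [h2]; simp
      exact (pow_eq_one_iff_of_nonneg (norm_nonneg _) two_ne_zero).1 h3
    · have hxo : x ∈ Hᗮ := by
        rw [Submodule.orthogonal_orthogonal]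
        exact Submodule.mem_span_singleton_self x
      rw [map_add, map_smul, Submodule.orthogonalProjectionOnto_apply_of_mem_orthogonal hxo]
      simp
  refine lt_of_lt_of_le ?_ (measure_mono hsub)
  rw [← finrank_orthogonal_cast hx0]
  exact Metric.measure_ball_pos _ _ one_pos

theorem exists_isometry_apply_eq {x y : Eucl n} (h : ‖x‖ = ‖y‖) :
    ∃ e : Eucl n ≃ₗᵢ[ℝ] Eucl n, e x = y := ⟨_, Submodule.reflection_sub h⟩

theorem image_ball_sphere (e : Eucl n ≃ₗᵢ[ℝ] Eucl n) (x : Metric.sphere (0 : Eucl n) 1)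
    (y : Metric.sphere (0 : Eucl n) 1) (h : e x = y) (r : ℝ) :
    e '' (Subtype.val '' Metric.ball x r) = Subtype.val '' Metric.ball y r := by
  rw [Subtype.image_ball, Subtype.image_ball]
  ext z
  constructor
  · rintro ⟨w, ⟨hw, hws⟩, rfl⟩
    refine ⟨?_, by simpa using hws⟩
    rw [← h]
    simpa [e.dist_map] using hw
  · rintro ⟨hw, hws⟩
    refine ⟨e.symm z, ⟨?_, by simpa using hws⟩, by simp⟩
    have h2 : (x : Eucl n) = e.symm y := by rw [← h]; simp
    rw [h2]
    simpa [e.symm.dist_map] using hw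

theorem exists_sphereHausdorff_eq (hn : n ≠ 0) :
    ∃ c : ℝ≥0∞, c ≠ 0 ∧ c ≠ ∞ ∧
      sphereHausdorff n = c • (volume : Measure (Eucl n)).toSphere := by
  have : Nonempty (Fin n) := Fin.pos_iff_nonempty.1 (Nat.pos_of_ne_zero hn)
  obtain ⟨x0, hx0⟩ := exists_norm_eq (Eucl n) (zero_le_one' ℝ)
  set z : Metric.sphere (0 : Eucl n) 1 := ⟨x0, by simpa using hx0⟩
  have huniv : sphereHausdorff n Set.univ = μH[(n : ℝ) - 1] (Metric.sphere (0 : Eucl n) 1) := by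
    rw [sphereHausdorff_apply, Set.image_univ, Subtype.range_coe]
  have : IsFiniteMeasure (sphereHausdorff n) :=
    ⟨by rw [huniv]; exact hausdorffMeasure_sphere_lt_top hn⟩
  refine exists_eq_smul_of_uniform_ball (sphereHausdorff n) _ ?_ (Measure.toSphere_ne_zero _)
    (m := fun r => sphereHausdorff n (Metric.ball z r))
    (v := fun r => (volume : Measure (Eucl n)).toSphere (Metric.ball z r)) ?_ ?_
  · rw [Ne, ← Measure.measure_univ_eq_zero, huniv]
    exact hausdorffMeasure_sphere_ne_zero hn
  · intro r x
    obtain ⟨e, he⟩ := exists_isometry_apply_eq (x := (x : Eucl n)) (y := z) (by simp [hx0, z])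
    rw [sphereHausdorff_apply, sphereHausdorff_apply, ← image_ball_sphere e x z he r]
    exact (e.toIsometryEquiv.hausdorffMeasure_image _ _).symm
  · intro r x
    obtain ⟨e, he⟩ := exists_isometry_apply_eq (x := (x : Eucl n)) (y := z) (by simp [hx0, z])
    rw [Measure.toSphere_apply' _ measurableSet_ball, Measure.toSphere_apply' _ measurableSet_ball,
      ← image_ball_sphere e x z he r]
    congr 1
    have himg : Set.Ioo (0 : ℝ) 1 • (e '' (Subtype.val '' Metric.ball x r))
        = e '' (Set.Ioo (0 : ℝ) 1 • (Subtype.val '' Metric.ball x r)) := by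
      ext w
      simp only [Set.mem_smul, Set.mem_image]
      constructor
      · rintro ⟨a, ha, _, ⟨u, hu, rfl⟩, rfl⟩
        exact ⟨a • u, ⟨a, ha, u, hu, rfl⟩, by simp⟩
      · rintro ⟨_, ⟨a, ha, u, hu, rfl⟩, rfl⟩
        exact ⟨a, ha, e u, ⟨u, hu, rfl⟩, by simp⟩
    rw [himg, e.image_eq_preimage_symm]
    exact ((LinearIsometryEquiv.measurePreserving e.symm).measure_preimage_equiv
      (f := e.symm.toHomeomorph.toMeasurableEquiv) _).symm

/-- Integrals over the sphere against Hausdorff measure are a fixed positive multiple of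
integrals against the spherical measure induced by Lebesgue measure. -/
theorem exists_setIntegral_sphere_eq (hn : n ≠ 0) :
    ∃ c : ℝ, 0 < c ∧ ∀ φ : Eucl n → ℝ,
      ∫ x in Metric.sphere (0 : Eucl n) 1, φ x ∂μH[(n : ℝ) - 1] =
        c * ∫ x : Metric.sphere (0 : Eucl n) 1, φ x ∂(volume : Measure (Eucl n)).toSphere := by
  obtain ⟨c, hc0, hct, hc⟩ := exists_sphereHausdorff_eq hn
  refine ⟨c.toReal, ENNReal.toReal_pos hc0 hct, fun φ => ?_⟩
  rw [← integral_subtype_comap Metric.isClosed_sphere.measurableSet]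
  change ∫ x : Metric.sphere (0 : Eucl n) 1, φ x ∂(sphereHausdorff n) = _
  rw [hc, integral_smul_measure, smul_eq_mul]

end

section

variable {n : ℕ} {q : ℝ}

/-- The singular kernel `|u|^{-(n-q+1)}`. -/
def chordKernel (q : ℝ) (u : Eucl n) : ℝ := (‖u‖ ^ ((n : ℝ) - q + 1))⁻¹

theorem chordKernel_nonneg (q : ℝ) (u : Eucl n) : 0 ≤ chordKernel q u :=
  inv_nonneg.2 (Real.rpow_nonneg (norm_nonneg _) _)

theorem measurable_chordKernel (q : ℝ) : Measurable (chordKernel q : Eucl n → ℝ) := by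
  unfold chordKernel
  fun_prop

theorem integrableOn_chordKernel (hn : n ≠ 0) (hq : 1 < q) (R : ℝ) :
    IntegrableOn (chordKernel q : Eucl n → ℝ) (Metric.closedBall 0 R) := by
  have : Nonempty (Fin n) := Fin.pos_iff_nonempty.1 (Nat.pos_of_ne_zero hn)
  set r : ℝ := max R 0 + 1
  have hr : 0 < r := by positivity
  refine IntegrableOn.mono_set (t := Metric.ball (0 : Eucl n) r) ?_
    (Metric.closedBall_subset_ball (lt_of_le_of_lt (le_max_left R 0) (lt_add_one _)))
  refine (integrableOn_fun_norm_addHaar (volume : Measure (Eucl n))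
    (f := fun s : ℝ => (s ^ ((n : ℝ) - q + 1))⁻¹)).2 ?_
  have h1 : IntegrableOn (fun s : ℝ => s ^ (q - 2)) (Set.Ioo 0 r) :=
    (intervalIntegral.integrableOn_Ioo_rpow_iff hr).2 (by linarith)
  refine h1.congr_fun (fun s hs => ?_) measurableSet_Ioo
  have hs0 : 0 < s := hs.1
  have hn1 : 1 ≤ n := Nat.one_le_iff_ne_zero.2 hn
  simp only [finrank_euclideanSpace_fin, smul_eq_mul]
  rw [← Real.rpow_natCast s (n - 1), ← Real.rpow_neg hs0.le, ← Real.rpow_add hs0]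
  congr 1
  push_cast [hn1]
  ring

theorem integral_chordKernel_nonneg (q R : ℝ) :
    0 ≤ ∫ u in Metric.closedBall (0 : Eucl n) R, chordKernel q u :=
  integral_nonneg fun _ => chordKernel_nonneg _ _

theorem vtilde_eq_integral (q : ℝ) {K : Set (Eucl n)} (hK : MeasurableSet K) (y : Eucl n) :
    Vtilde q K y = 2 * Real.exp (-‖y‖ ^ 2 / 2) *
      ∫ u, K.indicator (fun z => Real.exp (-‖z‖ ^ 2 / 2)) (y + u) * chordKernel q u := by
  unfold Vtilde
  congr 1
  rw [← integral_indicator hK, ← integral_add_left_eq_self _ y]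
  refine integral_congr_ae (Eventually.of_forall fun u => ?_)
  by_cases h : y + u ∈ K <;> simp [h, chordKernel, div_eq_mul_inv]

theorem norm_indicator_mul_chordKernel_le {K : Set (Eucl n)} {R : ℝ}
    (hK : K ⊆ Metric.closedBall 0 R) {y : Eucl n} (hy : ‖y‖ ≤ R) (u : Eucl n) :
    ‖K.indicator (fun z => Real.exp (-‖z‖ ^ 2 / 2)) (y + u) * chordKernel q u‖ ≤
      (Metric.closedBall (0 : Eucl n) (2 * R)).indicator (chordKernel q) u := by
  by_cases h : y + u ∈ K
  · have h1 : ‖y + u‖ ≤ R := by simpa using hK h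
    have h2 : u ∈ Metric.closedBall (0 : Eucl n) (2 * R) := by
      rw [mem_closedBall_zero_iff]
      calc ‖u‖ = ‖(y + u) - y‖ := by simp
        _ ≤ ‖y + u‖ + ‖y‖ := norm_sub_le _ _
        _ ≤ 2 * R := by linarith
    rw [Set.indicator_of_mem h, Set.indicator_of_mem h2, norm_mul,
      Real.norm_of_nonneg (chordKernel_nonneg _ _), Real.norm_of_nonneg (Real.exp_pos _).le]
    refine mul_le_of_le_one_left (chordKernel_nonneg _ _) (Real.exp_le_one_iff.2 ?_)
    have := sq_nonneg ‖y + u‖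
    linarith
  · rw [Set.indicator_of_notMem h, zero_mul, norm_zero]
    exact Set.indicator_nonneg (fun u _ => chordKernel_nonneg _ _) _

theorem measurable_indicator_mul_chordKernel {K : Set (Eucl n)} (hK : MeasurableSet K)
    (y : Eucl n) :
    Measurable fun u => K.indicator (fun z => Real.exp (-‖z‖ ^ 2 / 2)) (y + u) *
      chordKernel q u := by
  refine Measurable.mul ?_ (measurable_chordKernel q)
  have : Measurable (K.indicator fun z => Real.exp (-‖z‖ ^ 2 / 2)) :=
    Measurable.indicator (by fun_prop) hK
  exact this.comp (measurable_const_add y)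

theorem integrable_indicator_chordKernel (hn : n ≠ 0) (hq : 1 < q) (R : ℝ) :
    Integrable ((Metric.closedBall (0 : Eucl n) R).indicator (chordKernel q)) :=
  (integrable_indicator_iff Metric.isClosed_closedBall.measurableSet).2
    (integrableOn_chordKernel hn hq R)

theorem vtilde_nonneg (q : ℝ) (K : Set (Eucl n)) (y : Eucl n) : 0 ≤ Vtilde q K y := by
  refine mul_nonneg (by positivity) (integral_nonneg fun z => ?_)
  exact div_nonneg (Real.exp_pos _).le (Real.rpow_nonneg (norm_nonneg _) _)

theorem vtilde_le (hn : n ≠ 0) (hq : 1 < q) {K : Set (Eucl n)} (hKm : MeasurableSet K) {R : ℝ}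
    (hK : K ⊆ Metric.closedBall 0 R) {y : Eucl n} (hy : ‖y‖ ≤ R) :
    Vtilde q K y ≤ 2 * ∫ u in Metric.closedBall (0 : Eucl n) (2 * R), chordKernel q u := by
  rw [vtilde_eq_integral q hKm]
  have h1 : ∫ u, K.indicator (fun z => Real.exp (-‖z‖ ^ 2 / 2)) (y + u) * chordKernel q u ≤
      ∫ u in Metric.closedBall (0 : Eucl n) (2 * R), chordKernel q u := by
    rw [← integral_indicator Metric.isClosed_closedBall.measurableSet]
    refine integral_mono_of_nonneg (Eventually.of_forall fun u => ?_)
      (integrable_indicator_chordKernel hn hq _)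
      (Eventually.of_forall fun u =>
        (le_abs_self _).trans (norm_indicator_mul_chordKernel_le hK hy u))
    exact mul_nonneg (Set.indicator_nonneg (fun _ _ => (Real.exp_pos _).le) _)
      (chordKernel_nonneg _ _)
  have h2 : Real.exp (-‖y‖ ^ 2 / 2) ≤ 1 := by
    refine Real.exp_le_one_iff.2 ?_
    have := sq_nonneg ‖y‖
    linarith
  have h3 := integral_chordKernel_nonneg (n := n) q (2 * R)
  calc _ ≤ 2 * Real.exp (-‖y‖ ^ 2 / 2) *
        ∫ u in Metric.closedBall (0 : Eucl n) (2 * R), chordKernel q u := by gcongr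
    _ ≤ 2 * 1 * ∫ u in Metric.closedBall (0 : Eucl n) (2 * R), chordKernel q u := by gcongr
    _ = _ := by ring

theorem vtilde_pos (hn : n ≠ 0) (hq : 1 < q) {K : Set (Eucl n)} (hK : IsBody K) (y : Eucl n) :
    0 < Vtilde q K y := by
  obtain ⟨R, hR⟩ := hK.isCompact.isBounded.subset_closedBall (0 : Eucl n)
  have hKm := hK.isCompact.isClosed.measurableSet
  set R' := max R ‖y‖
  have hK' : K ⊆ Metric.closedBall 0 R' :=
    hR.trans (Metric.closedBall_subset_closedBall (le_max_left _ _))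
  rw [vtilde_eq_integral q hKm]
  refine mul_pos (by positivity) ?_
  have h_int : Integrable fun u =>
      K.indicator (fun z => Real.exp (-‖z‖ ^ 2 / 2)) (y + u) * chordKernel q u :=
    (integrable_indicator_chordKernel hn hq (2 * R')).mono'
      (measurable_indicator_mul_chordKernel hKm y).aestronglyMeasurable
      (Eventually.of_forall fun u =>
        norm_indicator_mul_chordKernel_le hK' (le_max_right _ _) u)
  rw [integral_pos_iff_support_of_nonneg (fun u => ?_) h_int]
  · have hopen : IsOpen ((fun u => y + u) ⁻¹' interior K ∩ {0}ᶜ) :=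
      (isOpen_interior.preimage (continuous_const_add y)).inter isOpen_compl_singleton
    have : Nonempty (Fin n) := Fin.pos_iff_nonempty.1 (Nat.pos_of_ne_zero hn)
    have hne : ((fun u => y + u) ⁻¹' interior K ∩ {0}ᶜ).Nonempty := by
      have h1 : Dense ({(0 : Eucl n)}ᶜ) := dense_compl_singleton 0
      refine h1.inter_open_nonempty _ (isOpen_interior.preimage (continuous_const_add y))
        ⟨-y, ?_⟩
      simpa using hK.zero_mem_interior
    refine (hopen.measure_pos volume hne).trans_le (measure_mono ?_)
    rintro u ⟨hu, hu0⟩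
    have hu1 : y + u ∈ K := interior_subset hu
    rw [Function.mem_support, Set.indicator_of_mem hu1]
    have : 0 < ‖u‖ := norm_pos_iff.2 hu0
    exact mul_ne_zero (Real.exp_pos _).ne' (inv_ne_zero (Real.rpow_pos_of_pos this _).ne')
  · exact mul_nonneg (Set.indicator_nonneg (fun _ _ => (Real.exp_pos _).le) _)
      (chordKernel_nonneg _ _)

theorem IsBodyFamily.tendsto_vtilde (hn : n ≠ 0) (hq : 1 < q) {S : Set ℝ} {K : ℝ → Set (Eucl n)}
    (h : IsBodyFamily S K) {t : ℝ} (ht : t ∈ S) (y : Eucl n) :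
    Tendsto (fun p : ℝ × Eucl n => Vtilde q (K p.1) p.2) (𝓝[S] t ×ˢ 𝓝 y)
      (𝓝 (Vtilde q (K t) y)) := by
  obtain ⟨R, hR0, hR⟩ := h.eventually_subset_closedBall ht
  set R' := max R (‖y‖ + 1)
  have hev : ∀ᶠ p : ℝ × Eucl n in 𝓝[S] t ×ˢ 𝓝 y,
      (p.1 ∈ S ∧ K p.1 ⊆ Metric.closedBall 0 R') ∧ ‖p.2‖ ≤ R' := by
    have h1 : ∀ᶠ s in 𝓝[S] t, s ∈ S ∧ K s ⊆ Metric.closedBall 0 R' := by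
      filter_upwards [hR, self_mem_nhdsWithin] with s hs hsS using
        ⟨hsS, hs.trans (Metric.closedBall_subset_closedBall (le_max_left _ _))⟩
    have h2 : ∀ᶠ z in 𝓝 y, ‖z‖ ≤ R' := by
      filter_upwards [(continuous_norm.tendsto y).eventually (gt_mem_nhds (lt_add_one ‖y‖))]
        with z hz using hz.le.trans (le_max_right _ _)
    exact (tendsto_fst.eventually h1).and (tendsto_snd.eventually h2)
  have hev2 : (fun p : ℝ × Eucl n => 2 * Real.exp (-‖p.2‖ ^ 2 / 2) *
      ∫ u, (K p.1).indicator (fun z => Real.exp (-‖z‖ ^ 2 / 2)) (p.2 + u) * chordKernel q u)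
      =ᶠ[𝓝[S] t ×ˢ 𝓝 y] fun p => Vtilde q (K p.1) p.2 := by
    filter_upwards [hev] with p hp
    exact (vtilde_eq_integral q (h.isBody _ hp.1.1).isCompact.isClosed.measurableSet _).symm
  have hKm := (h.isBody t ht).isCompact.isClosed.measurableSet
  refine Tendsto.congr' hev2 ?_
  rw [vtilde_eq_integral q hKm]
  refine Tendsto.mul ?_ ?_
  · have : Tendsto (fun z : Eucl n => 2 * Real.exp (-‖z‖ ^ 2 / 2)) (𝓝 y)
        (𝓝 (2 * Real.exp (-‖y‖ ^ 2 / 2))) := Continuous.tendsto (by fun_prop) y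
    exact this.comp tendsto_snd
  refine tendsto_integral_filter_of_dominated_convergence
    ((Metric.closedBall (0 : Eucl n) (2 * R')).indicator (chordKernel q)) ?_ ?_
    (integrable_indicator_chordKernel hn hq _) ?_
  · filter_upwards [hev] with p hp
    exact (measurable_indicator_mul_chordKernel
      (h.isBody _ hp.1.1).isCompact.isClosed.measurableSet _).aestronglyMeasurable
  · filter_upwards [hev] with p hp
    exact Eventually.of_forall fun u => norm_indicator_mul_chordKernel_le hp.1.2 hp.2 u
  · have hfr : ∀ᵐ u, y + u ∉ frontier (K t) := by
      have h0 : volume (frontier (K t)) = 0 := (h.isBody t ht).convex.addHaar_frontier volume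
      have h1 : volume ((fun u => y + u) ⁻¹' frontier (K t)) = 0 := by
        rw [measure_preimage_add]; exact h0
      exact measure_eq_zero_iff_ae_notMem.1 h1
    filter_upwards [hfr] with u hu
    refine Tendsto.mul_const _ ?_
    have hadd : Tendsto (fun p : ℝ × Eucl n => (p.1, p.2 + u)) (𝓝[S] t ×ˢ 𝓝 y)
        (𝓝[S] t ×ˢ 𝓝 (y + u)) := tendsto_fst.prodMk (tendsto_snd.add_const u)
    by_cases hin : y + u ∈ K t
    · have h_int : y + u ∈ interior (K t) := by
        by_contra hni
        exact hu ⟨subset_closure hin, hni⟩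
      rw [Set.indicator_of_mem hin]
      have h3 : Tendsto (fun p : ℝ × Eucl n => Real.exp (-‖p.2 + u‖ ^ 2 / 2))
          (𝓝[S] t ×ˢ 𝓝 y) (𝓝 (Real.exp (-‖y + u‖ ^ 2 / 2))) := by
        have : Tendsto (fun z : Eucl n => Real.exp (-‖z + u‖ ^ 2 / 2)) (𝓝 y)
          (𝓝 (Real.exp (-‖y + u‖ ^ 2 / 2))) := Continuous.tendsto (by fun_prop) y
        exact this.comp tendsto_snd
      refine h3.congr' ?_
      filter_upwards [hadd.eventually (h.eventually_mem ht h_int)] with p hp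
      rw [Set.indicator_of_mem hp]
    · rw [Set.indicator_of_notMem hin]
      refine tendsto_const_nhds.congr' ?_
      filter_upwards [hadd.eventually (h.eventually_notMem ht hin)] with p hp
      rw [Set.indicator_of_notMem hp]

theorem isBodyFamily_const {K : Set (Eucl n)} (hK : IsBody K) :
    IsBodyFamily Set.univ fun _ => K :=
  ⟨fun _ _ => hK, fun _ _ => continuousOn_const⟩

theorem continuous_vtilde (hn : n ≠ 0) (hq : 1 < q) {K : Set (Eucl n)} (hK : IsBody K) :
    Continuous (Vtilde q K) := by
  rw [continuous_iff_continuousAt]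
  intro y
  have h1 : Tendsto (fun p : ℝ × Eucl n => Vtilde q K p.2) (𝓝[Set.univ] 0 ×ˢ 𝓝 y)
      (𝓝 (Vtilde q K y)) :=
    (isBodyFamily_const hK).tendsto_vtilde hn hq (Set.mem_univ (0 : ℝ)) y
  have h2 : Tendsto (fun z : Eucl n => ((0 : ℝ), z)) (𝓝 y) (𝓝[Set.univ] 0 ×ˢ 𝓝 y) := by
    rw [nhdsWithin_univ]
    exact tendsto_const_nhds.prodMk tendsto_id
  have h3 := h1.comp h2
  rw [Function.comp_def] at h3
  exact h3

theorem continuousOn_radFun {K : Set (Eucl n)} (hK : IsBody K) :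
    ContinuousOn (radFun K) {0}ᶜ := by
  intro ξ hξ
  have h1 := (isBodyFamily_const hK).tendsto_radFun (Set.mem_univ 0) hξ
  rw [nhdsWithin_univ] at h1
  exact (h1.comp (tendsto_const_nhds.prodMk tendsto_id)).mono_left nhdsWithin_le_nhds

/-- The bilinear form whose diagonal is the Gaussian chord integral. -/
def chordForm (q : ℝ) (K L : Set (Eucl n)) : ℝ :=
  ∫ y in K, ∫ z in L,
    Real.exp (-(‖z‖ ^ 2 + ‖y‖ ^ 2) / 2) / ‖z - y‖ ^ ((n : ℝ) - q + 1)

theorem setIntegral_exp_div_eq_vtilde (q : ℝ) (L : Set (Eucl n)) (y : Eucl n) :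
    ∫ z in L, Real.exp (-(‖z‖ ^ 2 + ‖y‖ ^ 2) / 2) / ‖z - y‖ ^ ((n : ℝ) - q + 1) =
      Vtilde q L y / 2 := by
  have : ∀ z : Eucl n, Real.exp (-(‖z‖ ^ 2 + ‖y‖ ^ 2) / 2) / ‖z - y‖ ^ ((n : ℝ) - q + 1) =
      Real.exp (-‖y‖ ^ 2 / 2) * (Real.exp (-‖z‖ ^ 2 / 2) / ‖z - y‖ ^ ((n : ℝ) - q + 1)) := by
    intro z
    rw [mul_div_assoc', ← Real.exp_add]
    congr 2
    ring
  simp_rw [this]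
  rw [integral_const_mul, Vtilde]
  ring

theorem chordForm_eq (q : ℝ) (K L : Set (Eucl n)) :
    chordForm q K L = ∫ y in K, Vtilde q L y / 2 := by
  simp only [chordForm, setIntegral_exp_div_eq_vtilde]

theorem chordForm_comm (hn : n ≠ 0) (hq : 1 < q) {K L : Set (Eucl n)} (hK : IsBody K)
    (hL : IsBody L) : chordForm q K L = chordForm q L K := by
  have hLm := hL.isCompact.isClosed.measurableSet
  unfold chordForm
  rw [integral_integral_swap]
  · refine integral_congr_ae (Eventually.of_forall fun z => ?_)
    refine integral_congr_ae (Eventually.of_forall fun y => ?_)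
    simp only
    rw [add_comm, norm_sub_rev]
  · have hmeas : Measurable (Function.uncurry fun y z : Eucl n =>
        Real.exp (-(‖z‖ ^ 2 + ‖y‖ ^ 2) / 2) / ‖z - y‖ ^ ((n : ℝ) - q + 1)) := by
      simp only [Function.uncurry_def]
      fun_prop
    have hnn : ∀ y z : Eucl n,
        0 ≤ Real.exp (-(‖z‖ ^ 2 + ‖y‖ ^ 2) / 2) / ‖z - y‖ ^ ((n : ℝ) - q + 1) := fun y z =>
      div_nonneg (Real.exp_pos _).le (Real.rpow_nonneg (norm_nonneg _) _)
    refine (integrable_prod_iff hmeas.aestronglyMeasurable).2 ⟨?_, ?_⟩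
    · refine Eventually.of_forall fun y => ?_
      by_contra hni
      have h0 := setIntegral_exp_div_eq_vtilde q L y
      have h1 := integral_undef hni
      simp only [Function.uncurry_apply_pair] at h1
      rw [h1] at h0
      have := vtilde_pos hn hq hL y
      linarith
    · simp only [Function.uncurry_apply_pair, Real.norm_of_nonneg (hnn _ _),
        setIntegral_exp_div_eq_vtilde]
      exact ((continuous_vtilde hn hq hL).div_const 2).continuousOn.integrableOn_compact
        hK.isCompact

theorem gaussChord_sub_eq (hn : n ≠ 0) (hq : 1 < q) {K L : Set (Eucl n)} (hK : IsBody K)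
    (hL : IsBody L) : gaussChord q K - gaussChord q L =
      (∫ y in K, (Vtilde q K y + Vtilde q L y) / 2) -
        ∫ y in L, (Vtilde q K y + Vtilde q L y) / 2 := by
  have hi : ∀ A B : Set (Eucl n), IsBody A → IsBody B →
      IntegrableOn (fun y => Vtilde q B y / 2) A := fun A B hA hB =>
    ((continuous_vtilde hn hq hB).div_const 2).continuousOn.integrableOn_compact hA.isCompact
  simp only [add_div]
  rw [integral_add (hi K K hK hK) (hi K L hK hL), integral_add (hi L K hL hK) (hi L L hL hL)]
  simp only [← chordForm_eq]
  rw [chordForm_comm hn hq hK hL]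
  change chordForm q K K - chordForm q L L = _
  ring

theorem IsBodyFamily.tendsto_gaussChord (hn : n ≠ 0) (hq : 1 < q) {S : Set ℝ}
    {K : ℝ → Set (Eucl n)} (h : IsBodyFamily S K) {t : ℝ} (ht : t ∈ S) :
    Tendsto (fun s => gaussChord q (K s)) (𝓝[S] t) (𝓝 (gaussChord q (K t))) := by
  obtain ⟨R, hR0, hR⟩ := h.eventually_subset_closedBall ht
  have hKt := hR.self_of_nhdsWithin ht
  have hKm : ∀ s ∈ S, MeasurableSet (K s) := fun s hs =>
    (h.isBody s hs).isCompact.isClosed.measurableSet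
  have hform : ∀ s ∈ S, gaussChord q (K s) =
      ∫ y, (K s).indicator (fun y => Vtilde q (K s) y / 2) y := fun s hs => by
    rw [integral_indicator (hKm s hs)]
    exact chordForm_eq q _ _
  rw [hform t ht]
  refine Tendsto.congr' (f₁ := fun s => ∫ y, (K s).indicator (fun y => Vtilde q (K s) y / 2) y)
    ?_ ?_
  · filter_upwards [self_mem_nhdsWithin] with s hs using (hform s hs).symm
  refine tendsto_integral_filter_of_dominated_convergence
    ((Metric.closedBall (0 : Eucl n) R).indicator fun _ =>
      ∫ u in Metric.closedBall (0 : Eucl n) (2 * R), chordKernel q u) ?_ ?_ ?_ ?_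
  · filter_upwards [self_mem_nhdsWithin] with s hs
    exact (((continuous_vtilde hn hq (h.isBody s hs)).div_const 2).measurable.indicator
      (hKm s hs)).aestronglyMeasurable
  · filter_upwards [hR, self_mem_nhdsWithin] with s hs hsS
    refine Eventually.of_forall fun y => ?_
    by_cases hy : y ∈ K s
    · rw [Set.indicator_of_mem hy, Set.indicator_of_mem (hs hy),
        Real.norm_of_nonneg (div_nonneg (vtilde_nonneg _ _ _) zero_le_two)]
      have := vtilde_le hn hq (hKm s hsS) hs (y := y) (by simpa using hs hy)
      linarith
    · rw [Set.indicator_of_notMem hy, norm_zero]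
      exact Set.indicator_nonneg (fun _ _ => integral_chordKernel_nonneg _ _) _
  · rw [integrable_indicator_iff Metric.isClosed_closedBall.measurableSet]
    exact integrableOn_const (isCompact_closedBall (0 : Eucl n) R).measure_ne_top
  · have hfr : ∀ᵐ y, y ∉ frontier (K t) :=
      measure_eq_zero_iff_ae_notMem.1 ((h.isBody t ht).convex.addHaar_frontier volume)
    filter_upwards [hfr] with y hy
    have hpair : Tendsto (fun s : ℝ => (s, y)) (𝓝[S] t) (𝓝[S] t ×ˢ 𝓝 y) :=
      tendsto_id.prodMk tendsto_const_nhds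
    by_cases hin : y ∈ K t
    · have h_int : y ∈ interior (K t) := by
        by_contra hni
        exact hy ⟨subset_closure hin, hni⟩
      rw [Set.indicator_of_mem hin]
      refine (((h.tendsto_vtilde hn hq ht y).comp hpair).div_const 2).congr' ?_
      filter_upwards [hpair.eventually (h.eventually_mem ht h_int)] with s hs
      rw [Set.indicator_of_mem hs]; rfl
    · rw [Set.indicator_of_notMem hin]
      refine tendsto_const_nhds.congr' ?_
      filter_upwards [hpair.eventually (h.eventually_notMem ht hin)] with s hs
      rw [Set.indicator_of_notMem hs]

end

section LinearAlgebra

variable {E : Type*} [NormedAddCommGroup E] [InnerProductSpace ℝ E]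

theorem Matrix.PosDef.det_le_det_add {ι : Type*} [Fintype ι] [DecidableEq ι]
    {B P : Matrix ι ι ℝ} (hB : B.PosDef) (hP : P.PosSemidef) : B.det ≤ (B + P).det := by
  open scoped MatrixOrder ComplexOrder in
  obtain ⟨M, hM⟩ := CStarAlgebra.nonneg_iff_eq_star_mul_self.1
    (Matrix.nonneg_iff_posSemidef.2 hB.posSemidef)
  have hBd := hB.det_pos
  have hMd : IsUnit M.det := by
    rw [isUnit_iff_ne_zero]
    intro h0
    rw [hM, Matrix.det_mul, h0, mul_zero] at hBd
    exact lt_irrefl _ hBd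
  set C := (M⁻¹).conjTranspose * P * M⁻¹
  have hC : C.PosSemidef := hP.conjTranspose_mul_mul_same _
  have hMs : star M = M.conjTranspose := rfl
  have hP2 : P = M.conjTranspose * C * M := by
    have h1 : M.conjTranspose * (M⁻¹).conjTranspose = 1 := by
      rw [← Matrix.conjTranspose_mul, Matrix.nonsing_inv_mul _ hMd, Matrix.conjTranspose_one]
    calc P = (M.conjTranspose * (M⁻¹).conjTranspose) * P * (M⁻¹ * M) := by
          rw [h1, Matrix.nonsing_inv_mul _ hMd, one_mul, mul_one]
      _ = _ := by simp only [C, mul_assoc]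
  have hC1 : 1 ≤ (1 + C).det := by
    have h1 : (1 + C).det = ∏ i, (1 + hC.1.eigenvalues i) := by
      have h2 : 1 + C = (hC.1.eigenvectorUnitary : Matrix ι ι ℝ) *
          Matrix.diagonal (fun i => 1 + hC.1.eigenvalues i) *
            star (hC.1.eigenvectorUnitary : Matrix ι ι ℝ) := by
        have h3 : Matrix.diagonal (fun i => 1 + hC.1.eigenvalues i) =
            1 + Matrix.diagonal hC.1.eigenvalues := by
          rw [← Matrix.diagonal_one, Matrix.diagonal_add]
        rw [h3, mul_add, add_mul, mul_one, Unitary.mul_star_self_of_mem hC.1.eigenvectorUnitary.2]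
        congr 1
        exact hC.1.spectral_theorem
      rw [h2, Matrix.det_mul, Matrix.det_mul, mul_right_comm, ← Matrix.det_mul,
        Unitary.mul_star_self_of_mem hC.1.eigenvectorUnitary.2, Matrix.det_one, one_mul,
        Matrix.det_diagonal]
    rw [h1]
    exact Finset.one_le_prod (fun i _ => le_add_of_nonneg_right (hC.eigenvalues_nonneg i))
  have h4 : B + P = M.conjTranspose * (1 + C) * M := by
    rw [mul_add, add_mul, mul_one, ← hP2, hM, hMs]
  have h5 : (B + P).det = B.det * (1 + C).det := by
    rw [h4, hM, hMs, Matrix.det_mul, Matrix.det_mul, Matrix.det_mul]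
    ring
  rw [h5]
  exact le_mul_of_one_le_right hBd.le hC1

theorem LinearMap.IsPositive.det_le_det [FiniteDimensional ℝ E] {A B : E →ₗ[ℝ] E}
    (hB : B.IsPositive) (hB0 : LinearMap.det B ≠ 0) (hAB : (A - B).IsPositive) :
    LinearMap.det B ≤ LinearMap.det A := by
  set b := stdOrthonormalBasis ℝ E
  have h1 := (LinearMap.posSemidef_toMatrix_iff b).2 hB
  have h2 := (LinearMap.posSemidef_toMatrix_iff b).2 hAB
  rw [← LinearMap.det_toMatrix b.toBasis] at hB0
  have h3 : (LinearMap.toMatrix b.toBasis b.toBasis B).PosDef :=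
    h1.posDef_iff_det_ne_zero.2 hB0
  have h4 := h3.det_le_det_add h2
  rwa [← map_add, add_sub_cancel, LinearMap.det_toMatrix, LinearMap.det_toMatrix] at h4

theorem LinearMap.IsPositive.apply_eq_zero {B : E →ₗ[ℝ] E} (hB : B.IsPositive) {v : E}
    (hv : ⟪B v, v⟫ = 0) : B v = 0 := by
  have hsym : ∀ x y, ⟪B x, y⟫ = ⟪x, B y⟫ := hB.isSymmetric
  have h1 : ∀ s : ℝ, 0 ≤ ⟪B (B v), B v⟫ * (s * s) + 2 * ‖B v‖ ^ 2 * s + 0 := by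
    intro s
    have h2 : 0 ≤ ⟪B (v + s • B v), v + s • B v⟫ := by
      simpa using hB.2 (v + s • B v)
    simp only [map_add, map_smul, inner_add_left, inner_add_right, real_inner_smul_left,
      real_inner_smul_right, hv] at h2
    rw [hsym (B v) v, real_inner_self_eq_norm_sq] at h2
    linarith
  have h3 := discrim_le_zero h1
  rw [discrim] at h3
  have h4 : ‖B v‖ ^ 2 = 0 := by nlinarith [sq_nonneg (‖B v‖ ^ 2)]
  simpa using h4

theorem LinearMap.IsPositive.inner_pos [FiniteDimensional ℝ E] {B : E →ₗ[ℝ] E} (hB : B.IsPositive)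
    (hB0 : LinearMap.det B ≠ 0) {v : E} (hv : v ≠ 0) : 0 < ⟪B v, v⟫ := by
  have h0 : 0 ≤ ⟪B v, v⟫ := by simpa using hB.2 v
  refine lt_of_le_of_ne h0 fun h => hv ?_
  have h1 := hB.apply_eq_zero h.symm
  have h2 : LinearMap.ker B = ⊥ := by
    by_contra hne
    exact hB0 (LinearMap.det_eq_zero_iff_ker_ne_bot.2 hne)
  exact (LinearMap.ker_eq_bot'.1 h2) v h1

end LinearAlgebra

section

variable {n : ℕ} {K : Set (Eucl n)}

namespace IsSmoothBody

theorem contDiffAt_suppFun (hK : IsSmoothBody K) {x : Eucl n} (hx : x ≠ 0) :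
    ContDiffAt ℝ (⊤ : ℕ∞) (suppFun K) x :=
  hK.2.2.2.2.1.contDiffAt (isOpen_compl_singleton.mem_nhds hx)

theorem differentiableAt_suppFun (hK : IsSmoothBody K) {x : Eucl n} (hx : x ≠ 0) :
    DifferentiableAt ℝ (suppFun K) x :=
  (hK.contDiffAt_suppFun hx).differentiableAt (by simp)

theorem contDiffAt_gradient (hK : IsSmoothBody K) {x : Eucl n} (hx : x ≠ 0) :
    ContDiffAt ℝ (⊤ : ℕ∞) (fun y => gradient (suppFun K) y) x := by
  have h1 : ContDiffAt ℝ (⊤ : ℕ∞) (fderiv ℝ (suppFun K)) x :=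
    (hK.contDiffAt_suppFun hx).fderiv_right (by simp)
  exact (InnerProductSpace.toDual ℝ (Eucl n)).symm.contDiff.contDiffAt.comp x h1

theorem differentiableAt_gradient (hK : IsSmoothBody K) {x : Eucl n} (hx : x ≠ 0) :
    DifferentiableAt ℝ (fun y => gradient (suppFun K) y) x :=
  (hK.contDiffAt_gradient hx).differentiableAt (by simp)

theorem gradient_mem (hK : IsSmoothBody K) {x : Eucl n} (hx : x ≠ 0) :
    gradient (suppFun K) x ∈ K :=
  (hK.isBody.gradient_spec (hK.differentiableAt_suppFun hx)).1

theorem inner_gradient (hK : IsSmoothBody K) {x : Eucl n} (hx : x ≠ 0) :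
    ⟪x, gradient (suppFun K) x⟫ = suppFun K x :=
  (hK.isBody.gradient_spec (hK.differentiableAt_suppFun hx)).2

theorem gradient_smul (hK : IsSmoothBody K) {x : Eucl n} (hx : x ≠ 0) {c : ℝ} (hc : 0 < c) :
    gradient (suppFun K) (c • x) = gradient (suppFun K) x := by
  refine (eq_gradient_suppFun hK.isBody.isCompact
    (hK.differentiableAt_suppFun (smul_ne_zero hc.ne' hx)) (hK.gradient_mem hx) ?_).symm
  rw [real_inner_smul_left, hK.inner_gradient hx, hK.isBody.suppFun_smul hc.le]

theorem gradient_ne_zero (hK : IsSmoothBody K) {x : Eucl n} (hx : x ≠ 0) :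
    gradient (suppFun K) x ≠ 0 := by
  intro h
  have h1 := hK.inner_gradient hx
  rw [h, inner_zero_right] at h1
  exact (hK.isBody.suppFun_pos hx).ne h1

end IsSmoothBody

/-- The Hessian of the support function, as a continuous linear map. -/
def suppHess (K : Set (Eucl n)) (x : Eucl n) : Eucl n →L[ℝ] Eucl n :=
  fderiv ℝ (fun y => gradient (suppFun K) y) x

/-- The Hessian of the support function made invertible in the radial direction. -/
def curvMap (K : Set (Eucl n)) (x : Eucl n) : Eucl n →ₗ[ℝ] Eucl n :=
  (suppHess K x : Eucl n →ₗ[ℝ] Eucl n) + rankOne x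

theorem det_curvMap (K : Set (Eucl n)) (x : Eucl n) :
    LinearMap.det (curvMap K x) = curvDet (suppFun K) x := rfl

theorem curvMap_apply (K : Set (Eucl n)) (x v : Eucl n) :
    curvMap K x v = suppHess K x v + ⟪x, v⟫ • x := rfl

namespace IsSmoothBody

theorem continuousAt_suppHess (hK : IsSmoothBody K) {x : Eucl n} (hx : x ≠ 0) :
    ContinuousAt (suppHess K) x :=
  ((hK.contDiffAt_gradient hx).fderiv_right (m := (⊤ : ℕ∞)) (by simp)).continuousAt

theorem hasFDerivAt_gradient (hK : IsSmoothBody K) {x : Eucl n} (hx : x ≠ 0) :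
    HasFDerivAt (fun y => gradient (suppFun K) y) (suppHess K x) x :=
  (hK.differentiableAt_gradient hx).hasFDerivAt

theorem hasDerivAt_gradient_line (hK : IsSmoothBody K) {x : Eucl n} (hx : x ≠ 0) (v : Eucl n) :
    HasDerivAt (fun s : ℝ => gradient (suppFun K) (x + s • v)) (suppHess K x v) 0 := by
  have h1 : HasDerivAt (fun s : ℝ => x + s • v) v 0 := by
    simpa using ((hasDerivAt_id (0 : ℝ)).smul_const v).const_add x
  have h2 := hK.hasFDerivAt_gradient hx
  have h3 : HasFDerivAt (fun y => gradient (suppFun K) y) (suppHess K x)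
    (x + (0 : ℝ) • v) := by simpa using h2
  exact h3.comp_hasDerivAt (0 : ℝ) h1

theorem suppHess_self (hK : IsSmoothBody K) {x : Eucl n} (hx : x ≠ 0) : suppHess K x x = 0 := by
  refine (hK.hasDerivAt_gradient_line hx x).unique ?_
  refine (hasDerivAt_const (0 : ℝ) (gradient (suppFun K) x)).congr_of_eventuallyEq ?_
  filter_upwards [lt_mem_nhds (show (-1 : ℝ) < 0 by norm_num)] with s hs
  have : x + s • x = (1 + s) • x := by rw [add_smul, one_smul]
  rw [this]
  exact hK.gradient_smul hx (by linarith)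

theorem suppHess_symm (hK : IsSmoothBody K) {x : Eucl n} (hx : x ≠ 0) (v w : Eucl n) :
    ⟪suppHess K x v, w⟫ = ⟪v, suppHess K x w⟫ := by
  have hsym : IsSymmSndFDerivAt ℝ (suppFun K) x :=
    (hK.contDiffAt_suppFun hx).isSymmSndFDerivAt
      (by
        rw [minSmoothness_of_isRCLikeNormedField]
        exact WithTop.coe_le_coe.2 (le_top (a := (2 : ℕ∞))))
  have h1 : DifferentiableAt ℝ (fderiv ℝ (suppFun K)) x :=
    ((hK.contDiffAt_suppFun hx).fderiv_right (m := (⊤ : ℕ∞)) (by simp)).differentiableAt (by simp)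
  have h2 : ∀ a b : Eucl n, ⟪suppHess K x a, b⟫ = fderiv ℝ (fderiv ℝ (suppFun K)) x a b := by
    intro a b
    have h3 : HasFDerivAt (fun y => ⟪gradient (suppFun K) y, b⟫)
        ((innerSL ℝ b).comp (suppHess K x)) x := by
      refine ((innerSL ℝ b).hasFDerivAt.comp x (hK.hasFDerivAt_gradient hx)).congr_of_eventuallyEq
        (Eventually.of_forall fun y => real_inner_comm _ _)
    have h4 : HasFDerivAt (fun y => fderiv ℝ (suppFun K) y b)
        ((ContinuousLinearMap.apply ℝ ℝ b).comp (fderiv ℝ (fderiv ℝ (suppFun K)) x)) x :=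
      (ContinuousLinearMap.apply ℝ ℝ b).hasFDerivAt.comp x h1.hasFDerivAt
    have h5 : (fun y => ⟪gradient (suppFun K) y, b⟫) = fun y => fderiv ℝ (suppFun K) y b := by
      funext y
      exact InnerProductSpace.toDual_symm_apply
    rw [h5] at h3
    have h6 := DFunLike.congr_fun (h3.unique h4) a
    rw [real_inner_comm]
    exact h6
  rw [h2, real_inner_comm, h2]
  exact hsym v w

theorem suppHess_nonneg (hK : IsSmoothBody K) {x : Eucl n} (hx : x ≠ 0) (v : Eucl n) :
    0 ≤ ⟪suppHess K x v, v⟫ := by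
  have h1 := ((hK.hasDerivAt_gradient_line hx v).inner ℝ (hasDerivAt_const (0 : ℝ) v))
  simp only [inner_zero_right, zero_add] at h1
  have hcont : ContinuousAt (fun s : ℝ => x + s • v) 0 := by fun_prop
  have hne : ∀ᶠ s : ℝ in 𝓝 0, x + s • v ≠ 0 :=
    hcont.eventually_ne (by simpa using hx)
  have h2 := (hasDerivAt_iff_tendsto_slope.1 h1).mono_left
    (nhdsWithin_mono (0 : ℝ) (show Set.Ioi (0 : ℝ) ⊆ {0}ᶜ from fun s hs => ne_of_gt hs))
  refine ge_of_tendsto h2 ?_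
  filter_upwards [self_mem_nhdsWithin, mem_nhdsWithin_of_mem_nhds hne] with s hs hs0
  have hs' : 0 < s := hs
  rw [slope_def_field]
  simp only [zero_smul, add_zero, sub_zero]
  refine div_nonneg ?_ hs'.le
  have a1 := hK.inner_gradient hx
  have a2 := hK.inner_gradient hs0
  have a3 := inner_le_suppFun hK.isBody.isCompact x (hK.gradient_mem hs0)
  have a4 := inner_le_suppFun hK.isBody.isCompact (x + s • v) (hK.gradient_mem hx)
  rw [inner_add_left, real_inner_smul_left] at a2 a4
  rw [real_inner_comm, real_inner_comm v (gradient (suppFun K) x)] at *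
  nlinarith

theorem inner_suppHess_self (hK : IsSmoothBody K) {x : Eucl n} (hx : x ≠ 0) (v : Eucl n) :
    ⟪x, suppHess K x v⟫ = 0 := by
  rw [← hK.suppHess_symm hx, hK.suppHess_self hx, inner_zero_left]

theorem inner_curvMap (x v w : Eucl n) :
    ⟪curvMap K x v, w⟫ = ⟪suppHess K x v, w⟫ + ⟪x, v⟫ * ⟪x, w⟫ := by
  rw [curvMap_apply, inner_add_left, real_inner_smul_left]

theorem isPositive_curvMap (hK : IsSmoothBody K) {x : Eucl n} (hx : x ≠ 0) :
    (curvMap K x).IsPositive := by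
  refine ⟨fun v w => ?_, fun v => ?_⟩
  · have h : ⟪v, curvMap K x w⟫ = ⟪curvMap K x w, v⟫ := real_inner_comm _ _
    rw [h, inner_curvMap, inner_curvMap, hK.suppHess_symm hx, real_inner_comm]
    ring
  · have := hK.suppHess_nonneg hx v
    simp only [inner_curvMap, RCLike.re_to_real]
    nlinarith [mul_self_nonneg ⟪x, v⟫]

theorem curvDet_pos (hK : IsSmoothBody K) {x : Eucl n}
    (hx : x ∈ Metric.sphere (0 : Eucl n) 1) : 0 < curvDet (suppFun K) x := hK.2.2.2.2.2 x hx

theorem continuousOn_curvDet (hK : IsSmoothBody K) :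
    ContinuousOn (curvDet (suppFun K)) {0}ᶜ := by
  intro x hx
  refine ContinuousAt.continuousWithinAt ?_
  have h1 : (curvDet (suppFun K)) = fun x : Eucl n =>
      ContinuousLinearMap.det (suppHess K x + (innerSL ℝ x).smulRight x) := by
    funext y
    rw [← det_curvMap]
    rfl
  rw [h1]
  have h2 : ContinuousAt (fun x : Eucl n => suppHess K x + (innerSL ℝ x).smulRight x) x := by
    refine (hK.continuousAt_suppHess hx).add ?_
    have : Continuous fun x : Eucl n =>
      ContinuousLinearMap.smulRightL ℝ (Eucl n) (Eucl n) (innerSL ℝ x) x := by fun_prop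
    exact this.continuousAt
  exact (ContinuousLinearMap.continuous_det.continuousAt).comp h2

theorem exists_le_inner_curvMap (hK : IsSmoothBody K) :
    ∃ l > 0, ∀ x ∈ Metric.sphere (0 : Eucl n) 1, ∀ v, l * ‖v‖ ^ 2 ≤ ⟪curvMap K x v, v⟫ := by
  set S := Metric.sphere (0 : Eucl n) 1
  have hcpt : IsCompact (S ×ˢ S) := (isCompact_sphere _ _).prod (isCompact_sphere _ _)
  have hcont : ContinuousOn (fun p : Eucl n × Eucl n => ⟪curvMap K p.1 p.2, p.2⟫) (S ×ˢ S) := by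
    simp only [inner_curvMap]
    rintro ⟨x, v⟩ ⟨hx, hv⟩
    have hx0 : x ≠ 0 := Metric.ne_of_mem_sphere hx one_ne_zero
    have h1 : ContinuousAt (fun p : Eucl n × Eucl n => suppHess K p.1) (x, v) :=
      ContinuousAt.comp (f := Prod.fst) (hK.continuousAt_suppHess hx0) continuousAt_fst
    have h2 := ContinuousAt.inner (𝕜 := ℝ) (h1.clm_apply continuousAt_snd) continuousAt_snd
    refine (h2.add ?_).continuousWithinAt
    fun_prop
  rcases (S ×ˢ S).eq_empty_or_nonempty with he | hne
  · refine ⟨1, one_pos, fun x hx => ?_⟩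
    have : (x, x) ∈ S ×ˢ S := ⟨hx, hx⟩
    rw [he] at this
    exact this.elim
  obtain ⟨⟨x0, v0⟩, ⟨hx0, hv0⟩, hmin⟩ := hcpt.exists_isMinOn hne hcont
  have hx00 : x0 ≠ 0 := Metric.ne_of_mem_sphere hx0 one_ne_zero
  refine ⟨_, (hK.isPositive_curvMap hx00).inner_pos (hK.curvDet_pos hx0).ne'
    (Metric.ne_of_mem_sphere hv0 one_ne_zero), fun x hx v => ?_⟩
  rcases eq_or_ne v 0 with rfl | hv
  · simp
  have hv' : ‖v‖ ≠ 0 := norm_ne_zero_iff.2 hv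
  have h1 : (x, ‖v‖⁻¹ • v) ∈ S ×ˢ S := ⟨hx, by simp [S, norm_smul, hv']⟩
  have h2 := hmin h1
  simp only [Set.mem_ofPred_eq, map_smul, real_inner_smul_left, real_inner_smul_right] at h2
  have h3 := mul_le_mul_of_nonneg_right h2 (sq_nonneg ‖v‖)
  have h4 : ‖v‖⁻¹ * (‖v‖⁻¹ * ⟪curvMap K x v, v⟫) * ‖v‖ ^ 2 = ⟪curvMap K x v, v⟫ := by
    field_simp
  rwa [h4] at h3

theorem eq_of_gradient_eq (hK : IsSmoothBody K) {x y : Eucl n}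
    (hx : x ∈ Metric.sphere (0 : Eucl n) 1) (hy : y ∈ Metric.sphere (0 : Eucl n) 1)
    (h : ⟪x, gradient (suppFun K) y⟫ = suppFun K x) : x = y := by
  have hx0 : x ≠ 0 := Metric.ne_of_mem_sphere hx one_ne_zero
  have hy0 : y ≠ 0 := Metric.ne_of_mem_sphere hy one_ne_zero
  have hGy := hK.gradient_mem hy0
  have hline : ∀ s : ℝ, s ∈ Set.Ioo 0 1 → y + s • (x - y) ≠ 0 →
      gradient (suppFun K) (y + s • (x - y)) = gradient (suppFun K) y := by
    intro s hs hne
    refine (eq_gradient_suppFun hK.isBody.isCompact (hK.differentiableAt_suppFun hne) hGy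
      (le_antisymm (inner_le_suppFun hK.isBody.isCompact _ hGy) ?_)).symm
    have e1 : y + s • (x - y) = (1 - s) • y + s • x := by module
    obtain ⟨z, hz, hzs⟩ := hK.isBody.exists_inner_eq_suppFun (y + s • (x - y))
    rw [← hzs, e1, inner_add_left, inner_add_left, real_inner_smul_left, real_inner_smul_left,
      real_inner_smul_left, real_inner_smul_left, h, hK.inner_gradient hy0]
    have a1 := inner_le_suppFun hK.isBody.isCompact y hz
    have a2 := inner_le_suppFun hK.isBody.isCompact x hz
    have b1 := mul_le_mul_of_nonneg_left a1 (sub_nonneg.2 hs.2.le)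
    have b2 := mul_le_mul_of_nonneg_left a2 hs.1.le
    linarith
  have hcont : ContinuousAt (fun s : ℝ => y + s • (x - y)) 0 := by fun_prop
  have hne : ∀ᶠ s : ℝ in 𝓝 0, y + s • (x - y) ≠ 0 := hcont.eventually_ne (by simpa using hy0)
  have hQ : suppHess K y (x - y) = 0 := by
    have h1 := (hasDerivAt_iff_tendsto_slope.1 (hK.hasDerivAt_gradient_line hy0 (x - y))).mono_left
      (nhdsWithin_mono (0 : ℝ) (show Set.Ioi (0 : ℝ) ⊆ {0}ᶜ from fun s hs => ne_of_gt hs))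
    refine tendsto_nhds_unique h1 (tendsto_const_nhds.congr' ?_)
    filter_upwards [Ioo_mem_nhdsGT (zero_lt_one' ℝ), mem_nhdsWithin_of_mem_nhds hne] with s hs hs0
    rw [slope_def_module, hline s hs hs0]
    simp
  have hxy1 : ‖x‖ = 1 := by simpa using hx
  have hyy1 : ‖y‖ = 1 := by simpa using hy
  have hQx : suppHess K y x = 0 := by
    rw [map_sub, hK.suppHess_self hy0, sub_zero] at hQ
    exact hQ
  have hker : curvMap K y (x - ⟪y, x⟫ • y) = 0 := by
    rw [curvMap_apply, map_sub, map_smul, hQx, hK.suppHess_self hy0, inner_sub_right,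
      real_inner_smul_right, real_inner_self_eq_norm_sq, hyy1]
    simp
  have hz : x - ⟪y, x⟫ • y = 0 := by
    by_contra hne
    have := (hK.isPositive_curvMap hy0).inner_pos (hK.curvDet_pos hy).ne' hne
    rw [hker, inner_zero_left] at this
    exact lt_irrefl _ this
  have hxs : x = ⟪y, x⟫ • y := sub_eq_zero.1 hz
  have habs : |⟪y, x⟫| = 1 := by
    have := congrArg norm hxs
    rw [norm_smul, hxy1, hyy1, mul_one, Real.norm_eq_abs] at this
    exact this.symm
  rcases (abs_eq zero_le_one).1 habs with h1 | h1
  · rw [hxs, h1, one_smul]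
  · exfalso
    rw [h1] at hxs
    have p1 := hK.isBody.suppFun_pos hx0
    have p2 := hK.isBody.suppFun_pos hy0
    rw [← h, hxs, real_inner_smul_left, hK.inner_gradient hy0] at p1
    linarith

theorem inner_gradient_lt (hK : IsSmoothBody K) {x y : Eucl n}
    (hx : x ∈ Metric.sphere (0 : Eucl n) 1) (hy : y ∈ Metric.sphere (0 : Eucl n) 1)
    (h : x ≠ y) : ⟪x, gradient (suppFun K) y⟫ < suppFun K x :=
  lt_of_le_of_ne (inner_le_suppFun hK.isBody.isCompact _
    (hK.gradient_mem (Metric.ne_of_mem_sphere hy one_ne_zero)))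
    fun he => h (hK.eq_of_gradient_eq hx hy he)

end IsSmoothBody

end

section

variable {n : ℕ} {K : Set (Eucl n)}

theorem integrable_polar_iff (hn : n ≠ 0) (F : Eucl n → ℝ) :
    Integrable F ↔ Integrable (fun p : Metric.sphere (0 : Eucl n) 1 × Set.Ioi (0 : ℝ) =>
      F ((p.2 : ℝ) • (p.1 : Eucl n)))
        ((volume : Measure (Eucl n)).toSphere.prod (Measure.volumeIoiPow (n - 1))) := by
  have : Nontrivial (Eucl n) := by
    have : NeZero n := ⟨hn⟩
    infer_instance
  have h1 := (volume : Measure (Eucl n)).measurePreserving_homeomorphUnitSphereProd.symm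
    (homeomorphUnitSphereProd (Eucl n)).toMeasurableEquiv
  rw [finrank_euclideanSpace_fin] at h1
  have h2 := h1.integrable_comp_emb (g := F ∘ Subtype.val)
    (homeomorphUnitSphereProd (Eucl n)).toMeasurableEquiv.symm.measurableEmbedding
  have h3 : (F ∘ Subtype.val) ∘ (homeomorphUnitSphereProd (Eucl n)).toMeasurableEquiv.symm =
      fun p => F ((p.2 : ℝ) • (p.1 : Eucl n)) := by
    funext p
    exact congrArg F (homeomorphUnitSphereProd_symm_apply_coe _ _)
  rw [h3] at h2
  rw [h2, ← integrableOn_iff_comap_subtypeVal (measurableSet_singleton _).compl, IntegrableOn,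
    MeasureTheory.restrict_compl_singleton]

theorem integral_polar_prod (hn : n ≠ 0) (F : Eucl n → ℝ) :
    ∫ x, F x = ∫ p : Metric.sphere (0 : Eucl n) 1 × Set.Ioi (0 : ℝ),
      F ((p.2 : ℝ) • (p.1 : Eucl n))
        ∂((volume : Measure (Eucl n)).toSphere.prod (Measure.volumeIoiPow (n - 1))) := by
  have : Nontrivial (Eucl n) := by
    have : NeZero n := ⟨hn⟩
    infer_instance
  have h1 := (volume : Measure (Eucl n)).measurePreserving_homeomorphUnitSphereProd.symm
    (homeomorphUnitSphereProd (Eucl n)).toMeasurableEquiv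
  rw [finrank_euclideanSpace_fin] at h1
  have h2 := h1.integral_comp
    (homeomorphUnitSphereProd (Eucl n)).toMeasurableEquiv.symm.measurableEmbedding
    (F ∘ Subtype.val)
  have h3 : ∀ p, (F ∘ Subtype.val) ((homeomorphUnitSphereProd (Eucl n)).toMeasurableEquiv.symm p) =
      F ((p.2 : ℝ) • (p.1 : Eucl n)) := by
    intro p
    exact congrArg F (homeomorphUnitSphereProd_symm_apply_coe _ _)
  simp only [h3] at h2
  rw [h2]
  simp only [Function.comp_apply]
  rw [integral_subtype_comap (measurableSet_singleton _).compl F,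
    MeasureTheory.restrict_compl_singleton]

theorem integral_volumeIoiPow (m : ℕ) (φ : ℝ → ℝ) :
    ∫ r : Set.Ioi (0 : ℝ), φ r ∂(Measure.volumeIoiPow m) =
      ∫ r in Set.Ioi (0 : ℝ), r ^ m * φ r := by
  simp only [Measure.volumeIoiPow, ENNReal.ofReal]
  rw [integral_withDensity_eq_integral_smul,
    integral_subtype_comap measurableSet_Ioi fun a ↦ Real.toNNReal (a ^ m) • φ a,
    setIntegral_congr_fun measurableSet_Ioi fun x hx ↦ ?_]
  · simp only [NNReal.smul_def, smul_eq_mul]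
    rw [Real.coe_toNNReal _ (pow_nonneg (le_of_lt hx) _)]
  · exact (measurable_subtype_coe.pow_const _).real_toNNReal

/-- Integration in polar coordinates. -/
theorem integral_polar (hn : n ≠ 0) {F : Eucl n → ℝ} (hF : Integrable F) :
    ∫ x, F x = ∫ w : Metric.sphere (0 : Eucl n) 1,
      (∫ r in Set.Ioi (0 : ℝ), r ^ (n - 1) * F (r • (w : Eucl n)))
        ∂(volume : Measure (Eucl n)).toSphere := by
  rw [integral_polar_prod hn, integral_prod _ ((integrable_polar_iff hn F).1 hF)]
  congr 1
  funext w
  exact integral_volumeIoiPow (n - 1) fun r => F (r • (w : Eucl n))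

theorem integrable_polar (hn : n ≠ 0) {F : Eucl n → ℝ} (hF : Integrable F) :
    Integrable (fun w : Metric.sphere (0 : Eucl n) 1 =>
      ∫ r in Set.Ioi (0 : ℝ), r ^ (n - 1) * F (r • (w : Eucl n)))
        (volume : Measure (Eucl n)).toSphere := by
  refine ((integrable_polar_iff hn F).1 hF).integral_prod_left.congr
    (Eventually.of_forall fun w => ?_)
  exact integral_volumeIoiPow (n - 1) fun r => F (r • (w : Eucl n))

namespace IsSmoothBody

theorem radFun_gradient (hK : IsSmoothBody K) {x : Eucl n} (hx : x ≠ 0) :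
    radFun K (gradient (suppFun K) x) = 1 := by
  have hG := hK.gradient_ne_zero hx
  refine le_antisymm ?_ (hK.isBody.le_radFun hG (by simpa using hK.gradient_mem hx))
  have h1 := inner_le_suppFun hK.isBody.isCompact x (hK.isBody.radFun_mem hG).2
  rw [real_inner_smul_right, hK.inner_gradient hx] at h1
  have h2 := hK.isBody.suppFun_pos hx
  nlinarith

theorem exists_gradient_eq (hK : IsSmoothBody K) {y : Eucl n} (hy : y ≠ 0)
    (hr : radFun K y = 1) :
    ∃ x ∈ Metric.sphere (0 : Eucl n) 1, gradient (suppFun K) x = y := by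
  have hyK : y ∈ K := by simpa [hr] using (hK.isBody.radFun_mem hy).2
  set S := Metric.sphere (0 : Eucl n) 1
  have hne : S.Nonempty := ⟨‖y‖⁻¹ • y, by simp [S, norm_smul, hy]⟩
  have hcont : ContinuousOn (fun x : Eucl n => ⟪x, y⟫ / suppFun K x) S := by
    refine ContinuousOn.div (by fun_prop) ?_ fun x hx =>
      (hK.isBody.suppFun_pos (Metric.ne_of_mem_sphere hx one_ne_zero)).ne'
    exact fun x hx => (hK.differentiableAt_suppFun
      (Metric.ne_of_mem_sphere hx one_ne_zero)).continuousAt.continuousWithinAt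
  obtain ⟨x, hx, hmax⟩ := (isCompact_sphere _ _).exists_isMaxOn hne hcont
  have hx0 : x ≠ 0 := Metric.ne_of_mem_sphere hx one_ne_zero
  have hpx := hK.isBody.suppFun_pos hx0
  refine ⟨x, hx, (eq_gradient_suppFun hK.isBody.isCompact (hK.differentiableAt_suppFun hx0) hyK
    ((inner_le_suppFun hK.isBody.isCompact x hyK).antisymm ?_)).symm⟩
  by_contra! hlt
  set M := ⟪x, y⟫ / suppFun K x
  have hM : M < 1 := (div_lt_one hpx).2 hlt
  obtain ⟨m, hm1, hm2⟩ : ∃ m, max M 0 < m ∧ m < 1 := exists_between (max_lt hM one_pos)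
  have hm0 : 0 < m := (le_max_right _ _).trans_lt hm1
  have hmem : m⁻¹ • y ∈ K := by
    refine hK.isBody.mem_of_forall_inner_le fun z hz => ?_
    have hpz := hK.isBody.suppFun_pos (Metric.ne_of_mem_sphere hz one_ne_zero)
    have h1 : ⟪z, y⟫ / suppFun K z ≤ M := hmax hz
    rw [div_le_iff₀ hpz] at h1
    rw [real_inner_smul_right, inv_mul_le_iff₀ hm0]
    exact h1.trans (mul_le_mul_of_nonneg_right ((le_max_left _ _).trans hm1.le) hpz.le)
  have := hK.isBody.le_radFun hy hmem
  rw [hr] at this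
  exact absurd this (not_le.2 ((one_lt_inv₀ hm0).2 hm2))

/-- The homogeneous inverse Gauss map is injective. -/
theorem injOn_gauss (hK : IsSmoothBody K) :
    Set.InjOn (fun x : Eucl n => ‖x‖ • gradient (suppFun K) x) {0}ᶜ := by
  intro x hx y hy h
  simp only at h
  have hx' : 0 < ‖x‖ := norm_pos_iff.2 hx
  have hy' : 0 < ‖y‖ := norm_pos_iff.2 hy
  have h1 := congrArg (radFun K) h
  rw [hK.isBody.radFun_smul (hK.gradient_ne_zero hx) hx', hK.radFun_gradient hx,
    hK.isBody.radFun_smul (hK.gradient_ne_zero hy) hy', hK.radFun_gradient hy, mul_one, mul_one,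
    inv_inj] at h1
  rw [h1] at h
  have h2 := smul_right_injective _ hy'.ne' h
  have h3 : ‖x‖⁻¹ • x = ‖y‖⁻¹ • y := by
    refine hK.eq_of_gradient_eq (by simp [norm_smul, hx'.ne']) (by simp [norm_smul, hy'.ne']) ?_
    rw [hK.gradient_smul hy (inv_pos.2 hy'), ← h2, real_inner_smul_left,
      hK.isBody.suppFun_smul (inv_pos.2 hx').le, hK.inner_gradient hx]
  rw [h1] at h3
  exact smul_right_injective _ (inv_pos.2 hy').ne' h3

theorem image_gauss (hK : IsSmoothBody K) :
    (fun x : Eucl n => ‖x‖ • gradient (suppFun K) x) '' {0}ᶜ = {0}ᶜ := by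
  ext y
  constructor
  · rintro ⟨x, hx, rfl⟩
    exact smul_ne_zero (norm_ne_zero_iff.2 hx) (hK.gradient_ne_zero hx)
  · intro hy
    have hρ := (hK.isBody.radFun_mem hy).1
    obtain ⟨x, hx, hxy⟩ := hK.exists_gradient_eq (smul_ne_zero hρ.ne' hy)
      (by rw [hK.isBody.radFun_smul hy hρ, inv_mul_cancel₀ hρ.ne'])
    have hx0 : x ≠ 0 := Metric.ne_of_mem_sphere hx one_ne_zero
    have hx1 : ‖x‖ = 1 := by simpa using hx
    refine ⟨(radFun K y)⁻¹ • x, smul_ne_zero (inv_pos.2 hρ).ne' hx0, ?_⟩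
    simp only
    rw [hK.gradient_smul hx0 (inv_pos.2 hρ), hxy, norm_smul, hx1, norm_inv, Real.norm_eq_abs,
      abs_of_pos hρ, mul_one, smul_smul, inv_mul_cancel₀ hρ.ne', one_smul]

/-- The derivative of the homogeneous inverse Gauss map. -/
theorem hasFDerivAt_gauss (hK : IsSmoothBody K) {x : Eucl n}
    (hx : x ∈ Metric.sphere (0 : Eucl n) 1) :
    HasFDerivAt (fun x : Eucl n => ‖x‖ • gradient (suppFun K) x)
      (suppHess K x + (innerSL ℝ x).smulRight (gradient (suppFun K) x)) x := by
  have hx0 : x ≠ 0 := Metric.ne_of_mem_sphere hx one_ne_zero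
  have hx1 : ‖x‖ = 1 := by simpa using hx
  have h1 : HasFDerivAt (fun x : Eucl n => ‖x‖) (innerSL ℝ x) x := by
    have h2 := (hasStrictFDerivAt_norm_sq x).hasFDerivAt.sqrt (by simp [hx1])
    simp only [Real.sqrt_sq (norm_nonneg _), hx1] at h2
    refine h2.congr_fderiv ?_
    ext1 v
    simp
  refine (h1.smul (hK.hasFDerivAt_gradient hx0)).congr_fderiv ?_
  rw [hx1, one_smul]

theorem hasFDerivAt_gauss_smul (hK : IsSmoothBody K) {x : Eucl n}
    (hx : x ∈ Metric.sphere (0 : Eucl n) 1) {c : ℝ} (hc : 0 < c) :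
    HasFDerivAt (fun x : Eucl n => ‖x‖ • gradient (suppFun K) x)
      (suppHess K x + (innerSL ℝ x).smulRight (gradient (suppFun K) x)) (c • x) := by
  have hx0 : x ≠ 0 := Metric.ne_of_mem_sphere hx one_ne_zero
  set L := suppHess K x + (innerSL ℝ x).smulRight (gradient (suppFun K) x)
  have h0 : HasFDerivAt (fun x : Eucl n => ‖x‖ • gradient (suppFun K) x) L x :=
    hK.hasFDerivAt_gauss hx
  clear_value L
  have h1 : HasFDerivAt (fun y : Eucl n => c⁻¹ • y)
      (c⁻¹ • ContinuousLinearMap.id ℝ (Eucl n)) (c • x) := (hasFDerivAt_id (c • x)).const_smul c⁻¹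
  have h2 : c⁻¹ • c • x = x := by rw [smul_smul, inv_mul_cancel₀ hc.ne', one_smul]
  have h3 := (HasFDerivAt.comp (c • x) (h2.symm ▸ h0) h1).const_smul c
  have h4 : c • L.comp (c⁻¹ • ContinuousLinearMap.id ℝ (Eucl n)) = L := by
    ext1 v
    simp [smul_smul, hc.ne']
  rw [h4] at h3
  refine h3.congr_of_eventuallyEq ?_
  filter_upwards [isOpen_compl_singleton.mem_nhds (smul_ne_zero hc.ne' hx0)] with y hy
  simp only [Pi.smul_apply, Function.comp_apply]
  rw [hK.gradient_smul hy (inv_pos.2 hc), norm_smul, norm_inv, Real.norm_eq_abs, abs_of_pos hc,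
    smul_smul, mul_inv_cancel_left₀ hc.ne']

theorem det_gauss (hK : IsSmoothBody K) {x : Eucl n}
    (hx : x ∈ Metric.sphere (0 : Eucl n) 1) :
    (suppHess K x + (innerSL ℝ x).smulRight (gradient (suppFun K) x)).det =
      suppFun K x * curvDet (suppFun K) x := by
  have hx0 : x ≠ 0 := Metric.ne_of_mem_sphere hx one_ne_zero
  have hx1 : ‖x‖ = 1 := by simpa using hx
  have h1 : (suppHess K x + (innerSL ℝ x).smulRight (gradient (suppFun K) x) :
        Eucl n →L[ℝ] Eucl n).toLinearMap =
      (LinearMap.transvection (innerSL ℝ x : Eucl n →ₗ[ℝ] ℝ) (gradient (suppFun K) x - x)).comp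
        (curvMap K x) := by
    ext1 v
    simp only [LinearMap.comp_apply, LinearMap.transvection.apply, curvMap_apply, map_add,
      ContinuousLinearMap.coe_coe, innerSL_apply_apply, hK.inner_suppHess_self hx0,
      real_inner_smul_right, real_inner_self_eq_norm_sq, hx1, add_apply,
      ContinuousLinearMap.smulRight_apply]
    module
  have h2 : 1 + ⟪x, gradient (suppFun K) x - x⟫ = suppFun K x := by
    rw [inner_sub_right, hK.inner_gradient hx0, real_inner_self_eq_norm_sq, hx1]
    ring
  rw [ContinuousLinearMap.det, h1, LinearMap.det_comp, LinearMap.transvection.det, det_curvMap]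
  congr 1

theorem curvDet_mul_pos (hK : IsSmoothBody K) {x : Eucl n}
    (hx : x ∈ Metric.sphere (0 : Eucl n) 1) : 0 < suppFun K x * curvDet (suppFun K) x :=
  mul_pos (hK.isBody.suppFun_pos (Metric.ne_of_mem_sphere hx one_ne_zero)) (hK.curvDet_pos hx)

/-- Change of variables along the homogeneous inverse Gauss map. -/
theorem exists_integrable_gauss (hK : IsSmoothBody K) (hn : n ≠ 0) {F : Eucl n → ℝ}
    (hF : Integrable F) : ∃ F' : Eucl n → ℝ, Integrable F' ∧ ∫ x, F' x = ∫ x, F x ∧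
      ∀ w ∈ Metric.sphere (0 : Eucl n) 1, ∀ r : ℝ, 0 < r → F' (r • w) =
        suppFun K w * curvDet (suppFun K) w * F (r • gradient (suppFun K) w) := by
  have : Nontrivial (Eucl n) := by
    have : NeZero n := ⟨hn⟩
    infer_instance
  have hs : MeasurableSet ({0}ᶜ : Set (Eucl n)) := (measurableSet_singleton _).compl
  set L : Eucl n → Eucl n →L[ℝ] Eucl n := fun x =>
    suppHess K (‖x‖⁻¹ • x) +
      (innerSL ℝ (‖x‖⁻¹ • x)).smulRight (gradient (suppFun K) (‖x‖⁻¹ • x)) with hL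
  have hd : ∀ x ∈ ({0}ᶜ : Set (Eucl n)),
      HasFDerivWithinAt (fun x : Eucl n => ‖x‖ • gradient (suppFun K) x) (L x) {0}ᶜ x := by
    intro x hx
    have hx' : 0 < ‖x‖ := norm_pos_iff.2 hx
    have h1 := hK.hasFDerivAt_gauss_smul (x := ‖x‖⁻¹ • x) (by simp [norm_smul, hx'.ne']) hx'
    rw [smul_smul, mul_inv_cancel₀ hx'.ne', one_smul] at h1
    exact h1.hasFDerivWithinAt
  refine ⟨fun x => |(L x).det| • F (‖x‖ • gradient (suppFun K) x), ?_, ?_, ?_⟩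
  · have h1 := (integrableOn_image_iff_integrableOn_abs_det_fderiv_smul volume hs hd
      hK.injOn_gauss F).1 hF.integrableOn
    rwa [IntegrableOn, MeasureTheory.restrict_compl_singleton] at h1
  · have h1 := integral_image_eq_integral_abs_det_fderiv_smul volume hs hd hK.injOn_gauss F
    rw [hK.image_gauss, MeasureTheory.restrict_compl_singleton] at h1
    exact h1.symm
  · intro w hw r hr
    have hw0 : w ≠ 0 := Metric.ne_of_mem_sphere hw one_ne_zero
    have hw1 : ‖w‖ = 1 := by simpa using hw
    have h1 : ‖r • w‖ = r := by rw [norm_smul, hw1, mul_one, Real.norm_eq_abs, abs_of_pos hr]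
    have h2 : L (r • w) =
        suppHess K w + (innerSL ℝ w).smulRight (gradient (suppFun K) w) := by
      rw [hL]
      simp only
      rw [h1, smul_smul, inv_mul_cancel₀ hr.ne', one_smul]
    simp only
    rw [h2, hK.det_gauss hw, h1, hK.gradient_smul hw0 hr, abs_of_pos (hK.curvDet_mul_pos hw),
      smul_eq_mul]

/-- Integration in the coordinates `y = r • ∇h(w)`. -/
theorem integral_gauss (hK : IsSmoothBody K) (hn : n ≠ 0) {F : Eucl n → ℝ} (hF : Integrable F) :
    ∫ x, F x = ∫ w : Metric.sphere (0 : Eucl n) 1,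
      (∫ r in Set.Ioi (0 : ℝ), r ^ (n - 1) *
        (suppFun K w * curvDet (suppFun K) w * F (r • gradient (suppFun K) w)))
        ∂(volume : Measure (Eucl n)).toSphere := by
  obtain ⟨F', hi, he, h⟩ := hK.exists_integrable_gauss hn hF
  rw [← he, integral_polar hn hi]
  congr 1
  funext w
  exact setIntegral_congr_fun measurableSet_Ioi fun r hr => by
    rw [h w w.2 r hr]

theorem integrable_gauss (hK : IsSmoothBody K) (hn : n ≠ 0) {F : Eucl n → ℝ}
    (hF : Integrable F) : Integrable (fun w : Metric.sphere (0 : Eucl n) 1 =>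
      ∫ r in Set.Ioi (0 : ℝ), r ^ (n - 1) *
        (suppFun K w * curvDet (suppFun K) w * F (r • gradient (suppFun K) w)))
        (volume : Measure (Eucl n)).toSphere := by
  obtain ⟨F', hi, he, h⟩ := hK.exists_integrable_gauss hn hF
  refine (integrable_polar hn hi).congr (Eventually.of_forall fun w => ?_)
  exact setIntegral_congr_fun measurableSet_Ioi fun r hr => by
    rw [h w w.2 r hr]

theorem integral_Ioi_indicator_pow (hn : n ≠ 0) {R : ℝ} (hR : 0 ≤ R) (c : ℝ) :
    ∫ r in Set.Ioi (0 : ℝ), r ^ (n - 1) * (Set.Iic R).indicator (fun _ => c) r =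
      R ^ n / n * c := by
  have h1 : ∀ r : ℝ, r ^ (n - 1) * (Set.Iic R).indicator (fun _ => c) r =
      (Set.Iic R).indicator (fun r => r ^ (n - 1) * c) r := by
    intro r
    by_cases hr : r ∈ Set.Iic R <;> simp [hr]
  simp only [h1]
  rw [setIntegral_indicator measurableSet_Iic, Set.Ioi_inter_Iic,
    ← intervalIntegral.integral_of_le hR, intervalIntegral.integral_mul_const, integral_pow,
    Nat.sub_add_cancel (Nat.pos_of_ne_zero hn), zero_pow hn, sub_zero]
  congr 2
  rw [Nat.cast_sub (Nat.pos_of_ne_zero hn)]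
  simp

/-- Boundary integrals expressed through the radial function and through the Gauss map. -/
theorem integral_radFun_eq_integral_gradient (hK : IsSmoothBody K) (hn : n ≠ 0)
    {Ψ : Eucl n → ℝ} (hΨ : Continuous Ψ) :
    ∫ w : Metric.sphere (0 : Eucl n) 1, Ψ (radFun K w • w) * radFun K w ^ n
        ∂(volume : Measure (Eucl n)).toSphere =
      ∫ w : Metric.sphere (0 : Eucl n) 1,
        suppFun K w * curvDet (suppFun K) w * Ψ (gradient (suppFun K) w)
          ∂(volume : Measure (Eucl n)).toSphere := by
  have hn' : (n : ℝ) ≠ 0 := Nat.cast_ne_zero.2 hn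
  have : Nontrivial (Eucl n) := by
    have : NeZero n := ⟨hn⟩
    infer_instance
  set F : Eucl n → ℝ := K.indicator fun y => Ψ (radFun K y • y)
  have hF : Integrable F := by
    rw [integrable_indicator_iff hK.isBody.isCompact.isClosed.measurableSet, IntegrableOn,
      ← MeasureTheory.restrict_compl_singleton (μ := volume.restrict K) (0 : Eucl n),
      Measure.restrict_restrict (measurableSet_singleton _).compl, ← IntegrableOn]
    obtain ⟨C, hC⟩ := hK.isBody.isCompact.exists_bound_of_continuousOn hΨ.continuousOn
    have hm : MeasurableSet ({0}ᶜ ∩ K) :=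
      (measurableSet_singleton _).compl.inter hK.isBody.isCompact.isClosed.measurableSet
    have hρ : ContinuousOn (fun y => radFun K y • y) ({0}ᶜ ∩ K) :=
      ((continuousOn_radFun hK.isBody).mono Set.inter_subset_left).smul continuousOn_id
    have hΨF : ContinuousOn (fun y => Ψ (radFun K y • y)) ({0}ᶜ ∩ K) := hΨ.comp_continuousOn hρ
    refine IntegrableOn.of_bound ((measure_mono Set.inter_subset_right).trans_lt
        hK.isBody.isCompact.measure_lt_top) (hΨF.aestronglyMeasurable hm) C ?_
    · filter_upwards [ae_restrict_mem hm] with y hy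
      exact hC _ (hK.isBody.radFun_mem hy.1).2
  have h1 : ∀ y : Eucl n, y ≠ 0 → ∀ r : ℝ, 0 < r → F (r • y) =
      (Set.Iic (radFun K y)).indicator (fun _ => Ψ (radFun K y • y)) r := by
    intro y hy r hr
    have h2 : radFun K (r • y) • r • y = radFun K y • y := by
      rw [hK.isBody.radFun_smul hy hr, smul_smul, mul_right_comm, inv_mul_cancel₀ hr.ne', one_mul]
    by_cases hry : r ≤ radFun K y
    · rw [Set.indicator_of_mem (show r ∈ Set.Iic _ from hry)]
      simp only [F]
      rw [Set.indicator_of_mem ((hK.isBody.smul_mem_iff_le_radFun hy hr.le).2 hry), h2]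
    · rw [Set.indicator_of_notMem (show r ∉ Set.Iic _ from hry)]
      simp only [F]
      rw [Set.indicator_of_notMem (mt (hK.isBody.smul_mem_iff_le_radFun hy hr.le).1 hry)]
  have h2 : ∫ y, F y = (∫ w : Metric.sphere (0 : Eucl n) 1, Ψ (radFun K w • w) * radFun K w ^ n
      ∂(volume : Measure (Eucl n)).toSphere) / n := by
    rw [integral_polar hn hF, ← integral_div]
    congr 1
    funext w
    have hw0 : (w : Eucl n) ≠ 0 := Metric.ne_of_mem_sphere w.2 one_ne_zero
    rw [setIntegral_congr_fun measurableSet_Ioi (g := fun r => r ^ (n - 1) *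
        (Set.Iic (radFun K w)).indicator (fun _ => Ψ (radFun K w • w)) r)
        (fun r hr => by simp only; rw [h1 w hw0 r hr]),
      integral_Ioi_indicator_pow hn (hK.isBody.radFun_mem hw0).1.le]
    ring
  have h3 : ∫ y, F y = (∫ w : Metric.sphere (0 : Eucl n) 1,
        suppFun K w * curvDet (suppFun K) w * Ψ (gradient (suppFun K) w)
          ∂(volume : Measure (Eucl n)).toSphere) / n := by
    rw [hK.integral_gauss hn hF, ← integral_div]
    congr 1
    funext w
    have hw0 : (w : Eucl n) ≠ 0 := Metric.ne_of_mem_sphere w.2 one_ne_zero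
    have hG := hK.gradient_ne_zero hw0
    have hr1 := hK.radFun_gradient hw0
    rw [setIntegral_congr_fun measurableSet_Ioi (g := fun r => r ^ (n - 1) *
        (Set.Iic 1).indicator (fun _ => suppFun K w * curvDet (suppFun K) w *
          Ψ (gradient (suppFun K) w)) r)
        (fun r hr => by
          simp only
          rw [h1 _ hG r hr, hr1, one_smul]
          by_cases h : r ∈ Set.Iic (1 : ℝ) <;> simp [h]),
      integral_Ioi_indicator_pow hn zero_le_one]
    ring
  rw [h2] at h3
  exact (div_left_inj' hn').1 h3

end IsSmoothBody

end

section

variable {n : ℕ}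

/-- The standing hypotheses on a normalized Gauss curvature flow. -/
structure IsSmoothFlow (q p T : ℝ) (f : Eucl n → ℝ) (K : ℝ → Set (Eucl n)) : Prop where
  ne_zero : n ≠ 0
  one_lt : 1 < q
  continuous : Continuous f
  pos : ∀ x ∈ Metric.sphere (0 : Eucl n) 1, 0 < f x
  smooth : ∀ t ∈ Set.Ico (0 : ℝ) T, IsSmoothBody (K t)
  flow : IsGaussChordFlow q p f (Set.Ico 0 T) K

theorem tendsto_integral_toSphere {S : Set ℝ} {t : ℝ} (ht : t ∈ S) {φ : ℝ → Eucl n → ℝ}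
    (h : ∀ s ∈ S, ∀ x ∈ Metric.sphere (0 : Eucl n) 1,
      Tendsto (fun p : ℝ × Eucl n => φ p.1 p.2) (𝓝[S] s ×ˢ 𝓝 x) (𝓝 (φ s x))) :
    Tendsto (fun s => ∫ x : Metric.sphere (0 : Eucl n) 1, φ s x
        ∂(volume : Measure (Eucl n)).toSphere) (𝓝[S] t)
      (𝓝 (∫ x : Metric.sphere (0 : Eucl n) 1, φ t x
        ∂(volume : Measure (Eucl n)).toSphere)) := by
  have hc : ∀ s ∈ S, Continuous fun x : Metric.sphere (0 : Eucl n) 1 => φ s x := by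
    intro s hs
    rw [continuous_iff_continuousAt]
    intro x
    have h1 : Tendsto (fun y : Metric.sphere (0 : Eucl n) 1 => (s, (y : Eucl n))) (𝓝 x)
        (𝓝[S] s ×ˢ 𝓝 (x : Eucl n)) :=
      Tendsto.prodMk (tendsto_const_pure.mono_right (pure_le_nhdsWithin hs))
        continuous_subtype_val.continuousAt
    exact (h s hs x x.2).comp h1
  obtain ⟨M, hM⟩ : ∃ M, ∀ x ∈ Metric.sphere (0 : Eucl n) 1, |φ t x| ≤ M := by
    obtain ⟨M, hM⟩ := isCompact_univ.exists_bound_of_continuousOn (hc t ht).continuousOn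
    exact ⟨M, fun x hx => hM ⟨x, hx⟩ (Set.mem_univ _)⟩
  have hev : ∀ᶠ s in 𝓝[S] t, ∀ x ∈ Metric.sphere (0 : Eucl n) 1, |φ s x| < M + 1 := by
    refine eventually_forall_mem_of_isCompact (P := fun s x => |φ s x| < M + 1)
      (isCompact_sphere _ _) fun x hx => ?_
    exact (h t ht x hx).abs.eventually_lt_const ((hM x hx).trans_lt (lt_add_one M))
  refine tendsto_integral_filter_of_dominated_convergence (fun _ => M + 1) ?_ ?_
    (integrable_const _) ?_
  · filter_upwards [self_mem_nhdsWithin] with s hs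
    exact (hc s hs).aestronglyMeasurable
  · filter_upwards [hev] with s hs
    exact Eventually.of_forall fun x => (hs x x.2).le
  · refine Eventually.of_forall fun x => ?_
    exact (h t ht x x.2).comp (tendsto_id.prodMk tendsto_const_nhds)

end

section

variable {n : ℕ} {q p T : ℝ} {f : Eucl n → ℝ} {K : ℝ → Set (Eucl n)} {t : ℝ} {x : Eucl n}

/-- The numerator `θ h^p f / Ṽ` of the speed of the flow. -/
def flowSpeed (q p : ℝ) (f : Eucl n → ℝ) (K : Set (Eucl n)) (x : Eucl n) : ℝ :=
  theta q p f K * (suppFun K x ^ p * f x) / Vtilde q K (gradient (suppFun K) x)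

theorem flowRHS_eq (q p : ℝ) (f : Eucl n → ℝ) (K : Set (Eucl n)) (x : Eucl n) :
    flowRHS q p f K x = suppFun K x - flowSpeed q p f K x / curvDet (suppFun K) x := by
  rw [flowRHS, flowSpeed]
  ring

namespace IsSmoothFlow

theorem isBodyFamily (h : IsSmoothFlow q p T f K) : IsBodyFamily (Set.Ico 0 T) K where
  isBody t ht := (h.smooth t ht).isBody
  continuousOn x hx t ht := (h.flow t ht x hx).continuousWithinAt

theorem tendsto_gradient (h : IsSmoothFlow q p T f K) (ht : t ∈ Set.Ico 0 T) (hx : x ≠ 0) :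
    Tendsto (fun p : ℝ × Eucl n => gradient (suppFun (K p.1)) p.2) (𝓝[Set.Ico 0 T] t ×ˢ 𝓝 x)
      (𝓝 (gradient (suppFun (K t)) x)) :=
  h.isBodyFamily.tendsto_gradient ht (fun s hs _ hy => (h.smooth s hs).differentiableAt_suppFun hy)
    hx

theorem suppFun_pos (h : IsSmoothFlow q p T f K) (ht : t ∈ Set.Ico 0 T)
    (hx : x ∈ Metric.sphere (0 : Eucl n) 1) : 0 < suppFun (K t) x :=
  (h.smooth t ht).isBody.suppFun_pos (Metric.ne_of_mem_sphere hx one_ne_zero)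

theorem tendsto_suppFun_rpow (h : IsSmoothFlow q p T f K) (ht : t ∈ Set.Ico 0 T)
    (hx : x ∈ Metric.sphere (0 : Eucl n) 1) :
    Tendsto (fun u : ℝ × Eucl n => suppFun (K u.1) u.2 ^ p * f u.2) (𝓝[Set.Ico 0 T] t ×ˢ 𝓝 x)
      (𝓝 (suppFun (K t) x ^ p * f x)) :=
  ((h.isBodyFamily.tendsto_suppFun ht x).rpow_const (Or.inl (h.suppFun_pos ht hx).ne')).mul
    ((h.continuous.tendsto x).comp tendsto_snd)

theorem tendsto_vtilde_radFun (h : IsSmoothFlow q p T f K) (ht : t ∈ Set.Ico 0 T)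
    (hx : x ∈ Metric.sphere (0 : Eucl n) 1) :
    Tendsto (fun u : ℝ × Eucl n =>
        Vtilde q (K u.1) (radFun (K u.1) u.2 • u.2) * radFun (K u.1) u.2 ^ n)
      (𝓝[Set.Ico 0 T] t ×ˢ 𝓝 x)
      (𝓝 (Vtilde q (K t) (radFun (K t) x • x) * radFun (K t) x ^ n)) := by
  have hx0 : x ≠ 0 := Metric.ne_of_mem_sphere hx one_ne_zero
  have h1 := h.isBodyFamily.tendsto_radFun ht hx0
  have h2 := h.isBodyFamily.tendsto_vtilde h.ne_zero h.one_lt ht (radFun (K t) x • x)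
  exact (h2.comp (tendsto_fst.prodMk (h1.smul tendsto_snd))).mul (h1.pow n)

theorem continuousOn_suppFun_rpow (h : IsSmoothFlow q p T f K) (ht : t ∈ Set.Ico 0 T) :
    ContinuousOn (fun x => suppFun (K t) x ^ p * f x) (Metric.sphere 0 1) := by
  intro x hx
  have hx0 : x ≠ 0 := Metric.ne_of_mem_sphere hx one_ne_zero
  exact ((((h.smooth t ht).differentiableAt_suppFun hx0).continuousAt.rpow_const
    (Or.inl (h.suppFun_pos ht hx).ne')).mul h.continuous.continuousAt).continuousWithinAt

theorem integral_suppFun_rpow_pos (h : IsSmoothFlow q p T f K) (ht : t ∈ Set.Ico 0 T) :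
    0 < ∫ x : Metric.sphere (0 : Eucl n) 1, suppFun (K t) x ^ p * f x
      ∂(volume : Measure (Eucl n)).toSphere := by
  have : Nontrivial (Eucl n) := by
    have : NeZero n := ⟨h.ne_zero⟩
    infer_instance
  have hpos : ∀ x : Metric.sphere (0 : Eucl n) 1, 0 < suppFun (K t) x ^ p * f x := fun x =>
    mul_pos (Real.rpow_pos_of_pos (h.suppFun_pos ht x.2) _) (h.pos x x.2)
  have hi : Integrable (fun x : Metric.sphere (0 : Eucl n) 1 => suppFun (K t) x ^ p * f x)
      (volume : Measure (Eucl n)).toSphere :=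
    (continuousOn_iff_continuous_domRestrict.1
      (h.continuousOn_suppFun_rpow ht)).integrable_of_hasCompactSupport
      (HasCompactSupport.of_compactSpace _)
  rw [integral_pos_iff_support_of_nonneg (fun x => (hpos x).le) hi]
  have : Function.support (fun x : Metric.sphere (0 : Eucl n) 1 => suppFun (K t) x ^ p * f x) =
      Set.univ := Set.eq_univ_of_forall fun x => (hpos x).ne'
  rw [this]
  exact Measure.measure_univ_pos.2 (Measure.toSphere_ne_zero _)

theorem theta_eq (h : IsSmoothFlow q p T f K) (t : ℝ) : theta q p f (K t) =
    (∫ x : Metric.sphere (0 : Eucl n) 1,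
      Vtilde q (K t) (radFun (K t) x • x) * radFun (K t) x ^ n
        ∂(volume : Measure (Eucl n)).toSphere) /
      ∫ x : Metric.sphere (0 : Eucl n) 1, suppFun (K t) x ^ p * f x
        ∂(volume : Measure (Eucl n)).toSphere := by
  obtain ⟨c, hc, hi⟩ := exists_setIntegral_sphere_eq h.ne_zero
  rw [theta, hi, hi, mul_div_mul_left _ _ hc.ne']

theorem tendsto_theta (h : IsSmoothFlow q p T f K) (ht : t ∈ Set.Ico 0 T) :
    Tendsto (fun s => theta q p f (K s)) (𝓝[Set.Ico 0 T] t) (𝓝 (theta q p f (K t))) := by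
  simp only [h.theta_eq]
  exact (tendsto_integral_toSphere (φ := fun t x =>
    Vtilde q (K t) (radFun (K t) x • x) * radFun (K t) x ^ n) ht
    fun s hs x hx => h.tendsto_vtilde_radFun hs hx).div
    (tendsto_integral_toSphere (φ := fun t x => suppFun (K t) x ^ p * f x) ht
      fun s hs x hx => h.tendsto_suppFun_rpow hs hx) (h.integral_suppFun_rpow_pos ht).ne'

theorem theta_nonneg (h : IsSmoothFlow q p T f K) (ht : t ∈ Set.Ico 0 T) :
    0 ≤ theta q p f (K t) := by
  rw [h.theta_eq]
  refine div_nonneg (integral_nonneg fun x => ?_) (h.integral_suppFun_rpow_pos ht).le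
  exact mul_nonneg (vtilde_nonneg _ _ _) (pow_nonneg ((h.smooth t ht).isBody.radFun_mem
    (Metric.ne_of_mem_sphere x.2 one_ne_zero)).1.le _)

theorem flowSpeed_nonneg (h : IsSmoothFlow q p T f K) (ht : t ∈ Set.Ico 0 T)
    (hx : x ∈ Metric.sphere (0 : Eucl n) 1) : 0 ≤ flowSpeed q p f (K t) x :=
  div_nonneg (mul_nonneg (h.theta_nonneg ht) (mul_pos
    (Real.rpow_pos_of_pos (h.suppFun_pos ht hx) _) (h.pos x hx)).le) (vtilde_nonneg _ _ _)

theorem tendsto_flowSpeed (h : IsSmoothFlow q p T f K) (ht : t ∈ Set.Ico 0 T)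
    (hx : x ∈ Metric.sphere (0 : Eucl n) 1) :
    Tendsto (fun u : ℝ × Eucl n => flowSpeed q p f (K u.1) u.2) (𝓝[Set.Ico 0 T] t ×ˢ 𝓝 x)
      (𝓝 (flowSpeed q p f (K t) x)) := by
  have hx0 : x ≠ 0 := Metric.ne_of_mem_sphere hx one_ne_zero
  have h1 := h.isBodyFamily.tendsto_vtilde h.ne_zero h.one_lt ht (gradient (suppFun (K t)) x)
  have h2 : Tendsto (fun u : ℝ × Eucl n => Vtilde q (K u.1) (gradient (suppFun (K u.1)) u.2))
      (𝓝[Set.Ico 0 T] t ×ˢ 𝓝 x) (𝓝 (Vtilde q (K t) (gradient (suppFun (K t)) x))) := by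
    simpa only [Function.comp_def] using
      h1.comp (tendsto_fst.prodMk (h.tendsto_gradient ht hx0))
  have h3 : Tendsto (fun u : ℝ × Eucl n => theta q p f (K u.1))
      (𝓝[Set.Ico 0 T] t ×ˢ 𝓝 x) (𝓝 (theta q p f (K t))) :=
    (h.tendsto_theta ht).comp tendsto_fst
  have h4 := vtilde_pos h.ne_zero h.one_lt (h.smooth t ht).isBody (gradient (suppFun (K t)) x)
  simp only [flowSpeed]
  exact (h3.mul (h.tendsto_suppFun_rpow ht hx)).div h2 h4.ne'

theorem continuousOn_flowRHS (h : IsSmoothFlow q p T f K) (ht : t ∈ Set.Ico 0 T) :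
    ContinuousOn (flowRHS q p f (K t)) (Metric.sphere 0 1) := by
  intro x hx
  have hx0 : x ≠ 0 := Metric.ne_of_mem_sphere hx one_ne_zero
  have h0 : Tendsto (fun y : Eucl n => (t, y)) (𝓝 x) (𝓝[Set.Ico 0 T] t ×ˢ 𝓝 x) :=
    (tendsto_const_pure.mono_right (pure_le_nhdsWithin ht)).prodMk tendsto_id
  have h1 : Tendsto (fun y => flowSpeed q p f (K t) y) (𝓝 x) (𝓝 (flowSpeed q p f (K t) x)) := by
    simpa only [Function.comp_def] using (h.tendsto_flowSpeed ht hx).comp h0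
  have h2 : Tendsto (fun y => curvDet (suppFun (K t)) y) (𝓝 x)
      (𝓝 (curvDet (suppFun (K t)) x)) :=
    ((h.smooth t ht).continuousOn_curvDet).continuousAt (isOpen_compl_singleton.mem_nhds hx0)
  have h3 : Tendsto (fun y => suppFun (K t) y) (𝓝 x) (𝓝 (suppFun (K t) x)) :=
    ((h.smooth t ht).differentiableAt_suppFun hx0).continuousAt
  have h4 := h3.sub (h1.div h2 ((h.smooth t ht).curvDet_pos hx).ne')
  refine ContinuousAt.continuousWithinAt ?_
  rw [ContinuousAt, flowRHS_eq]
  exact h4.congr fun y => (flowRHS_eq q p f (K t) y).symm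

end IsSmoothFlow

end

section

theorem IsLocalMin.nonneg_of_hasDerivAt {e e' : ℝ → ℝ} {a c : ℝ} (h : IsLocalMin e a)
    (he : ∀ᶠ τ in 𝓝 a, HasDerivAt e (e' τ) τ) (he' : HasDerivAt e' c a) : 0 ≤ c := by
  by_contra! hc
  have hd : deriv e =ᶠ[𝓝 a] e' := he.mono fun τ hτ => hτ.deriv
  have hdd : deriv (deriv e) a = c := by rw [hd.deriv_eq, he'.deriv]
  have hmax : IsLocalMax e a :=
    isLocalMax_of_deriv_deriv_neg (by rwa [hdd]) h.deriv_eq_zero he.self_of_nhds.continuousAt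
  have hcst : e =ᶠ[𝓝 a] fun _ => e a := by
    filter_upwards [h, hmax] with τ h1 h2 using le_antisymm h2 h1
  have h0 : deriv e =ᶠ[𝓝 a] fun _ => 0 := by
    simpa using hcst.deriv
  rw [h0.deriv_eq, deriv_const] at hdd
  exact hc.ne hdd.symm

end

section

variable {n : ℕ} {K L : Set (Eucl n)} {x : Eucl n}

namespace IsSmoothBody

theorem hasDerivAt_suppFun_line (hK : IsSmoothBody K) {v : Eucl n} {τ : ℝ}
    (hτ : x + τ • v ≠ 0) :
    HasDerivAt (fun s : ℝ => suppFun K (x + s • v)) ⟪gradient (suppFun K) (x + τ • v), v⟫ τ := by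
  have h1 : HasDerivAt (fun s : ℝ => x + s • v) v τ := by
    simpa using ((hasDerivAt_id τ).smul_const v).const_add x
  have h2 := (hK.differentiableAt_suppFun hτ).hasGradientAt.hasFDerivAt
  have h3 := h2.comp_hasDerivAt τ h1
  rwa [InnerProductSpace.toDual_apply_apply] at h3

theorem inner_suppHess_le_of_sub_le (hK : IsSmoothBody K) (hL : IsSmoothBody L)
    (hx : x ∈ Metric.sphere (0 : Eucl n) 1) {b : Eucl n} {m : ℝ} (hm : 0 ≤ m)
    (h : ∀ y ∈ Metric.sphere (0 : Eucl n) 1, -m ≤ suppFun L y - suppFun K y - ⟪b, y⟫)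
    (hxm : suppFun L x - suppFun K x - ⟪b, x⟫ = -m) (v : Eucl n) :
    ⟪suppHess K x v, v⟫ ≤ ⟪suppHess L x v, v⟫ + m * ‖v‖ ^ 2 := by
  have hx0 : x ≠ 0 := Metric.ne_of_mem_sphere hx one_ne_zero
  have hx1 : ‖x‖ = 1 := by simpa using hx
  set e : ℝ → ℝ := fun τ => suppFun L (x + τ • v) - suppFun K (x + τ • v) - ⟪b, x + τ • v⟫ +
    m * (1 + τ * ⟪x, v⟫ + τ ^ 2 * (‖v‖ ^ 2 / 2))
  set e' : ℝ → ℝ := fun τ => ⟪gradient (suppFun L) (x + τ • v), v⟫ -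
    ⟪gradient (suppFun K) (x + τ • v), v⟫ - ⟪b, v⟫ + m * (⟪x, v⟫ + τ * ‖v‖ ^ 2)
  have hnorm (y : Eucl n) : 0 ≤ suppFun L y - suppFun K y - ⟪b, y⟫ + m * ‖y‖ := by
    rw [hL.isBody.suppFun_eq_norm_mul, hK.isBody.suppFun_eq_norm_mul]
    rcases eq_or_ne y 0 with rfl | hy
    · simp
    have hy' : (‖y‖⁻¹ • y) ∈ Metric.sphere (0 : Eucl n) 1 := by
      simp [norm_smul, hy]
    have h1 := h _ hy'
    have h2 : ⟪b, y⟫ = ‖y‖ * ⟪b, ‖y‖⁻¹ • y⟫ := by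
      rw [real_inner_smul_right, ← mul_assoc, mul_inv_cancel₀ (norm_ne_zero_iff.2 hy), one_mul]
    rw [h2]
    nlinarith [norm_nonneg y]
  have he0 : e 0 = 0 := by simp only [e]; simp [hxm]
  have hmin : IsLocalMin e 0 := by
    refine Eventually.of_forall fun τ => ?_
    rw [he0]
    have h1 := hnorm (x + τ • v)
    have h2 : ‖x + τ • v‖ ≤ 1 + τ * ⟪x, v⟫ + τ ^ 2 * (‖v‖ ^ 2 / 2) := by
      have h3 := norm_add_sq_real x (τ • v)
      rw [hx1, real_inner_smul_right, norm_smul, mul_pow, Real.norm_eq_abs, sq_abs] at h3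
      nlinarith [sq_nonneg (‖x + τ • v‖ - 1)]
    have := mul_le_mul_of_nonneg_left h2 hm
    simp only [e]
    linarith
  have hne : ∀ᶠ τ : ℝ in 𝓝 0, x + τ • v ≠ 0 := by
    have hcont : ContinuousAt (fun s : ℝ => x + s • v) 0 := by fun_prop
    exact hcont.eventually_ne (by simpa using hx0)
  have hde : ∀ᶠ τ in 𝓝 0, HasDerivAt e (e' τ) τ := by
    filter_upwards [hne] with τ hτ
    have h1 := hL.hasDerivAt_suppFun_line hτ
    have h2 := hK.hasDerivAt_suppFun_line hτ
    have h3 : HasDerivAt (fun s : ℝ => ⟪b, x + s • v⟫) ⟪b, v⟫ τ := by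
      have : HasDerivAt (fun s : ℝ => x + s • v) v τ := by
        simpa using ((hasDerivAt_id τ).smul_const v).const_add x
      simpa using (hasDerivAt_const τ b).inner ℝ this
    have h4 : HasDerivAt (fun s : ℝ => 1 + s * ⟪x, v⟫ + s ^ 2 * (‖v‖ ^ 2 / 2))
        (⟪x, v⟫ + τ * ‖v‖ ^ 2) τ := by
      have := (((hasDerivAt_id τ).mul_const ⟪x, v⟫).const_add 1).add
        (((hasDerivAt_id τ).pow 2).mul_const (‖v‖ ^ 2 / 2))
      refine this.congr_deriv ?_
      simp only [id, one_mul, mul_one]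
      ring
    exact ((h1.sub h2).sub h3).add (h4.const_mul m)
  have hde' : HasDerivAt e' (⟪suppHess L x v, v⟫ - ⟪suppHess K x v, v⟫ + m * ‖v‖ ^ 2) 0 := by
    have h1 := ((hL.hasDerivAt_gradient_line hx0 v).inner ℝ (hasDerivAt_const (0 : ℝ) v))
    have h2 := ((hK.hasDerivAt_gradient_line hx0 v).inner ℝ (hasDerivAt_const (0 : ℝ) v))
    have h3 : HasDerivAt (fun s : ℝ => ⟪x, v⟫ + s * ‖v‖ ^ 2) (‖v‖ ^ 2) 0 := by
      simpa using ((hasDerivAt_id (0 : ℝ)).mul_const (‖v‖ ^ 2)).const_add ⟪x, v⟫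
    simp only [inner_zero_right, zero_add] at h1 h2
    exact ((h1.sub h2).sub_const ⟪b, v⟫).add (h3.const_mul m)
  linarith [hmin.nonneg_of_hasDerivAt hde hde']

theorem pow_mul_curvDet_le_of_sub_le (hK : IsSmoothBody K) (hL : IsSmoothBody L)
    (hx : x ∈ Metric.sphere (0 : Eucl n) 1) {b : Eucl n} {m l : ℝ} (hm : 0 ≤ m) (hml : m < l)
    (hl : ∀ v, l * ‖v‖ ^ 2 ≤ ⟪curvMap K x v, v⟫)
    (h : ∀ y ∈ Metric.sphere (0 : Eucl n) 1, -m ≤ suppFun L y - suppFun K y - ⟪b, y⟫)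
    (hxm : suppFun L x - suppFun K x - ⟪b, x⟫ = -m) :
    (1 - m / l) ^ n * curvDet (suppFun K) x ≤ curvDet (suppFun L) x := by
  have hx0 : x ≠ 0 := Metric.ne_of_mem_sphere hx one_ne_zero
  have hl0 : 0 < l := hm.trans_lt hml
  have hμ : 0 < 1 - m / l := by
    rw [sub_pos, div_lt_one hl0]
    exact hml
  have hdet : LinearMap.det ((1 - m / l) • curvMap K x) =
      (1 - m / l) ^ n * curvDet (suppFun K) x := by
    rw [LinearMap.det_smul, det_curvMap, finrank_euclideanSpace_fin]
  rw [← hdet, ← det_curvMap L]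
  have hKp := hK.isPositive_curvMap hx0
  have hB : ((1 - m / l) • curvMap K x).IsPositive := hKp.smul_of_nonneg hμ.le
  refine hB.det_le_det ?_ ⟨(hL.isPositive_curvMap hx0).isSymmetric.sub hB.isSymmetric, fun v => ?_⟩
  · rw [hdet]
    exact (mul_pos (pow_pos hμ n) (hK.curvDet_pos hx)).ne'
  · have h1 := hK.inner_suppHess_le_of_sub_le hL hx hm h hxm v
    have h2 : m * ‖v‖ ^ 2 ≤ m / l * ⟪curvMap K x v, v⟫ := by
      rw [div_mul_eq_mul_div, le_div_iff₀ hl0]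
      nlinarith [mul_le_mul_of_nonneg_left (hl v) hm]
    simp only [LinearMap.sub_apply, LinearMap.smul_apply, inner_sub_left, real_inner_smul_left]
    rw [inner_curvMap] at h2
    change 0 ≤ ⟪curvMap L x v, v⟫ - (1 - m / l) * ⟪curvMap K x v, v⟫
    rw [inner_curvMap, inner_curvMap]
    linarith

end IsSmoothBody

end

section

variable {n : ℕ} {q p T : ℝ} {f : Eucl n → ℝ} {K : ℝ → Set (Eucl n)} {t : ℝ} {x : Eucl n}

theorem HasDerivWithinAt.nonpos_of_isMinOn_Icc {φ : ℝ → ℝ} {d a b : ℝ} (hab : a < b)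
    (hφ : HasDerivWithinAt φ d (Set.Icc a b) b) (h : IsMinOn φ (Set.Icc a b) b) : d ≤ 0 := by
  have h1 : a - b ∈ posTangentConeAt (Set.Icc a b) b :=
    sub_mem_posTangentConeAt_of_segment_subset (by rw [segment_symm, segment_eq_Icc hab.le])
  have h2 := h.localize.hasFDerivWithinAt_nonneg hφ.hasFDerivWithinAt h1
  have h3 : 0 ≤ (a - b) * d := by simpa using h2
  nlinarith

theorem nhdsGT_le_nhdsWithin_Ico (ht : t ∈ Set.Ico 0 T) : 𝓝[>] t ≤ 𝓝[Set.Ico 0 T] t := by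
  rw [← nhdsWithin_Ioo_eq_nhdsGT ht.2]
  exact nhdsWithin_mono _ fun s hs => ⟨ht.1.trans hs.1.le, hs.2⟩

namespace IsSmoothFlow

theorem eventually_lt_sub_div (h : IsSmoothFlow q p T f K) (ht : t ∈ Set.Ico 0 T) {a : ℝ}
    {b : Eucl n}
    (hab : ∀ x ∈ Metric.sphere (0 : Eucl n) 1, a + ⟪b, x⟫ < flowRHS q p f (K t) x) :
    ∀ᶠ u : ℝ × ℝ in 𝓝[Set.Ico 0 T] t ×ˢ 𝓝 (1 : ℝ), ∀ x ∈ Metric.sphere (0 : Eucl n) 1,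
      a + ⟪b, x⟫ < suppFun (K u.1) x -
        flowSpeed q p f (K u.1) x / (u.2 ^ n * curvDet (suppFun (K t)) x) := by
  refine eventually_forall_mem_of_isCompact (P := fun (u : ℝ × ℝ) x =>
    a + ⟪b, x⟫ < suppFun (K u.1) x -
      flowSpeed q p f (K u.1) x / (u.2 ^ n * curvDet (suppFun (K t)) x))
    (isCompact_sphere _ _) fun x hx => ?_
  have hx0 : x ≠ 0 := Metric.ne_of_mem_sphere hx one_ne_zero
  set F := (𝓝[Set.Ico 0 T] t ×ˢ 𝓝 (1 : ℝ)) ×ˢ 𝓝 x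
  have hD0 := (h.smooth t ht).curvDet_pos hx
  have h1 : Tendsto (fun v : (ℝ × ℝ) × Eucl n => (v.1.1, v.2)) F (𝓝[Set.Ico 0 T] t ×ˢ 𝓝 x) :=
    (tendsto_fst.comp tendsto_fst).prodMk tendsto_snd
  have h2 : Tendsto (fun v : (ℝ × ℝ) × Eucl n => v.1.2) F (𝓝 1) := tendsto_snd.comp tendsto_fst
  have h3 : Tendsto (fun v : (ℝ × ℝ) × Eucl n => v.2) F (𝓝 x) := tendsto_snd
  have hD : Tendsto (fun y => curvDet (suppFun (K t)) y) (𝓝 x)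
      (𝓝 (curvDet (suppFun (K t)) x)) :=
    ((h.smooth t ht).continuousOn_curvDet).continuousAt (isOpen_compl_singleton.mem_nhds hx0)
  have h4 : Tendsto (fun v : (ℝ × ℝ) × Eucl n => suppFun (K v.1.1) v.2) F
      (𝓝 (suppFun (K t) x)) := by
    simpa only [Function.comp_def] using (h.isBodyFamily.tendsto_suppFun ht x).comp h1
  have h5 : Tendsto (fun v : (ℝ × ℝ) × Eucl n => flowSpeed q p f (K v.1.1) v.2) F
      (𝓝 (flowSpeed q p f (K t) x)) := by
    simpa only [Function.comp_def] using (h.tendsto_flowSpeed ht hx).comp h1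
  have h6 : Tendsto (fun v : (ℝ × ℝ) × Eucl n => v.1.2 ^ n * curvDet (suppFun (K t)) v.2) F
      (𝓝 (1 ^ n * curvDet (suppFun (K t)) x)) := by
    simpa only [Function.comp_def] using (h2.pow n).mul (hD.comp h3)
  rw [one_pow, one_mul] at h6
  have h7 : Tendsto (fun v : (ℝ × ℝ) × Eucl n => a + ⟪b, v.2⟫) F (𝓝 (a + ⟪b, x⟫)) :=
    ((tendsto_const_nhds (x := b)).inner (𝕜 := ℝ) h3).const_add a
  refine h7.eventually_lt (h4.sub (h5.div h6 hD0.ne')) ?_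
  rw [← flowRHS_eq]
  exact hab x hx

/-- A maximum principle: affine speeds below the initial speed of the flow give lower barriers. -/
theorem eventually_add_le_suppFun (h : IsSmoothFlow q p T f K) (ht : t ∈ Set.Ico 0 T) {a : ℝ}
    {b : Eucl n} (ha : a ≤ 0)
    (hab : ∀ x ∈ Metric.sphere (0 : Eucl n) 1, a + ⟪b, x⟫ < flowRHS q p f (K t) x) :
    ∀ᶠ s in 𝓝[>] t, ∀ x ∈ Metric.sphere (0 : Eucl n) 1,
      suppFun (K t) x + (s - t) * (a + ⟪b, x⟫) ≤ suppFun (K s) x := by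
  obtain ⟨l, hl0, hl⟩ := (h.smooth t ht).exists_le_inner_curvMap
  obtain ⟨pa, hpa, pb, hpb, hpab⟩ := eventually_prod_iff.1 (h.eventually_lt_sub_div ht hab)
  obtain ⟨ε, hε, hεb⟩ := Metric.eventually_nhds_iff.1 hpb
  set δ := l * min ε 1 / 2 with hδ
  have hδ0 : 0 < δ := by positivity
  set w : ℝ → Eucl n → ℝ := fun s x =>
    suppFun (K s) x - suppFun (K t) x - (s - t) * (a + ⟪b, x⟫) with hw
  have hwt : ∀ s ∈ Set.Ico 0 T, ∀ x : Eucl n, Tendsto (fun u : ℝ × Eucl n => w u.1 u.2)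
      (𝓝[Set.Ico 0 T] s ×ˢ 𝓝 x) (𝓝 (w s x)) := by
    intro s hs x
    have h1 := h.isBodyFamily.tendsto_suppFun hs x
    have h2 : Tendsto (fun u : ℝ × Eucl n => suppFun (K t) u.2) (𝓝[Set.Ico 0 T] s ×ˢ 𝓝 x)
        (𝓝 (suppFun (K t) x)) := by
      have h3 := (h.isBodyFamily.tendsto_suppFun ht x).comp
        (((tendsto_const_pure (b := t)).mono_right (pure_le_nhdsWithin ht)).prodMk tendsto_snd :
        Tendsto (fun u : ℝ × Eucl n => (t, u.2)) (𝓝[Set.Ico 0 T] s ×ˢ 𝓝 x) _)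
      simpa only [Function.comp_def] using h3
    have h3 : Tendsto (fun u : ℝ × Eucl n => u.1) (𝓝[Set.Ico 0 T] s ×ˢ 𝓝 x) (𝓝 s) :=
      (tendsto_fst).mono_right nhdsWithin_le_nhds
    have h4 : Tendsto (fun u : ℝ × Eucl n => a + ⟪b, u.2⟫) (𝓝[Set.Ico 0 T] s ×ˢ 𝓝 x)
        (𝓝 (a + ⟪b, x⟫)) := ((tendsto_const_nhds (x := b)).inner (𝕜 := ℝ) tendsto_snd).const_add a
    exact (h1.sub h2).sub ((h3.sub_const t).mul h4)
  have hw0 (x : Eucl n) : w t x = 0 := by simp [hw]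
  have hev : ∀ᶠ s in 𝓝[Set.Ico 0 T] t, s ∈ Set.Ico 0 T ∧ pa s ∧ (s - t) * (-a) < δ ∧
      ∀ x ∈ Metric.sphere (0 : Eucl n) 1, -δ < w s x := by
    refine Eventually.and self_mem_nhdsWithin (hpa.and (.and ?_ ?_))
    · have : Tendsto (fun s => (s - t) * (-a)) (𝓝 t) (𝓝 ((t - t) * (-a))) :=
        Continuous.tendsto (by fun_prop) t
      rw [sub_self, zero_mul] at this
      exact (this.mono_left nhdsWithin_le_nhds).eventually_lt_const hδ0
    · refine eventually_forall_mem_of_isCompact (P := fun s x => -δ < w s x)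
        (isCompact_sphere _ _) fun x hx => ?_
      have h1 := hwt t ht x
      rw [hw0] at h1
      exact h1.eventually_const_lt (by linarith)
  have hev' := hev.filter_mono (nhdsGT_le_nhdsWithin_Ico ht)
  obtain ⟨u, hu, hQ⟩ := (mem_nhdsGT_iff_exists_Ioo_subset).1 hev'
  filter_upwards [Ioo_mem_nhdsGT hu] with s₁ hs₁ x₁ hx₁
  by_contra! hlt
  have hw1 : w s₁ x₁ < 0 := by simp only [hw]; linarith
  have hIcc : Set.Icc t s₁ ⊆ Set.Ico 0 T := fun s hs =>
    ⟨ht.1.trans hs.1, hs.2.trans_lt (hQ hs₁).1.2⟩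
  have hcont : ContinuousOn (fun v : ℝ × Eucl n => w v.1 v.2)
      (Set.Icc t s₁ ×ˢ Metric.sphere (0 : Eucl n) 1) := by
    rintro ⟨s, x⟩ ⟨hs, -⟩
    rw [ContinuousWithinAt, nhdsWithin_prod_eq]
    exact (hwt s (hIcc hs) x).mono_left
      (prod_mono (nhdsWithin_mono _ hIcc) nhdsWithin_le_nhds)
  obtain ⟨⟨s, x⟩, ⟨hs, hx⟩, hmin⟩ :=
    (isCompact_Icc.prod (isCompact_sphere (0 : Eucl n) 1)).exists_isMinOn
    ⟨(s₁, x₁), ⟨⟨hs₁.1.le, le_rfl⟩, hx₁⟩⟩ hcont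
  have hle : ∀ s' ∈ Set.Icc t s₁, ∀ y ∈ Metric.sphere (0 : Eucl n) 1, w s x ≤ w s' y :=
    fun s' hs' y hy => hmin (a := (s', y)) ⟨hs', hy⟩
  have hneg : w s x < 0 := (hle s₁ ⟨hs₁.1.le, le_rfl⟩ x₁ hx₁).trans_lt hw1
  have hts : t < s := lt_of_le_of_ne hs.1 fun he => by
    rw [← he, hw0] at hneg
    exact hneg.false
  obtain ⟨hsS, hpas, hsa, hws⟩ := hQ ⟨hts, hs.2.trans_lt hs₁.2⟩
  have hderiv : flowRHS q p f (K s) x - (a + ⟪b, x⟫) ≤ 0 := by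
    have h1 := (h.flow s hsS x hx).mono
      ((Set.Icc_subset_Icc_right hs.2).trans hIcc : Set.Icc t s ⊆ Set.Ico 0 T)
    have h2 : HasDerivWithinAt (fun s => w s x) (flowRHS q p f (K s) x - (a + ⟪b, x⟫))
        (Set.Icc t s) s := by
      have h3 : HasDerivWithinAt (fun s => (s - t) * (a + ⟪b, x⟫)) (1 * (a + ⟪b, x⟫))
        (Set.Icc t s) s := ((hasDerivWithinAt_id s _).sub_const t).mul_const _
      rw [one_mul] at h3
      exact (h1.sub_const _).sub h3
    exact h2.nonpos_of_isMinOn_Icc hts fun s' hs' => hle s' ⟨hs'.1, hs'.2.trans hs.2⟩ x hx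
  set m := -w s x - (s - t) * a with hm
  have hm0 : 0 ≤ m := by nlinarith
  have hm2 : m < 2 * δ := by linarith [hws x hx]
  have hml : m / l < min ε 1 := by
    rw [div_lt_iff₀ hl0]
    linarith
  have hcurv := (h.smooth t ht).pow_mul_curvDet_le_of_sub_le (h.smooth s hsS) hx
    (b := (s - t) • b) hm0 (by
      have := (hml.trans_le (min_le_right _ _))
      rwa [div_lt_one hl0] at this) (hl x hx) (fun y hy => by
      have := hle s hs y hy
      simp only [hm, hw, real_inner_smul_left] at this ⊢
      linarith) (by
      simp only [hm, hw, real_inner_smul_left]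
      ring)
  have hμ0 : 0 < 1 - m / l := by linarith [min_le_right ε 1]
  have hpbm : pb (1 - m / l) := hεb (by
    rw [Real.dist_eq, sub_sub_cancel_left, abs_neg, abs_of_nonneg (by positivity)]
    exact hml.trans_le (min_le_left _ _))
  have hfin := hpab hpas hpbm x hx
  have hdiv : flowSpeed q p f (K s) x / curvDet (suppFun (K s)) x ≤
      flowSpeed q p f (K s) x / ((1 - m / l) ^ n * curvDet (suppFun (K t)) x) :=
    div_le_div_of_nonneg_left (h.flowSpeed_nonneg hsS hx)
      (mul_pos (pow_pos hμ0 n) ((h.smooth t ht).curvDet_pos hx)) hcurv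
  rw [flowRHS_eq] at hderiv
  dsimp only at hfin
  linarith

end IsSmoothFlow

end

section

variable {n : ℕ} {q p T : ℝ} {f : Eucl n → ℝ} {K : ℝ → Set (Eucl n)} {s t : ℝ} {x ω : Eucl n}

namespace IsSmoothFlow

theorem exists_abs_flowRHS_le (h : IsSmoothFlow q p T f K) (ht : t ∈ Set.Ico 0 T) :
    ∃ C, 0 ≤ C ∧ ∀ x ∈ Metric.sphere (0 : Eucl n) 1, |flowRHS q p f (K t) x| ≤ C := by
  obtain ⟨C, hC⟩ := (isCompact_sphere (0 : Eucl n) 1).exists_bound_of_continuousOn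
    (h.continuousOn_flowRHS ht)
  exact ⟨max C 0, le_max_right _ _, fun x hx => (hC x hx).trans (le_max_left _ _)⟩

theorem flowRHS_le_suppFun (h : IsSmoothFlow q p T f K) (ht : t ∈ Set.Ico 0 T)
    (hx : x ∈ Metric.sphere (0 : Eucl n) 1) : flowRHS q p f (K t) x ≤ suppFun (K t) x := by
  rw [flowRHS_eq]
  have := div_nonneg (h.flowSpeed_nonneg ht hx) ((h.smooth t ht).curvDet_pos hx).le
  linarith

theorem suppFun_le_exp_mul (h : IsSmoothFlow q p T f K) (ht : 0 ≤ t) (hts : t ≤ s) (hs : s < T)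
    (hx : x ∈ Metric.sphere (0 : Eucl n) 1) :
    suppFun (K s) x ≤ Real.exp (s - t) * suppFun (K t) x := by
  have hd : ∀ r ∈ Set.Ico 0 T, HasDerivWithinAt (fun r => Real.exp (t - r) * suppFun (K r) x)
      (Real.exp (t - r) * (flowRHS q p f (K r) x - suppFun (K r) x)) (Set.Ico 0 T) r := by
    intro r hr
    have h1 : HasDerivWithinAt (fun r => Real.exp (t - r)) (Real.exp (t - r) * (-1))
        (Set.Ico 0 T) r := ((hasDerivWithinAt_id r _).const_sub t).exp
    exact (h1.mul (h.flow r hr x hx)).congr_deriv (by ring)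
  have hsub : Set.Icc t s ⊆ Set.Ico 0 T := fun r hr => ⟨ht.trans hr.1, hr.2.trans_lt hs⟩
  have key := image_le_of_deriv_right_le_deriv_boundary (B := fun _ => suppFun (K t) x)
    (B' := fun _ => 0)
    (fun r hr => ((hd r (hsub hr)).mono hsub).continuousWithinAt)
    (fun r hr => (hd r (hsub ⟨hr.1, hr.2.le⟩)).mono_of_mem_nhdsWithin
      (mem_of_superset (Ico_mem_nhdsGE hr.2)
        fun u hu => hsub ⟨hr.1.trans hu.1, hu.2.le⟩)) (by simp) continuousOn_const
    (fun r _ => hasDerivWithinAt_const r _ _) (fun r hr =>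
      mul_nonpos_of_nonneg_of_nonpos (Real.exp_pos _).le
        (sub_nonpos.2 (h.flowRHS_le_suppFun (hsub ⟨hr.1, hr.2.le⟩) hx))) ⟨hts, le_rfl⟩
  have h2 := mul_le_mul_of_nonneg_left key (Real.exp_pos (s - t)).le
  rwa [← mul_assoc, ← Real.exp_add, sub_add_sub_cancel, sub_self, Real.exp_zero, one_mul] at h2

/-- The radial function of one body of the flow at a boundary point of another is at most the
ratio of their support functions at the normal of that point. -/
theorem radFun_mul_suppFun_le (h : IsSmoothFlow q p T f K) (ht : t ∈ Set.Ico 0 T)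
    (hs : s ∈ Set.Ico 0 T) (hω : ω ∈ Metric.sphere (0 : Eucl n) 1) :
    radFun (K s) (gradient (suppFun (K t)) ω) * suppFun (K t) ω ≤ suppFun (K s) ω := by
  have hω0 : ω ≠ 0 := Metric.ne_of_mem_sphere hω one_ne_zero
  have h1 := inner_le_suppFun (h.smooth s hs).isBody.isCompact ω
    ((h.smooth s hs).isBody.radFun_mem ((h.smooth t ht).gradient_ne_zero hω0)).2
  rwa [real_inner_smul_right, (h.smooth t ht).inner_gradient hω0] at h1

theorem exists_barrier (h : IsSmoothFlow q p T f K) (ht : t ∈ Set.Ico 0 T)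
    (hω : ω ∈ Metric.sphere (0 : Eucl n) 1) {d : ℝ} (hd : d < flowRHS q p f (K t) ω) :
    ∃ M, d ≤ M ∧ ∀ x ∈ Metric.sphere (0 : Eucl n) 1,
      d - M * (1 - ⟪ω, x⟫) < flowRHS q p f (K t) x := by
  obtain ⟨C, hC0, hC⟩ := h.exists_abs_flowRHS_le ht
  have hω1 : ‖ω‖ = 1 := by simpa using hω
  have hev : ∀ᶠ M : ℝ in atTop, ∀ x ∈ Metric.sphere (0 : Eucl n) 1,
      x ∈ Metric.sphere (0 : Eucl n) 1 → d - M * (1 - ⟪ω, x⟫) < flowRHS q p f (K t) x := by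
    refine eventually_forall_mem_of_isCompact
      (P := fun (M : ℝ) x => x ∈ Metric.sphere (0 : Eucl n) 1 →
        d - M * (1 - ⟪ω, x⟫) < flowRHS q p f (K t) x) (isCompact_sphere _ _) fun x hx => ?_
    have hx1 : ‖x‖ = 1 := by simpa using hx
    rcases eq_or_ne x ω with rfl | hne
    · have h1 : ∀ᶠ y in 𝓝 x, y ∈ Metric.sphere (0 : Eucl n) 1 → d < flowRHS q p f (K t) y :=
        eventually_nhdsWithin_iff.1 ((h.continuousOn_flowRHS ht x hx).eventually_const_lt hd)
      filter_upwards [tendsto_fst.eventually (eventually_ge_atTop (0 : ℝ)),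
        tendsto_snd.eventually h1] with u hu1 hu2 hy
      have hy1 : ‖u.2‖ = 1 := by simpa using hy
      have h3 : ⟪x, u.2⟫ ≤ 1 := by
        simpa [hx1, hy1] using real_inner_le_norm x u.2
      nlinarith [hu2 hy]
    · have h1 : ⟪ω, x⟫ < 1 := by
        refine lt_of_le_of_ne (by simpa [hx1, hω1] using real_inner_le_norm ω x) fun he => hne ?_
        exact ((inner_eq_one_iff_of_norm_eq_one hω1 hx1).1 he).symm
      have h2 : Tendsto (fun u : ℝ × Eucl n => u.1 * (1 - ⟪ω, u.2⟫)) (atTop ×ˢ 𝓝 x) atTop := by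
        refine Tendsto.atTop_mul_pos (sub_pos.2 h1) tendsto_fst ?_
        exact ((tendsto_const_nhds (x := ω)).inner (𝕜 := ℝ) tendsto_snd).const_sub 1
      filter_upwards [h2.eventually_gt_atTop (d + C)] with u hu hy
      linarith [(abs_le.1 (hC _ hy)).1]
  obtain ⟨M, hM, hMd⟩ := (hev.and (eventually_ge_atTop d)).exists
  exact ⟨M, hMd, fun x hx => hM x hx hx⟩

theorem eventually_le_radFun (h : IsSmoothFlow q p T f K) (ht : t ∈ Set.Ico 0 T)
    (hω : ω ∈ Metric.sphere (0 : Eucl n) 1) {c : ℝ}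
    (hc : c < flowRHS q p f (K t) ω / suppFun (K t) ω) :
    ∀ᶠ s in 𝓝[>] t, 1 + c * (s - t) ≤ radFun (K s) (gradient (suppFun (K t)) ω) := by
  have hω0 : ω ≠ 0 := Metric.ne_of_mem_sphere hω one_ne_zero
  have hω1 : ‖ω‖ = 1 := by simpa using hω
  have hKt := h.smooth t ht
  set G := gradient (suppFun (K t)) ω
  rw [lt_div_iff₀ (h.suppFun_pos ht hω)] at hc
  obtain ⟨d, hcd, hd⟩ := exists_between hc
  obtain ⟨M, hdM, hM⟩ := h.exists_barrier ht hω hd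
  have hbar := h.eventually_add_le_suppFun ht (a := d - M) (b := M • ω) (by linarith)
    fun x hx => by
      have := hM x hx
      rw [real_inner_smul_left]
      linarith
  set U := {x : Eucl n | c * ⟪x, G⟫ < d - M * (1 - ⟪ω, x⟫)}
  have hU : IsOpen U := isOpen_lt (by fun_prop) (by fun_prop)
  have hωU : ω ∈ U := by
    change c * ⟪ω, G⟫ < d - M * (1 - ⟪ω, ω⟫)
    rw [hKt.inner_gradient hω0, real_inner_self_eq_norm_sq, hω1]
    linarith
  have hfar : ∀ᶠ s in 𝓝[Set.Ico 0 T] t, ∀ x ∈ Metric.sphere (0 : Eucl n) 1 \ U,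
      (1 + c * (s - t)) * ⟪x, G⟫ < suppFun (K s) x := by
    refine eventually_forall_mem_of_isCompact
      (P := fun s x => (1 + c * (s - t)) * ⟪x, G⟫ < suppFun (K s) x)
      ((isCompact_sphere _ _).diff hU) fun x hx => ?_
    have h1 := h.isBodyFamily.tendsto_suppFun ht x
    have h2 : Tendsto (fun u : ℝ × Eucl n => (1 + c * (u.1 - t)) * ⟪u.2, G⟫)
        (𝓝 t ×ˢ 𝓝 x) (𝓝 ((1 + c * (t - t)) * ⟪x, G⟫)) := by
      rw [← nhds_prod_eq]
      exact Continuous.tendsto (by fun_prop) (t, x)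
    refine (h2.mono_left (prod_mono nhdsWithin_le_nhds le_rfl)).eventually_lt h1 ?_
    rw [sub_self, mul_zero, add_zero, one_mul]
    exact hKt.inner_gradient_lt hx.1 hω fun he => hx.2 (he ▸ hωU)
  filter_upwards [hbar, hfar.filter_mono (nhdsGT_le_nhdsWithin_Ico ht),
    (eventually_mem_nhdsWithin).filter_mono (nhdsGT_le_nhdsWithin_Ico ht),
    self_mem_nhdsWithin] with s hs1 hs2 hsS hst
  have hts : 0 < s - t := sub_pos.2 hst
  refine (h.smooth s hsS).isBody.le_radFun (hKt.gradient_ne_zero hω0)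
    ((h.smooth s hsS).isBody.mem_of_forall_inner_le fun x hx => ?_)
  rw [real_inner_smul_right]
  by_cases hxU : x ∈ U
  · have h1 := hs1 x hx
    have h2 : c * ⟪x, G⟫ < d - M * (1 - ⟪ω, x⟫) := hxU
    have h3 := inner_le_suppFun hKt.isBody.isCompact x (hKt.gradient_mem hω0)
    rw [real_inner_smul_left] at h1
    nlinarith [mul_lt_mul_of_pos_left h2 hts]
  · exact (hs2 x ⟨hx, hxU⟩).le

theorem exists_one_sub_le_radFun (h : IsSmoothFlow q p T f K) (ht : t ∈ Set.Ico 0 T) :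
    ∃ C, ∀ᶠ s in 𝓝[>] t, ∀ ω ∈ Metric.sphere (0 : Eucl n) 1,
      1 - C * (s - t) ≤ radFun (K s) (gradient (suppFun (K t)) ω) := by
  have hKt := h.smooth t ht
  obtain ⟨C, hC0, hC⟩ := h.exists_abs_flowRHS_le ht
  obtain ⟨r, hr0, hr⟩ : ∃ r > 0, ∀ x ∈ Metric.sphere (0 : Eucl n) 1, r ≤ suppFun (K t) x :=
    (isCompact_sphere _ _).exists_forall_le' (a := 0)
      (fun x hx => (hKt.differentiableAt_suppFun
        (Metric.ne_of_mem_sphere hx one_ne_zero)).continuousAt.continuousWithinAt)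
      fun x hx => h.suppFun_pos ht hx
  have hbar := h.eventually_add_le_suppFun ht (a := -(C + 1)) (b := 0) (by linarith)
    fun x hx => by
      rw [inner_zero_left]
      linarith [(abs_le.1 (hC x hx)).1]
  have hlt : ∀ᶠ s in 𝓝[>] t, 0 < 1 - (C + 1) / r * (s - t) := by
    have : Tendsto (fun s => 1 - (C + 1) / r * (s - t)) (𝓝 t)
      (𝓝 (1 - (C + 1) / r * (t - t))) := Continuous.tendsto (by fun_prop) t
    rw [sub_self, mul_zero, sub_zero] at this
    exact (this.mono_left nhdsWithin_le_nhds).eventually_const_lt one_pos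
  refine ⟨(C + 1) / r, ?_⟩
  filter_upwards [hbar, hlt,
    (eventually_mem_nhdsWithin).filter_mono (nhdsGT_le_nhdsWithin_Ico ht),
    self_mem_nhdsWithin] with s hs1 hs2 hsS hst ω hω
  have hω0 : ω ≠ 0 := Metric.ne_of_mem_sphere hω one_ne_zero
  have hts : 0 < s - t := sub_pos.2 hst
  refine (h.smooth s hsS).isBody.le_radFun (hKt.gradient_ne_zero hω0)
    ((h.smooth s hsS).isBody.mem_of_forall_inner_le fun x hx => ?_)
  rw [real_inner_smul_right]
  have h1 := hs1 x hx
  rw [inner_zero_left, add_zero] at h1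
  have h2 := inner_le_suppFun hKt.isBody.isCompact x (hKt.gradient_mem hω0)
  have h3 : C + 1 ≤ (C + 1) / r * suppFun (K t) x := by
    rw [div_mul_eq_mul_div, le_div_iff₀ hr0]
    exact mul_le_mul_of_nonneg_left (hr x hx) (by linarith)
  have h4 := mul_le_mul_of_nonneg_left h2 hs2.le
  have h5 := mul_le_mul_of_nonneg_left h3 hts.le
  linarith

theorem tendsto_radFun_sub_div (h : IsSmoothFlow q p T f K) (ht : t ∈ Set.Ico 0 T)
    (hω : ω ∈ Metric.sphere (0 : Eucl n) 1) :
    Tendsto (fun s => (s - t)⁻¹ * (radFun (K s) (gradient (suppFun (K t)) ω) - 1)) (𝓝[>] t)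
      (𝓝 (flowRHS q p f (K t) ω / suppFun (K t) ω)) := by
  have hpos := h.suppFun_pos ht hω
  have hS := (eventually_mem_nhdsWithin).filter_mono (nhdsGT_le_nhdsWithin_Ico ht)
  refine tendsto_order.2 ⟨fun c hc => ?_, fun c hc => ?_⟩
  · obtain ⟨c', hcc', hc'⟩ := exists_between hc
    filter_upwards [h.eventually_le_radFun ht hω hc', self_mem_nhdsWithin] with s hs hst
    have hts : 0 < s - t := sub_pos.2 hst
    refine hcc'.trans_le ?_
    rw [inv_mul_eq_div, le_div_iff₀ hts]
    linarith
  · have h1 : Tendsto (fun s => (s - t)⁻¹ * (suppFun (K s) ω - suppFun (K t) ω)) (𝓝[>] t)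
        (𝓝 (flowRHS q p f (K t) ω)) := by
      exact (hasDerivWithinAt_iff_tendsto_slope' (by simp)).1
        ((h.flow t ht ω hω).mono_of_mem_nhdsWithin
          (nhdsGT_le_nhdsWithin_Ico ht self_mem_nhdsWithin))
    filter_upwards [(h1.div_const (suppFun (K t) ω)).eventually_lt_const hc, hS,
      self_mem_nhdsWithin] with s hs hsS hst
    have hts : 0 < s - t := sub_pos.2 hst
    refine lt_of_le_of_lt ?_ hs
    rw [le_div_iff₀ hpos, mul_assoc]
    refine mul_le_mul_of_nonneg_left ?_ (inv_nonneg.2 hts.le)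
    linarith [h.radFun_mul_suppFun_le ht hsS hω]

theorem exists_abs_radFun_sub_one_le (h : IsSmoothFlow q p T f K) (ht : t ∈ Set.Ico 0 T) :
    ∃ C, ∀ᶠ s in 𝓝[>] t, ∀ ω ∈ Metric.sphere (0 : Eucl n) 1,
      |radFun (K s) (gradient (suppFun (K t)) ω) - 1| ≤ C * (s - t) := by
  obtain ⟨C, hC⟩ := h.exists_one_sub_le_radFun ht
  refine ⟨max C 2, ?_⟩
  filter_upwards [hC, Ioo_mem_nhdsGT (lt_add_one t),
    (eventually_mem_nhdsWithin).filter_mono (nhdsGT_le_nhdsWithin_Ico ht)] with s hs1 hs2 hsS ω hω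
  have hts : 0 < s - t := sub_pos.2 hs2.1
  have hpos := h.suppFun_pos ht hω
  have h1 := (h.radFun_mul_suppFun_le ht hsS hω).trans
    (h.suppFun_le_exp_mul ht.1 hs2.1.le hsS.2 hω)
  have h2 := le_of_mul_le_mul_right h1 hpos
  have h3 := Real.abs_exp_sub_one_le (x := s - t) (by
    rw [abs_of_pos hts]
    linarith [hs2.2])
  rw [abs_of_pos hts] at h3
  have h4 := (abs_le.1 h3).2
  rw [abs_le]
  constructor
  · nlinarith [hs1 ω hω, le_max_left C 2]
  · nlinarith [le_max_right C 2]

end IsSmoothFlow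

end

section

theorem tendsto_mul_intervalIntegral {α : Type*} {l : Filter α} {φ : α → ℝ → ℝ} {R κ : α → ℝ}
    {a c L : ℝ} (hφ : ∀ᶠ s in l, Continuous (φ s))
    (hL : Tendsto (fun u : α × ℝ => φ u.1 u.2) (l ×ˢ 𝓝 a) (𝓝 L)) (hR : Tendsto R l (𝓝 a))
    (hκ : Tendsto (fun s => κ s * (R s - a)) l (𝓝 c)) :
    Tendsto (fun s => κ s * ∫ r in a..R s, φ s r) l (𝓝 (c * L)) := by
  have ho : (fun s => ∫ r in a..R s, (φ s r - L)) =o[l] fun s => R s - a := by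
    refine Asymptotics.isLittleO_iff.2 fun ε hε => ?_
    have h1 : ∀ᶠ u : α × ℝ in l ×ˢ 𝓝 a, ‖φ u.1 u.2 - L‖ < ε := by
      have := (hL.sub_const L).norm
      rw [sub_self, norm_zero] at this
      exact this.eventually_lt_const hε
    obtain ⟨pa, hpa, pb, hpb, hab⟩ := eventually_prod_iff.1 h1
    obtain ⟨δ, hδ, hδb⟩ := Metric.eventually_nhds_iff.1 hpb
    filter_upwards [hpa, hR.eventually (Metric.ball_mem_nhds a hδ)] with s hs hRs
    rw [Real.norm_eq_abs (R s - a)]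
    refine intervalIntegral.norm_integral_le_of_norm_le_const fun r hr => ?_
    refine (hab hs (hδb ?_)).le
    have hr' := Set.abs_sub_left_of_mem_uIcc (Set.uIoc_subset_uIcc hr)
    rw [Real.dist_eq]
    exact hr'.trans_lt (by simpa [Real.dist_eq] using hRs)
  have h2 : Tendsto (fun s => κ s * ∫ r in a..R s, (φ s r - L)) l (𝓝 0) :=
    (Asymptotics.isLittleO_one_iff ℝ).1
      (((Asymptotics.isBigO_refl κ l).mul_isLittleO ho).trans_isBigO (hκ.isBigO_one ℝ))
  have h3 := (hκ.mul_const L).add h2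
  rw [add_zero] at h3
  refine h3.congr' ?_
  filter_upwards [hφ] with s hs
  rw [intervalIntegral.integral_sub (hs.intervalIntegrable _ _) (by simp),
    intervalIntegral.integral_const, smul_eq_mul]
  ring

end

section

variable {n : ℕ} {K L : Set (Eucl n)} {F : Eucl n → ℝ}

namespace IsSmoothBody

theorem integral_Ioi_indicator_gauss (hK : IsSmoothBody K) (hL : IsBody L) {w : Eucl n}
    (hw : w ∈ Metric.sphere (0 : Eucl n) 1) :
    ∫ r in Set.Ioi (0 : ℝ), r ^ (n - 1) * (suppFun K w * curvDet (suppFun K) w *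
        L.indicator F (r • gradient (suppFun K) w)) =
      suppFun K w * curvDet (suppFun K) w *
        ∫ r in (0)..radFun L (gradient (suppFun K) w), r ^ (n - 1) *
          F (r • gradient (suppFun K) w) := by
  have hG := hK.gradient_ne_zero (Metric.ne_of_mem_sphere hw one_ne_zero)
  rw [intervalIntegral.integral_of_le (hL.radFun_mem hG).1.le, ← integral_const_mul,
    ← Set.Ioi_inter_Iic, ← setIntegral_indicator measurableSet_Iic]
  refine setIntegral_congr_fun measurableSet_Ioi fun r hr => ?_
  have hiff := hL.smul_mem_iff_le_radFun hG (le_of_lt (Set.mem_Ioi.1 hr))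
  by_cases h : r ≤ radFun L (gradient (suppFun K) w)
  · simp only [Set.indicator_of_mem (hiff.2 h), Set.indicator_of_mem (Set.mem_Iic.2 h)]
    ring
  · simp only [Set.indicator_of_notMem (mt hiff.1 h), Set.indicator_of_notMem (mt Set.mem_Iic.1 h),
      mul_zero]

theorem setIntegral_eq_gauss (hK : IsSmoothBody K) (hn : n ≠ 0) (hL : IsBody L)
    (hF : Continuous F) :
    ∫ y in L, F y = ∫ w : Metric.sphere (0 : Eucl n) 1,
      suppFun K w * curvDet (suppFun K) w *
        (∫ r in (0)..radFun L (gradient (suppFun K) w), r ^ (n - 1) *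
          F (r • gradient (suppFun K) w)) ∂(volume : Measure (Eucl n)).toSphere := by
  have hLm := hL.isCompact.isClosed.measurableSet
  have hi : Integrable (L.indicator F) :=
    (integrable_indicator_iff hLm).2 (hF.continuousOn.integrableOn_compact hL.isCompact)
  rw [← integral_indicator hLm, hK.integral_gauss hn hi]
  simp only [hK.integral_Ioi_indicator_gauss hL (Subtype.coe_prop _)]

theorem integrable_setIntegral_gauss (hK : IsSmoothBody K) (hn : n ≠ 0) (hL : IsBody L)
    (hF : Continuous F) :
    Integrable (fun w : Metric.sphere (0 : Eucl n) 1 =>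
      suppFun K w * curvDet (suppFun K) w *
        ∫ r in (0)..radFun L (gradient (suppFun K) w), r ^ (n - 1) *
          F (r • gradient (suppFun K) w)) (volume : Measure (Eucl n)).toSphere := by
  have hLm := hL.isCompact.isClosed.measurableSet
  have hi : Integrable (L.indicator F) :=
    (integrable_indicator_iff hLm).2 (hF.continuousOn.integrableOn_compact hL.isCompact)
  refine (hK.integrable_gauss hn hi).congr (Eventually.of_forall fun w => ?_)
  simp only [hK.integral_Ioi_indicator_gauss hL (Subtype.coe_prop w)]

theorem intervalIntegral_sub_gauss (hK : IsSmoothBody K) (hF : Continuous F)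
    {w : Eucl n} (hw : w ∈ Metric.sphere (0 : Eucl n) 1) :
    suppFun K w * curvDet (suppFun K) w *
        (∫ r in (0)..radFun L (gradient (suppFun K) w), r ^ (n - 1) *
          F (r • gradient (suppFun K) w)) -
      suppFun K w * curvDet (suppFun K) w *
        (∫ r in (0)..radFun K (gradient (suppFun K) w), r ^ (n - 1) *
          F (r • gradient (suppFun K) w)) =
    suppFun K w * curvDet (suppFun K) w *
        ∫ r in (1)..radFun L (gradient (suppFun K) w), r ^ (n - 1) *
          F (r • gradient (suppFun K) w) := by
  have hc : Continuous fun r : ℝ => r ^ (n - 1) * F (r • gradient (suppFun K) w) := by fun_prop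
  rw [hK.radFun_gradient (Metric.ne_of_mem_sphere hw one_ne_zero), ← mul_sub,
    intervalIntegral.integral_interval_sub_left (hc.intervalIntegrable _ _)
      (hc.intervalIntegrable _ _)]

theorem setIntegral_sub_eq_gauss (hK : IsSmoothBody K) (hn : n ≠ 0) (hL : IsBody L)
    (hF : Continuous F) :
    (∫ y in L, F y) - ∫ y in K, F y = ∫ w : Metric.sphere (0 : Eucl n) 1,
      suppFun K w * curvDet (suppFun K) w *
        (∫ r in (1)..radFun L (gradient (suppFun K) w), r ^ (n - 1) *
          F (r • gradient (suppFun K) w)) ∂(volume : Measure (Eucl n)).toSphere := by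
  rw [hK.setIntegral_eq_gauss hn hL hF, hK.setIntegral_eq_gauss hn hK.isBody hF,
    ← integral_sub (hK.integrable_setIntegral_gauss hn hL hF)
      (hK.integrable_setIntegral_gauss hn hK.isBody hF)]
  simp only [hK.intervalIntegral_sub_gauss hF (Subtype.coe_prop _)]

theorem integrable_setIntegral_sub_gauss (hK : IsSmoothBody K) (hn : n ≠ 0) (hL : IsBody L)
    (hF : Continuous F) :
    Integrable (fun w : Metric.sphere (0 : Eucl n) 1 => suppFun K w * curvDet (suppFun K) w *
        (∫ r in (1)..radFun L (gradient (suppFun K) w), r ^ (n - 1) *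
          F (r • gradient (suppFun K) w))) (volume : Measure (Eucl n)).toSphere := by
  refine ((hK.integrable_setIntegral_gauss hn hL hF).sub
    (hK.integrable_setIntegral_gauss hn hK.isBody hF)).congr (Eventually.of_forall fun w => ?_)
  exact hK.intervalIntegral_sub_gauss hF w.2

end IsSmoothBody

end

section

variable {n : ℕ} {q p T : ℝ} {f : Eucl n → ℝ} {K : ℝ → Set (Eucl n)} {t : ℝ} {ω : Eucl n}

namespace IsSmoothFlow

/-- The integral of the normal speed against `Ṽ` vanishes, by the choice of `θ`. -/
theorem integral_curvDet_mul_flowRHS (h : IsSmoothFlow q p T f K) (ht : t ∈ Set.Ico 0 T) :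
    ∫ w : Metric.sphere (0 : Eucl n) 1, suppFun (K t) w * curvDet (suppFun (K t)) w *
      (flowRHS q p f (K t) w / suppFun (K t) w * Vtilde q (K t) (gradient (suppFun (K t)) w))
        ∂(volume : Measure (Eucl n)).toSphere = 0 := by
  have hKt := h.smooth t ht
  have hV := continuous_vtilde h.ne_zero h.one_lt hKt.isBody
  have hS0 : ∀ w ∈ Metric.sphere (0 : Eucl n) 1, w ≠ 0 := fun w hw =>
    Metric.ne_of_mem_sphere hw one_ne_zero
  have h_int : ∀ φ : Eucl n → ℝ, ContinuousOn φ (Metric.sphere (0 : Eucl n) 1) →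
      Integrable (fun w : Metric.sphere (0 : Eucl n) 1 => φ w)
        (volume : Measure (Eucl n)).toSphere := fun φ hφ =>
    (continuousOn_iff_continuous_domRestrict.1 hφ).integrable_of_hasCompactSupport
      (HasCompactSupport.of_compactSpace _)
  have hi1 := h_int (fun w => suppFun (K t) w * curvDet (suppFun (K t)) w *
      Vtilde q (K t) (gradient (suppFun (K t)) w)) fun w hw => by
    refine ContinuousAt.continuousWithinAt (((hKt.differentiableAt_suppFun
      (hS0 w hw)).continuousAt.mul (hKt.continuousOn_curvDet.continuousAt
      (isOpen_compl_singleton.mem_nhds (hS0 w hw)))).mul ?_)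
    exact ContinuousAt.comp (g := Vtilde q (K t)) hV.continuousAt
      (hKt.differentiableAt_gradient (hS0 w hw)).continuousAt
  have hi2 := (h_int _ (h.continuousOn_suppFun_rpow ht)).const_mul (theta q p f (K t))
  have hpt : ∀ w : Metric.sphere (0 : Eucl n) 1,
      suppFun (K t) w * curvDet (suppFun (K t)) w * (flowRHS q p f (K t) w / suppFun (K t) w *
        Vtilde q (K t) (gradient (suppFun (K t)) w)) =
      suppFun (K t) w * curvDet (suppFun (K t)) w * Vtilde q (K t) (gradient (suppFun (K t)) w) -
        theta q p f (K t) * (suppFun (K t) w ^ p * f w) := fun w => by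
    have h1 := (h.suppFun_pos ht w.2).ne'
    have h2 := (hKt.curvDet_pos w.2).ne'
    have h3 := (vtilde_pos h.ne_zero h.one_lt hKt.isBody (gradient (suppFun (K t)) w)).ne'
    rw [flowRHS_eq, flowSpeed]
    field_simp
  simp only [hpt]
  rw [integral_sub hi1 hi2, integral_const_mul, h.theta_eq,
    div_mul_cancel₀ _ (h.integral_suppFun_rpow_pos ht).ne',
    hKt.integral_radFun_eq_integral_gradient h.ne_zero hV, sub_self]

theorem tendsto_gaussChord_kernel (h : IsSmoothFlow q p T f K) (ht : t ∈ Set.Ico 0 T)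
    (y : Eucl n) :
    Tendsto (fun u : ℝ × ℝ => u.2 ^ (n - 1) *
        ((Vtilde q (K u.1) (u.2 • y) + Vtilde q (K t) (u.2 • y)) / 2)) (𝓝[>] t ×ˢ 𝓝 1)
      (𝓝 (Vtilde q (K t) y)) := by
  have hr : Tendsto (fun u : ℝ × ℝ => u.2) (𝓝[>] t ×ˢ 𝓝 1) (𝓝 1) := tendsto_snd
  have hy : Tendsto (fun u : ℝ × ℝ => u.2 • y) (𝓝[>] t ×ˢ 𝓝 1) (𝓝 y) := by
    simpa using hr.smul_const y
  have h1 : Tendsto (fun u : ℝ × ℝ => Vtilde q (K u.1) (u.2 • y)) (𝓝[>] t ×ˢ 𝓝 1)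
      (𝓝 (Vtilde q (K t) y)) := by
    simpa only [Function.comp_def] using
      (h.isBodyFamily.tendsto_vtilde h.ne_zero h.one_lt ht y).comp
        ((tendsto_fst.mono_right (nhdsGT_le_nhdsWithin_Ico ht)).prodMk hy)
  have h2 : Tendsto (fun u : ℝ × ℝ => Vtilde q (K t) (u.2 • y)) (𝓝[>] t ×ˢ 𝓝 1)
      (𝓝 (Vtilde q (K t) y)) := by
    simpa only [Function.comp_def] using
      ((continuous_vtilde h.ne_zero h.one_lt (h.smooth t ht).isBody).tendsto y).comp hy
  have h3 := (hr.pow (n - 1)).mul ((h1.add h2).div_const 2)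
  rwa [one_pow, one_mul, add_self_div_two] at h3

theorem exists_abs_kernel_le (h : IsSmoothFlow q p T f K) (ht : t ∈ Set.Ico 0 T) :
    ∃ B, ∀ᶠ s in 𝓝[>] t, ∀ y ∈ K t, ∀ r ∈ Set.Icc (0 : ℝ) 2,
      ‖r ^ (n - 1) * ((Vtilde q (K s) (r • y) + Vtilde q (K t) (r • y)) / 2)‖ ≤ B := by
  obtain ⟨R, hR0, hR⟩ := h.isBodyFamily.eventually_subset_closedBall ht
  have hKt := hR.self_of_nhdsWithin ht
  have hsub : Metric.closedBall (0 : Eucl n) R ⊆ Metric.closedBall 0 (2 * R) :=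
    Metric.closedBall_subset_closedBall (by linarith)
  set V := 2 * ∫ u in Metric.closedBall (0 : Eucl n) (2 * (2 * R)), chordKernel q u
  refine ⟨2 ^ (n - 1) * V, ?_⟩
  filter_upwards [hR.filter_mono (nhdsGT_le_nhdsWithin_Ico ht),
    (eventually_mem_nhdsWithin).filter_mono (nhdsGT_le_nhdsWithin_Ico ht)] with s hs hsS y hy r hr
  have hyR : ‖r • y‖ ≤ 2 * R := by
    rw [norm_smul, Real.norm_of_nonneg hr.1]
    exact mul_le_mul hr.2 (by simpa using hKt hy) (norm_nonneg _) (by norm_num)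
  have hV : ∀ u ∈ Set.Ico 0 T, K u ⊆ Metric.closedBall 0 R → Vtilde q (K u) (r • y) ≤ V :=
    fun u hu hKu => vtilde_le h.ne_zero h.one_lt
      (h.smooth u hu).isBody.isCompact.isClosed.measurableSet (hKu.trans hsub) hyR
  have h1 := hV s hsS hs
  have h2 := hV t ht hKt
  have h3 := vtilde_nonneg q (K s) (r • y)
  have h4 := vtilde_nonneg q (K t) (r • y)
  have h5 := pow_nonneg hr.1 (n - 1)
  rw [Real.norm_of_nonneg (by positivity)]
  exact mul_le_mul (pow_le_pow_left₀ hr.1 hr.2 _) (by linarith) (by linarith) (by positivity)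

theorem hasDerivWithinAt_gaussChord (h : IsSmoothFlow q p T f K) (ht : t ∈ Set.Ico 0 T) :
    HasDerivWithinAt (fun s => gaussChord q (K s)) 0 (Set.Ici t) t := by
  rw [← hasDerivWithinAt_Ioi_iff_Ici, hasDerivWithinAt_iff_tendsto_slope' (by simp),
    ← h.integral_curvDet_mul_flowRHS ht]
  have hKt := h.smooth t ht
  have hS := (eventually_mem_nhdsWithin).filter_mono (nhdsGT_le_nhdsWithin_Ico ht)
  have hcont : ∀ s ∈ Set.Ico 0 T, Continuous fun y => (Vtilde q (K s) y + Vtilde q (K t) y) / 2 :=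
    fun s hs => ((continuous_vtilde h.ne_zero h.one_lt (h.smooth s hs).isBody).add
      (continuous_vtilde h.ne_zero h.one_lt hKt.isBody)).div_const 2
  set I : ℝ → Eucl n → ℝ := fun s w => ∫ r in (1)..radFun (K s) (gradient (suppFun (K t)) w),
    r ^ (n - 1) * ((Vtilde q (K s) (r • gradient (suppFun (K t)) w) +
      Vtilde q (K t) (r • gradient (suppFun (K t)) w)) / 2) with hI
  have hslope : ∀ᶠ s in 𝓝[>] t, ∫ w : Metric.sphere (0 : Eucl n) 1,
      suppFun (K t) w * curvDet (suppFun (K t)) w * ((s - t)⁻¹ * I s w)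
        ∂(volume : Measure (Eucl n)).toSphere = slope (fun s => gaussChord q (K s)) t s := by
    filter_upwards [hS] with s hs
    rw [slope_def_module, smul_eq_mul, gaussChord_sub_eq h.ne_zero h.one_lt (h.smooth s hs).isBody
      hKt.isBody, hKt.setIntegral_sub_eq_gauss h.ne_zero (h.smooth s hs).isBody (hcont s hs),
      ← integral_const_mul]
    refine integral_congr_ae (Eventually.of_forall fun w => ?_)
    simp only [hI]
    ring
  refine Tendsto.congr' hslope ?_
  obtain ⟨C, hC⟩ := h.exists_abs_radFun_sub_one_le ht
  obtain ⟨B, hB⟩ := h.exists_abs_kernel_le ht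
  have hJ : Integrable (fun w : Metric.sphere (0 : Eucl n) 1 =>
      suppFun (K t) w * curvDet (suppFun (K t)) w) (volume : Measure (Eucl n)).toSphere := by
    have hc : ContinuousOn (fun w => suppFun (K t) w * curvDet (suppFun (K t)) w)
        (Metric.sphere (0 : Eucl n) 1) := fun w hw => by
      have hw0 : w ≠ 0 := Metric.ne_of_mem_sphere hw one_ne_zero
      exact ((hKt.differentiableAt_suppFun hw0).continuousAt.mul
        (hKt.continuousOn_curvDet.continuousAt
          (isOpen_compl_singleton.mem_nhds hw0))).continuousWithinAt
    exact (continuousOn_iff_continuous_domRestrict.1 hc).integrable_of_hasCompactSupport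
      (HasCompactSupport.of_compactSpace _)
  have hsmall : ∀ᶠ s in 𝓝[>] t, C * (s - t) < 1 := by
    have : Tendsto (fun s => C * (s - t)) (𝓝 t) (𝓝 (C * (t - t))) :=
      Continuous.tendsto (by fun_prop) t
    rw [sub_self, mul_zero] at this
    exact (this.mono_left nhdsWithin_le_nhds).eventually_lt_const one_pos
  refine tendsto_integral_filter_of_dominated_convergence
    (fun w => suppFun (K t) w * curvDet (suppFun (K t)) w * (B * C)) ?_ ?_ (hJ.mul_const _) ?_
  · filter_upwards [hS] with s hs
    refine (((hKt.integrable_setIntegral_sub_gauss h.ne_zero (h.smooth s hs).isBody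
      (hcont s hs)).const_mul (s - t)⁻¹).congr (Eventually.of_forall fun w => ?_)).1
    simp only [hI]
    ring
  · filter_upwards [hC, hB, hsmall, self_mem_nhdsWithin] with s hs1 hs2 hs3 hst
    refine Eventually.of_forall fun w => ?_
    have hts : 0 < s - t := sub_pos.2 hst
    have hw0 : (w : Eucl n) ≠ 0 := Metric.ne_of_mem_sphere w.2 one_ne_zero
    have hJ0 := (hKt.curvDet_mul_pos w.2).le
    have h1 := hs1 w w.2
    have h2 : ‖I s w‖ ≤ B * |radFun (K s) (gradient (suppFun (K t)) w) - 1| := by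
      refine intervalIntegral.norm_integral_le_of_norm_le_const fun r hr =>
        hs2 _ (hKt.gradient_mem hw0) r ?_
      have h3 := Set.abs_sub_left_of_mem_uIcc (Set.uIoc_subset_uIcc hr)
      have h4 := abs_le.1 (h3.trans (h1.trans hs3.le))
      exact ⟨by linarith, by linarith⟩
    have hB0 : 0 ≤ B := (norm_nonneg _).trans (hs2 _ (hKt.gradient_mem hw0) 0 (by simp))
    rw [norm_mul, Real.norm_of_nonneg hJ0, norm_mul, norm_inv, Real.norm_of_nonneg hts.le]
    refine mul_le_mul_of_nonneg_left ?_ hJ0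
    rw [inv_mul_le_iff₀ hts]
    calc ‖I s w‖ ≤ B * (C * (s - t)) := h2.trans (mul_le_mul_of_nonneg_left h1 hB0)
      _ = (s - t) * (B * C) := by ring
  · refine Eventually.of_forall fun w => Tendsto.const_mul _ ?_
    have hw0 : (w : Eucl n) ≠ 0 := Metric.ne_of_mem_sphere w.2 one_ne_zero
    refine tendsto_mul_intervalIntegral (φ := fun s r => r ^ (n - 1) *
      ((Vtilde q (K s) (r • gradient (suppFun (K t)) w) +
        Vtilde q (K t) (r • gradient (suppFun (K t)) w)) / 2)) ?_
      (h.tendsto_gaussChord_kernel ht _) ?_ (h.tendsto_radFun_sub_div ht w.2)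
    · filter_upwards [hS] with s hs
      have := hcont s hs
      exact (continuous_pow (n - 1)).mul (this.comp (continuous_id.smul continuous_const))
    · have h1 := (h.isBodyFamily.tendsto_radFun ht (hKt.gradient_ne_zero hw0)).comp
        (tendsto_id.prodMk tendsto_const_nhds)
      rw [hKt.radFun_gradient hw0] at h1
      exact h1.mono_left (nhdsGT_le_nhdsWithin_Ico ht)

theorem gaussChord_eq (h : IsSmoothFlow q p T f K) (ht : t ∈ Set.Ico 0 T) :
    gaussChord q (K t) = gaussChord q (K 0) := by
  have hsub : Set.Icc 0 t ⊆ Set.Ico 0 T := fun s hs => ⟨hs.1, hs.2.trans_lt ht.2⟩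
  refine constant_of_has_deriv_right_zero (f := fun s => gaussChord q (K s)) (fun s hs => ?_)
    (fun s hs => h.hasDerivWithinAt_gaussChord (hsub ⟨hs.1, hs.2.le⟩)) t ⟨ht.1, le_rfl⟩
  exact (h.isBodyFamily.tendsto_gaussChord h.ne_zero h.one_lt (hsub hs)).mono_left
    (nhdsWithin_mono _ hsub)

end IsSmoothFlow

end

/-- Lemma 3.1: the Gaussian chord integral is preserved along the
normalized Gauss curvature flow. -/
theorem gaussChord_invariant_along_flow
    (n : ℕ) (q p : ℝ) (hq : 1 < q) (T : ℝ) (hT : 0 < T)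
    (f : Eucl n → ℝ) (hf : ContDiff ℝ (⊤ : ℕ∞) f)
    (hfpos : ∀ x ∈ Metric.sphere (0 : Eucl n) 1, 0 < f x)
    (hfeven : ∀ x : Eucl n, f (-x) = f x)
    (K : ℝ → Set (Eucl n))
    (hsmooth : ∀ t ∈ Set.Ico (0 : ℝ) T, IsSmoothBody (K t))
    (hflow : IsGaussChordFlow q p f (Set.Ico 0 T) K) :
    ∀ t ∈ Set.Ico (0 : ℝ) T,
      HasDerivWithinAt (fun s => gaussChord q (K s)) 0 (Set.Ico 0 T) t ∧
      gaussChord q (K t) = gaussChord q (K 0) := by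
  have hconst : ∀ t ∈ Set.Ico (0 : ℝ) T, gaussChord q (K t) = gaussChord q (K 0) := by
    intro t ht
    rcases eq_or_ne n 0 with rfl | hn
    · have hK : ∀ s ∈ Set.Ico (0 : ℝ) T, K s = Set.univ := fun s hs =>
        Set.eq_univ_of_forall fun x =>
          Subsingleton.elim 0 x ▸ (hsmooth s hs).isBody.zero_mem
      rw [hK t ht, hK 0 ⟨le_rfl, hT⟩]
    · exact IsSmoothFlow.gaussChord_eq ⟨hn, hq, hf.continuous, hfpos, hsmooth, hflow⟩ ht
  exact fun t ht => ⟨(hasDerivWithinAt_const t _ (gaussChord q (K 0))).congr hconst (hconst t ht),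
    hconst t ht⟩
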